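/- There is no finitely generated abelian group G and free action φ of G on a Cantor set X giving a uniquely ergodic Cantor minimal G-system whose fundamental group equals {9^n : n ∈ ℤ}; i.e., {9^n : n ∈ ℤ} cannot be realized as F(R_{G,φ}) for any uniquely ergodic Cantor minimal system arising from a free action of a finitely generated abelian group. -/

import Mathlib

open MeasureTheory
open scoped ENNReal

/-- The group of self-homeomorphisms of a space, under composition. -/
instance homeomorphGroup {X : Type*} [TopologicalSpace X] : Group (X ≃ₜ X) where
  mul f g := g.trans f
  one := Homeomorph.refl X
  inv := Homeomorph.symm
  mul_assoc f g h := rfl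
  one_mul f := Homeomorph.ext fun x => rfl
  mul_one f := Homeomorph.ext fun x => rfl
  inv_mul_cancel f := Homeomorph.ext fun x => f.symm_apply_apply x

section Defs

variable {X Y : Type*} [TopologicalSpace X] [TopologicalSpace Y]

/-- The orbit equivalence relation `R_{G,φ}` of an action of `G` on `X` by homeomorphisms. -/
def orbitRelOf {G : Type*} [Group G] (φ : G →* (X ≃ₜ X)) : Set (X × X) :=
  {p | ∃ g : G, φ g p.1 = p.2}

/-- Freeness of an action by homeomorphisms. -/
def IsFreeAction {G : Type*} [Group G] (φ : G →* (X ≃ₜ X)) : Prop :=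
  ∀ g : G, g ≠ 1 → ∀ x : X, φ g x ≠ x

/-- The orbit relation of a single homeomorphism, i.e. of the generated `ℤ`-action. -/
def orbitRelZ (φ : X ≃ₜ X) : Set (X × X) :=
  {p | ∃ n : ℤ, (φ ^ n) p.1 = p.2}

/-- Freeness of the `ℤ`-action generated by a homeomorphism. -/
def IsFreeZ (φ : X ≃ₜ X) : Prop :=
  ∀ n : ℤ, n ≠ 0 → ∀ x : X, (φ ^ n) x ≠ x

/-- Minimality of an orbit equivalence relation: every class `R[x]` is dense. -/
def IsMinimalRel (R : Set (X × X)) : Prop :=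
  ∀ x : X, Dense {y : X | (x, y) ∈ R}

/-- A Borel measure is `R`-invariant if it is invariant under every homeomorphism `h`
with `(x, h x) ∈ R` for all `x`. -/
def IsInvariantMeasure [MeasurableSpace X] (R : Set (X × X)) (μ : Measure X) : Prop :=
  ∀ h : X ≃ₜ X, (∀ x : X, (x, h x) ∈ R) → Measure.map h μ = μ

/-- Restriction `R|_U = R ∩ (U × U)` of a relation, as a relation on the subtype `U`. -/
def restrictRel (R : Set (X × X)) (U : Set X) : Set (↥U × ↥U) :=
  {p | ((p.1 : X), (p.2 : X)) ∈ R}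

/-- `R^n` on `X × {1,…,n}`: `((x,i),(y,j)) ∈ R^n ↔ (x,y) ∈ R`. -/
def finProdRel (R : Set (X × X)) (n : ℕ) : Set ((X × Fin n) × (X × Fin n)) :=
  {p | (p.1.1, p.2.1) ∈ R}

/-- `R^∞` on `X × ℕ`: `((x,i),(y,j)) ∈ R^∞ ↔ (x,y) ∈ R`. -/
def natProdRel (R : Set (X × X)) : Set ((X × ℕ) × (X × ℕ)) :=
  {p | (p.1.1, p.2.1) ∈ R}

/-- Topological orbit equivalence of two equivalence relations: a homeomorphism `F` of the
underlying spaces with `(F × F)(R₁) = R₂`. -/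
def OrbitEquiv (R₁ : Set (X × X)) (R₂ : Set (Y × Y)) : Prop :=
  ∃ F : X ≃ₜ Y, ∀ x y : X, (x, y) ∈ R₁ ↔ (F x, F y) ∈ R₂

/-- The fundamental group `F(R)` of a uniquely ergodic Cantor minimal system, where `μ` is
the unique invariant probability measure: the set of values `(μ × δ)(U)` (with `δ` counting
measure) over clopen sets `U ⊆ X × {1,…,n}`, `n ∈ ℕ`, such that `R^n|_U` is orbit
equivalent to `R`. -/
noncomputable def fundGroup [MeasurableSpace X] (R : Set (X × X)) (μ : Measure X) : Set ℝ :=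
  {l : ℝ | ∃ (n : ℕ) (U : Set (X × Fin n)), IsClopen U ∧
    OrbitEquiv R (restrictRel (finProdRel R n) U) ∧
    l = ((μ.prod Measure.count) U).toReal}

/-- `E_μ`: the additive subgroup of `ℝ` generated by the measures of clopen sets. -/
noncomputable def clopenValueGroup [MeasurableSpace X] (μ : Measure X) : AddSubgroup ℝ :=
  AddSubgroup.closure {r : ℝ | ∃ V : Set X, IsClopen V ∧ r = (μ V).toReal}

/-- The positive inner multiplier group `IM₊(E)` of an additive subgroup of `ℝ`. -/
def IMplus (E : AddSubgroup ℝ) : Set ℝ :=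
  {t : ℝ | 0 < t ∧ t ∈ E ∧ t⁻¹ ∈ E ∧ (fun x => t * x) '' (E : Set ℝ) = (E : Set ℝ)}

end Defs

set_option linter.unusedSectionVars false

namespace CantorOrbit

open Set Topology
open scoped Pointwise

/-- A free action. -/
class FreeAct (G X : Type*) [Group G] [MulAction G X] : Prop where
  eq_one : ∀ (g : G) (x : X), g • x = x → g = 1

section Basic

variable {G X : Type*} [Group G] [MulAction G X]

theorem FreeAct.smul_inj [FreeAct G X] {g h : G} {x : X} (e : g • x = h • x) : g = h := by
  have : (h⁻¹ * g) • x = x := by rw [mul_smul, e, inv_smul_smul]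
  have := FreeAct.eq_one _ _ this
  rwa [inv_mul_eq_one, eq_comm] at this

variable [TopologicalSpace X]

variable (G) in
/-- Near `x`, the map `f` is given by the action of a single group element. -/
def LocG (f : X → X) (x : X) : Prop := ∃ g : G, ∀ᶠ y in 𝓝 x, f y = g • y

theorem LocG.congr {f f' : X → X} {x : X} (h : LocG G f x) (e : f' =ᶠ[𝓝 x] f) :
    LocG G f' x := by
  obtain ⟨g, hg⟩ := h
  exact ⟨g, by filter_upwards [hg, e] with y h1 h2; rw [h2, h1]⟩

variable [ContinuousConstSMul G X]

theorem LocG.continuousAt {f : X → X} {x : X} (h : LocG G f x) : ContinuousAt f x := by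
  obtain ⟨g, hg⟩ := h
  exact ((continuous_const_smul g).continuousAt (x := x)).congr (hg.mono fun y hy => hy.symm)

theorem LocG.comp {f f' : X → X} {x : X} (h' : LocG G f' (f x)) (h : LocG G f x) :
    LocG G (f' ∘ f) x := by
  have hc := h.continuousAt
  obtain ⟨g, hg⟩ := h
  obtain ⟨g', hg'⟩ := h'
  refine ⟨g' * g, ?_⟩
  filter_upwards [hg, hc.eventually hg'] with y h1 h2
  rw [Function.comp, h2, h1, mul_smul]

theorem LocG.exists_eq {f : X → X} {x : X} (h : LocG G f x) : ∃ g : G, f x = g • x := by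
  obtain ⟨g, hg⟩ := h
  exact ⟨g, hg.self_of_nhds⟩

theorem LocG.image_mem_nhds {f : X → X} {x : X} (h : LocG G f x) {U : Set X} (hU : U ∈ 𝓝 x) :
    f '' U ∈ 𝓝 (f x) := by
  obtain ⟨g, hg⟩ := h
  have h1 : (g • (U ∩ {y | f y = g • y})) ∈ 𝓝 (g • x) :=
    smul_mem_nhds_smul g (Filter.inter_mem hU hg)
  rw [hg.self_of_nhds]
  refine Filter.mem_of_superset h1 ?_
  rintro _ ⟨y, ⟨hy, hy'⟩, rfl⟩
  exact ⟨y, hy, hy'⟩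

theorem isOpen_image_of_locG {f : X → X} {U : Set X} (hU : IsOpen U) (h : ∀ x ∈ U, LocG G f x) :
    IsOpen (f '' U) := by
  rw [isOpen_iff_mem_nhds]
  rintro _ ⟨x, hx, rfl⟩
  exact (h x hx).image_mem_nhds (hU.mem_nhds hx)

theorem isClopen_image_of_locG [CompactSpace X] [T2Space X] {f : X → X} {U : Set X}
    (hU : IsClopen U) (h : ∀ x ∈ U, LocG G f x) : IsClopen (f '' U) := by
  refine ⟨IsCompact.isClosed ?_, isOpen_image_of_locG hU.isOpen h⟩
  exact hU.isClosed.isCompact.image_of_continuousOn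
    fun x hx => (h x hx).continuousAt.continuousWithinAt

/-- A partial homeomorphism `f : U → V` with inverse `f'`, with graph in the orbit relation, and
locally given by the action away from `P`. -/
structure PMap (G : Type*) {X : Type*} [Group G] [MulAction G X] [TopologicalSpace X]
    (U V P : Set X) (f f' : X → X) : Prop where
  mapsTo : MapsTo f U V
  mapsTo' : MapsTo f' V U
  left : ∀ x ∈ U, f' (f x) = x
  right : ∀ y ∈ V, f (f' y) = y
  cont : ContinuousOn f U
  cont' : ContinuousOn f' V
  rel : ∀ x ∈ U, ∃ g : G, f x = g • x
  loc : ∀ x ∈ U, x ∉ P → LocG G f x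

variable {U V P : Set X} {f f' : X → X}

theorem PMap.injOn (h : PMap G U V P f f') : InjOn f U := fun x hx y hy e => by
  rw [← h.left x hx, e, h.left y hy]

theorem PMap.image (h : PMap G U V P f f') : f '' U = V :=
  Subset.antisymm h.mapsTo.image_subset fun y hy => ⟨f' y, h.mapsTo' hy, h.right y hy⟩

theorem PMap.symm (h : PMap G U V P f f') (hV : IsOpen V) :
    PMap G V U (f '' P) f' f := by
  refine ⟨h.mapsTo', h.mapsTo, h.right, h.left, h.cont', h.cont, fun y hy => ?_, ?_⟩
  · obtain ⟨g, hg⟩ := h.rel _ (h.mapsTo' hy)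
    rw [h.right y hy] at hg
    exact ⟨g⁻¹, by rw [eq_inv_smul_iff]; exact hg.symm⟩
  · intro y hy hyP
    have h1 : f' y ∉ P := fun h1 => hyP ⟨f' y, h1, h.right y hy⟩
    obtain ⟨g, hg⟩ := h.loc _ (h.mapsTo' hy) h1
    refine ⟨g⁻¹, ?_⟩
    have hc : ContinuousAt f' y := h.cont'.continuousAt (hV.mem_nhds hy)
    filter_upwards [hc.eventually hg, hV.mem_nhds hy] with z hz hz'
    rw [h.right z hz'] at hz
    rw [eq_inv_smul_iff]; exact hz.symm

theorem PMap.symm' (h : PMap G U V ∅ f f') (hV : IsOpen V) : PMap G V U ∅ f' f := by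
  simpa using h.symm hV

theorem PMap.of_injOn [CompactSpace X] [T2Space X] [Nonempty X]
    (hU : IsClopen U) (h : ∀ x ∈ U, LocG G f x) (hi : InjOn f U) :
    ∃ f', PMap G U (f '' U) ∅ f f' := by
  have hinv := BijOn.invOn_invFunOn hi.bijOn_image
  refine ⟨Function.invFunOn f U, mapsTo_image f U, ?_, hinv.1, hinv.2,
    fun x hx => (h x hx).continuousAt.continuousWithinAt, ?_, fun x hx => (h x hx).exists_eq,
    fun x hx _ => h x hx⟩
  · intro y hy
    exact Function.invFunOn_mem hy
  · rintro _ ⟨x, hx, rfl⟩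
    apply ContinuousAt.continuousWithinAt
    apply LocG.continuousAt (G := G)
    obtain ⟨g, hg⟩ := h x hx
    refine ⟨g⁻¹, ?_⟩
    have hN : f '' (U ∩ {y | f y = g • y}) ∈ 𝓝 (f x) :=
      (h x hx).image_mem_nhds (Filter.inter_mem (hU.isOpen.mem_nhds hx) hg)
    filter_upwards [hN]
    rintro _ ⟨y, ⟨hy, hy'⟩, rfl⟩
    rw [hinv.1 hy, hy', inv_smul_smul]

open Classical in
theorem PMap.union {U₁ U₂ V₁ V₂ : Set X} {f₁ f₁' f₂ f₂' : X → X}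
    (h₁ : PMap G U₁ V₁ ∅ f₁ f₁') (h₂ : PMap G U₂ V₂ ∅ f₂ f₂')
    (hU₁ : IsClopen U₁) (hU₂ : IsClopen U₂) (hV₁ : IsClopen V₁) (hV₂ : IsClopen V₂)
    (hU : Disjoint U₁ U₂) (hV : Disjoint V₁ V₂) :
    PMap G (U₁ ∪ U₂) (V₁ ∪ V₂) ∅ (U₁.piecewise f₁ f₂) (V₁.piecewise f₁' f₂') := by
  have key : ∀ {U₁ U₂ V₁ V₂ : Set X} {f₁ f₁' f₂ f₂' : X → X}
    (_ : PMap G U₁ V₁ ∅ f₁ f₁') (_ : PMap G U₂ V₂ ∅ f₂ f₂')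
    (_ : IsClopen U₁) (_ : IsClopen U₂) (_ : Disjoint U₁ U₂) (_ : Disjoint V₁ V₂),
      MapsTo (U₁.piecewise f₁ f₂) (U₁ ∪ U₂) (V₁ ∪ V₂) ∧
      (∀ x ∈ U₁ ∪ U₂, V₁.piecewise f₁' f₂' (U₁.piecewise f₁ f₂ x) = x) ∧
      (∀ x ∈ U₁ ∪ U₂, LocG G (U₁.piecewise f₁ f₂) x) := by
    intro U₁ U₂ V₁ V₂ f₁ f₁' f₂ f₂' h₁ h₂ hU₁ hU₂ hU hV
    refine ⟨?_, ?_, ?_⟩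
    · rintro x (hx | hx)
      · rw [piecewise_eq_of_mem _ _ _ hx]; exact Or.inl (h₁.mapsTo hx)
      · rw [piecewise_eq_of_notMem _ _ _ (hU.notMem_of_mem_right hx)]
        exact Or.inr (h₂.mapsTo hx)
    · rintro x (hx | hx)
      · rw [piecewise_eq_of_mem _ _ _ hx, piecewise_eq_of_mem _ _ _ (h₁.mapsTo hx), h₁.left x hx]
      · rw [piecewise_eq_of_notMem _ _ _ (hU.notMem_of_mem_right hx),
          piecewise_eq_of_notMem _ _ _ (hV.notMem_of_mem_right (h₂.mapsTo hx)), h₂.left x hx]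
    · rintro x (hx | hx)
      · refine (h₁.loc x hx (notMem_empty x)).congr ?_
        filter_upwards [hU₁.isOpen.mem_nhds hx] with y hy
        rw [piecewise_eq_of_mem _ _ _ hy]
      · refine (h₂.loc x hx (notMem_empty x)).congr ?_
        filter_upwards [hU₂.isOpen.mem_nhds hx] with y hy
        rw [piecewise_eq_of_notMem _ _ _ (hU.notMem_of_mem_right hy)]
  obtain ⟨a1, a2, a3⟩ := key h₁ h₂ hU₁ hU₂ hU hV
  obtain ⟨b1, b2, b3⟩ := key (h₁.symm' hV₁.isOpen) (h₂.symm' hV₂.isOpen) hV₁ hV₂ hV hU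
  exact ⟨a1, b1, a2, b2, fun x hx => (a3 x hx).continuousAt.continuousWithinAt,
    fun x hx => (b3 x hx).continuousAt.continuousWithinAt, fun x hx => (a3 x hx).exists_eq,
    fun x hx _ => a3 x hx⟩

open Classical in
/-- Greedy maximal matching of `U` into `V` along prescribed clopen sets of translations. -/
theorem exists_maximal_matching [CompactSpace X] [T2Space X]
    (Ω : G → Set X) (hΩ : ∀ g, IsClopen (Ω g)) (A : Finset G) (hU : IsClopen U)
    (hV : IsClopen V) :
    ∃ (U' : Set X) (f : X → X), IsClopen U' ∧ U' ⊆ U ∧ (∀ x ∈ U', LocG G f x) ∧ InjOn f U' ∧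
      MapsTo f U' V ∧ (∀ x ∈ U', ∃ g ∈ A, x ∈ Ω g ∧ f x = g • x) ∧
      ∀ x ∈ U, x ∉ U' → ∀ g ∈ A, x ∈ Ω g → g • x ∈ V → g • x ∈ f '' U' := by
  induction A using Finset.induction_on with
  | empty => exact ⟨∅, id, isClopen_empty, by simp, by simp, by simp, mapsTo_empty _ _, by simp, by simp⟩
  | insert a A ha ih =>
    obtain ⟨U', f, hc, hsub, hloc, hinj, hmap, hA, hmax⟩ := ih
    have hcl := isClopen_image_of_locG hc hloc
    set N : Set X := (U \ U') ∩ (Ω a ∩ (fun x => a • x) ⁻¹' (V \ f '' U')) with hN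
    have hNc : IsClopen N :=
      (hU.diff hc).inter ((hΩ a).inter ((hV.diff hcl).preimage (continuous_const_smul a)))
    have hdis : ∀ x ∈ N, x ∉ U' := fun x hx => hx.1.2
    have e1 : ∀ x ∈ U', U'.piecewise f (fun x => a • x) x = f x := fun x hx =>
      piecewise_eq_of_mem _ _ _ hx
    have e2 : ∀ x ∈ N, U'.piecewise f (fun x => a • x) x = a • x := fun x hx =>
      piecewise_eq_of_notMem _ _ _ (hdis x hx)
    refine ⟨U' ∪ N, U'.piecewise f (fun x => a • x), hc.union hNc, ?_, ?_, ?_, ?_, ?_, ?_⟩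
    · exact union_subset hsub fun x hx => hx.1.1
    · rintro x (hx | hx)
      · refine (hloc x hx).congr ?_
        filter_upwards [hc.isOpen.mem_nhds hx] with y hy using e1 y hy
      · refine ⟨a, ?_⟩
        filter_upwards [hNc.isOpen.mem_nhds hx] with y hy using e2 y hy
    · rintro x (hx | hx) y (hy | hy) e
      · rw [e1 x hx, e1 y hy] at e; exact hinj hx hy e
      · rw [e1 x hx, e2 y hy] at e; exact absurd ⟨x, hx, e⟩ hy.2.2.2
      · rw [e2 x hx, e1 y hy] at e; exact absurd ⟨y, hy, e.symm⟩ hx.2.2.2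
      · rw [e2 x hx, e2 y hy] at e; exact smul_left_cancel a e
    · rintro x (hx | hx)
      · rw [e1 x hx]; exact hmap hx
      · rw [e2 x hx]; exact hx.2.2.1
    · rintro x (hx | hx)
      · obtain ⟨g, hg, h⟩ := hA x hx
        exact ⟨g, Finset.mem_insert_of_mem hg, by rwa [e1 x hx]⟩
      · exact ⟨a, Finset.mem_insert_self _ _, hx.2.1, e2 x hx⟩
    · intro x hx hx' g hg hxg hgV
      have hx1 : x ∉ U' := fun h => hx' (Or.inl h)
      have sub : f '' U' ⊆ U'.piecewise f (fun x => a • x) '' (U' ∪ N) := by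
        rintro _ ⟨y, hy, rfl⟩
        exact ⟨y, Or.inl hy, e1 y hy⟩
      rcases Finset.mem_insert.1 hg with rfl | hg
      · by_contra hcon
        exact hx' (Or.inr ⟨⟨hx, hx1⟩, hxg, hgV, fun h => hcon (sub h)⟩)
      · exact sub (hmax x hx hx1 g hg hxg hgV)

/-- A clopen equivalence subrelation of the orbit relation, with bounded displacement. -/
structure ClopenRel (G : Type*) {X : Type*} [Group G] [MulAction G X] [TopologicalSpace X]
    (T : X → X → Prop) : Prop where
  equiv : Equivalence T
  bdd : ∃ F : Finset G, ∀ x y, T x y → ∃ g ∈ F, y = g • x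
  clopen : ∀ g : G, IsClopen {x | T x (g • x)}

variable {T : X → X → Prop}

theorem ClopenRel.finite (h : ClopenRel G T) (x : X) : {y | T x y}.Finite := by
  obtain ⟨F, hF⟩ := h.bdd
  refine (F.finite_toSet.image fun g => g • x).subset fun y hy => ?_
  obtain ⟨g, hg, e⟩ := hF x y hy
  exact ⟨g, hg, e.symm⟩

theorem ClopenRel.cls_eq (h : ClopenRel G T) {x y : X} (hxy : T x y) :
    {z | T x z} = {z | T y z} := by
  ext z
  exact ⟨fun hz => h.equiv.trans (h.equiv.symm hxy) hz, fun hz => h.equiv.trans hxy hz⟩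

theorem ClopenRel.ncard_pos (h : ClopenRel G T) (x : X) : 0 < {y | T x y}.ncard :=
  (Set.ncard_pos (h.finite x)).2 ⟨x, h.equiv.refl x⟩

theorem ClopenRel.comap [CompactSpace X] (h : ClopenRel G T) {π : X → X}
    (hπ : ∀ x, LocG G π x) : ClopenRel G fun x y => T (π x) (π y) := by
  classical
  have hcl : ∀ g : G, IsOpen {x | T (π x) (π (g • x))} ∧ IsOpen {x | ¬ T (π x) (π (g • x))} := by
    intro g
    have key : ∀ x, ∃ k : G, ∀ᶠ y in 𝓝 x, (T (π y) (π (g • y)) ↔ T (π y) (k • π y)) := by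
      intro x
      obtain ⟨a, ha⟩ := hπ x
      obtain ⟨b, hb⟩ := hπ (g • x)
      refine ⟨b * g * a⁻¹, ?_⟩
      have hc : ContinuousAt (fun y : X => g • y) x := (continuous_const_smul g).continuousAt
      filter_upwards [ha, hc.eventually hb] with y h1 h2
      rw [h2, h1]
      simp [mul_smul]
    constructor <;> rw [isOpen_iff_mem_nhds] <;> intro x hx
    · obtain ⟨k, hk⟩ := key x
      have : π x ∈ {x | T x (k • x)} := hk.self_of_nhds.1 hx
      filter_upwards [hk, (hπ x).continuousAt ((h.clopen k).isOpen.mem_nhds this)] with y h1 h2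
      exact h1.2 h2
    · obtain ⟨k, hk⟩ := key x
      have : π x ∈ {x | T x (k • x)}ᶜ := fun h => hx (hk.self_of_nhds.2 h)
      filter_upwards [hk, (hπ x).continuousAt ((h.clopen k).compl.isOpen.mem_nhds this)]
        with y h1 h2
      exact fun h => h2 (h1.1 h)
  refine ⟨⟨fun x => h.equiv.refl _, fun h' => h.equiv.symm h', fun h1 h2 => h.equiv.trans h1 h2⟩,
    ?_, fun g => ⟨⟨(hcl g).2⟩, (hcl g).1⟩⟩
  obtain ⟨F, hF⟩ := h.bdd
  have hH : ∃ H : Finset G, ∀ x, ∃ g ∈ H, π x = g • x := by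
    choose g hg using hπ
    obtain ⟨t, ht⟩ := CompactSpace.elim_nhds_subcover (fun x => {y | π y = g x • y}) hg
    refine ⟨t.image g, fun x => ?_⟩
    have : x ∈ ⋃ x ∈ t, {y | π y = g x • y} := ht ▸ mem_univ x
    simp only [mem_iUnion] at this
    obtain ⟨i, hi, hx⟩ := this
    exact ⟨g i, Finset.mem_image_of_mem _ hi, hx⟩
  obtain ⟨H, hH⟩ := hH
  refine ⟨(H ×ˢ F ×ˢ H).image fun p => p.1⁻¹ * p.2.1 * p.2.2, fun x y hxy => ?_⟩
  obtain ⟨a, ha, ea⟩ := hH x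
  obtain ⟨b, hb, eb⟩ := hH y
  obtain ⟨f, hf, ef⟩ := hF _ _ hxy
  refine ⟨b⁻¹ * f * a, Finset.mem_image.2 ⟨(b, f, a), by simp [*], rfl⟩, ?_⟩
  rw [mul_assoc, mul_smul, mul_smul, eq_inv_smul_iff, ← eb, ← ea, ef]

end Basic

end CantorOrbit

namespace CantorOrbit

open Set Topology Filter ProbabilityTheory

section Meas

variable {G X : Type*} [CommGroup G] [MulAction G X] [TopologicalSpace X]
  [ContinuousConstSMul G X] [FreeAct G X] [CompactSpace X] [PolishSpace X]
  [TotallyDisconnectedSpace X] [MeasurableSpace X] [BorelSpace X] [Countable G]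

theorem measurable_smul_left (g : G) : Measurable fun x : X => g • x :=
  (continuous_const_smul g).measurable

variable (G) in
/-- Invariance of a measure under the action. -/
def Inv (ν : Measure X) : Prop := ∀ g : G, ν.map (fun x => g • x) = ν

theorem Inv.preimage {ν : Measure X} (h : Inv G ν) (g : G) {A : Set X} (hA : MeasurableSet A) :
    ν ((fun x => g • x) ⁻¹' A) = ν A := by
  rw [← Measure.map_apply (measurable_smul_left g) hA, h g]

theorem Inv.image {ν : Measure X} (h : Inv G ν) (g : G) {A : Set X} (hA : MeasurableSet A) :
    ν ((fun x => g • x) '' A) = ν A := by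
  rw [show (fun x : X => g • x) '' A = (fun x => g⁻¹ • x) ⁻¹' A from ?_, h.preimage _ hA]
  ext x
  constructor
  · rintro ⟨y, hy, rfl⟩; simpa using hy
  · intro hx; exact ⟨_, hx, by simp⟩

/-- Mass is preserved by maps moving points along orbits. -/
theorem Inv.measure_image_eq {ν : Measure X} (h : Inv G ν) {S : Set X} (hS : MeasurableSet S)
    {p q : X → X} (hp : Measurable p) (hq : Measurable q) (ip : InjOn p S) (iq : InjOn q S)
    (hr : ∀ x ∈ S, ∃ g : G, q x = g • p x) : ν (p '' S) = ν (q '' S) := by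
  set D : G → Set X := fun g => S ∩ {x | q x = g • p x} with hD
  have hDm : ∀ g, MeasurableSet (D g) := fun g =>
    hS.inter (measurableSet_eq_fun hq ((measurable_smul_left g).comp hp))
  have hU : S = ⋃ g, D g := by
    ext x
    simp only [hD, mem_iUnion, mem_inter_iff, mem_ofPred_eq]
    exact ⟨fun hx => (hr x hx).imp fun g hg => ⟨hx, hg⟩, fun ⟨g, hg⟩ => hg.1⟩
  have hdis : Pairwise (Function.onFun Disjoint D) := by
    intro g g' hne
    rw [Function.onFun, Set.disjoint_left]
    intro x hx hx'
    exact hne (FreeAct.smul_inj (hx.2.symm.trans hx'.2))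
  have hsub : ∀ g, D g ⊆ S := fun g => inter_subset_left
  have key : ∀ r : X → X, Measurable r → InjOn r S → ν (r '' S) = ∑' g, ν (r '' D g) := by
    intro r hr ir
    conv_lhs => rw [hU, image_iUnion]
    rw [measure_iUnion]
    · intro g g' hne
      have := hdis hne
      rw [Function.onFun, Set.disjoint_left] at this ⊢
      rintro _ ⟨x, hx, rfl⟩ ⟨y, hy, e⟩
      rw [ir (hsub _ hy) (hsub _ hx) e] at hy
      exact this hx hy
    · intro g
      exact (hDm g).image_of_measurable_injOn hr (ir.mono (hsub g))
  rw [key p hp ip, key q hq iq]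
  congr 1
  ext g
  rw [← h.image g ((hDm g).image_of_measurable_injOn hp (ip.mono (hsub g))), image_image]
  congr 1
  apply image_congr
  intro x hx
  exact hx.2.symm

theorem PMap.measure_eq {ν : Measure X} (h : Inv G ν) {U V P : Set X} {f f' : X → X}
    (hf : PMap G U V P f f') (hU : IsClopen U) : ν U = ν V := by
  classical
  have hm : Measurable (U.piecewise f id) := by
    refine Continuous.measurable ?_
    refine continuous_iff_continuousAt.2 fun x => ?_
    by_cases hx : x ∈ U
    · refine (hf.cont.continuousAt (hU.isOpen.mem_nhds hx)).congr ?_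
      filter_upwards [hU.isOpen.mem_nhds hx] with y hy
      rw [piecewise_eq_of_mem _ _ _ hy]
    · refine continuousAt_id.congr ?_
      filter_upwards [hU.compl.isOpen.mem_nhds hx] with y hy
      rw [piecewise_eq_of_notMem _ _ _ hy]
  have e : ∀ x ∈ U, U.piecewise f id x = f x := fun x hx => piecewise_eq_of_mem _ _ _ hx
  have := h.measure_image_eq hU.isOpen.measurableSet (p := id) (q := U.piecewise f id)
    measurable_id hm (injOn_id _) (fun x hx y hy he => hf.injOn hx hy (by rwa [e x hx, e y hy] at he))
    (fun x hx => by rw [e x hx]; exact hf.rel x hx)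
  rw [image_id, image_congr e, hf.image] at this
  exact this

theorem measure_image_of_locG {ν : Measure X} (h : Inv G ν) {U : Set X} {f : X → X}
    (hU : IsClopen U) (hl : ∀ x ∈ U, LocG G f x) (hi : InjOn f U) : ν (f '' U) = ν U := by
  rcases U.eq_empty_or_nonempty with rfl | ⟨x, hx⟩
  · simp
  · have : Nonempty X := ⟨x⟩
    obtain ⟨f', hf'⟩ := PMap.of_injOn hU hl hi
    exact (hf'.measure_eq h hU).symm

theorem ext_of_isClopen {ν ν' : Measure X} [IsProbabilityMeasure ν] [IsProbabilityMeasure ν']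
    (h : ∀ U, IsClopen U → ν U = ν' U) : ν = ν' := by
  refine ext_of_generate_finite {U | IsClopen U} ?_ ?_ (fun s hs => h s hs) (by simp)
  · rw [BorelSpace.measurable_eq (α := X)]
    exact (isTopologicalBasis_isClopen (X := X)).borel_eq_generateFrom
  · intro U hU V hV _
    exact IsClopen.inter hU hV

variable (G) in
/-- A free minimal uniquely ergodic action on a Cantor set, with invariant measure `μ`. -/
structure UEMin (μ : Measure X) : Prop where
  prob : IsProbabilityMeasure μ
  inv : Inv G μ
  uniq : ∀ ν : Measure X, IsProbabilityMeasure ν → Inv G ν → ν = μ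
  min : ∀ x : X, Dense {y | ∃ g : G, y = g • x}
  perfect : ∀ x : X, ¬ IsOpen {x}

/-- A finite set of points almost invariant under `K`. -/
def Folner (K : Finset G) (δ : ℝ) (S : Set X) : Prop :=
  S.Finite ∧ S.Nonempty ∧ ∀ k ∈ K, ({y ∈ S | k • y ∉ S}.ncard : ℝ) ≤ δ * S.ncard

theorem Folner.mono {K K' : Finset G} {δ δ' : ℝ} {S : Set X} (h : Folner K δ S) (hK : K' ⊆ K)
    (hδ : δ ≤ δ') : Folner K' δ' S :=
  ⟨h.1, h.2.1, fun k hk => (h.2.2 k (hK hk)).trans (by gcongr)⟩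

theorem ncard_preimage_le {S V : Set X} (hS : S.Finite) (g : G) :
    (S ∩ (fun x => g • x) ⁻¹' V).ncard ≤ (S ∩ V).ncard + {y ∈ S | g • y ∉ S}.ncard := by
  have h1 : S ∩ (fun x => g • x) ⁻¹' V ⊆
      ((fun x => g • x) ⁻¹' (S ∩ V)) ∪ {y ∈ S | g • y ∉ S} := by
    intro x hx
    by_cases h : g • x ∈ S
    · exact Or.inl ⟨h, hx.2⟩
    · exact Or.inr ⟨hx.1, h⟩
  have inj : Function.Injective fun x : X => g • x := MulAction.injective g
  have hf : (S ∩ V).Finite := hS.inter_of_left V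
  refine (ncard_le_ncard h1 ((hf.preimage inj.injOn).union (hS.sep _))).trans ?_
  refine (ncard_union_le _ _).trans ?_
  refine Nat.add_le_add_right ?_ _
  rw [← ncard_image_of_injective _ inj]
  exact ncard_le_ncard (image_preimage_subset _ _) hf

/-- Unique ergodicity: almost invariant finite sets equidistribute. -/
theorem UEMin.equidist {μ : Measure X} (h : UEMin G μ) {U : Set X} (hU : IsClopen U) {ε : ℝ}
    (hε : 0 < ε) : ∃ (K : Finset G) (δ : ℝ), 0 < δ ∧ ∀ S : Set X, Folner K δ S →
      |((S ∩ U).ncard : ℝ) - μ.real U * S.ncard| ≤ ε * S.ncard := by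
  classical
  have := h.prob
  by_contra! hcon
  obtain ⟨e, he⟩ := exists_injective_nat G
  set Kn : ℕ → Finset G := fun n => ((Set.finite_Iic n).preimage he.injOn).toFinset with hKn
  have hKmem : ∀ g n, e g ≤ n → g ∈ Kn n := fun g n hg => by simp [hKn, hg]
  choose S hS hbad using fun n : ℕ => hcon (Kn n) (1 / ((n : ℝ) + 1)) (by positivity)
  have hpr : ∀ n, IsProbabilityMeasure (uniformOn (S n)) := fun n =>
    isProbabilityMeasure_uniformOn (hS n).1 (hS n).2.1
  have hval : ∀ n V, MeasurableSet V →
      (uniformOn (S n)).real V = ((S n ∩ V).ncard : ℝ) / (S n).ncard := by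
    intro n V hV
    have hc : ∀ W : Set X, W.Finite → Measure.count W = (W.ncard : ℝ≥0∞) := by
      intro W hW
      rw [Measure.count_apply_finite _ hW, ncard_eq_toFinset_card _ hW]
    rw [Measure.real, uniformOn, cond_apply (hS n).1.measurableSet, hc _ (hS n).1,
      hc _ ((hS n).1.inter_of_left V)]
    rw [ENNReal.toReal_mul, ENNReal.toReal_inv, ENNReal.toReal_natCast, ENNReal.toReal_natCast]
    ring
  set P : ℕ → ProbabilityMeasure X := fun n => ⟨uniformOn (S n), hpr n⟩ with hP
  set 𝒰 : Ultrafilter ℕ := hyperfilter ℕ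
  obtain ⟨ν, hν⟩ : ∃ ν : ProbabilityMeasure X, Tendsto P 𝒰 (𝓝 ν) := by
    obtain ⟨ν, -, hν⟩ := isCompact_univ.ultrafilter_le_nhds (𝒰.map P) (by simp)
    exact ⟨ν, hν⟩
  have hlim : ∀ V, IsClopen V →
      Tendsto (fun n => ((S n ∩ V).ncard : ℝ) / (S n).ncard) 𝒰 (𝓝 ((ν : Measure X).real V)) := by
    intro V hV
    have h1 := ProbabilityMeasure.tendsto_measure_of_null_frontier_of_tendsto' hν (E := V)
      (by rw [hV.frontier_eq]; simp)
    have h2 := (ENNReal.tendsto_toReal (measure_ne_top (ν : Measure X) V)).comp h1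
    refine h2.congr fun n => ?_
    rw [← hval n V hV.isOpen.measurableSet]; rfl
  have h𝒰 : (𝒰 : Filter ℕ) ≤ atTop := by
    rw [← Nat.cofinite_eq_atTop]; exact hyperfilter_le_cofinite
  have hpos : ∀ n, 0 < ((S n).ncard : ℝ) := fun n => by
    exact_mod_cast (ncard_pos (hS n).1).2 (hS n).2.1
  have hle : ∀ V, IsClopen V → ∀ g : G,
      (ν : Measure X).real ((fun x => g • x) ⁻¹' V) ≤ (ν : Measure X).real V := by
    intro V hV g
    have t1 := hlim _ (hV.preimage (continuous_const_smul g))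
    have t2 : Tendsto (fun n => ((S n ∩ V).ncard : ℝ) / (S n).ncard + 1 / ((n : ℝ) + 1)) 𝒰
        (𝓝 ((ν : Measure X).real V + 0)) :=
      (hlim V hV).add (tendsto_one_div_add_atTop_nhds_zero_nat.mono_left h𝒰)
    rw [add_zero] at t2
    refine le_of_tendsto_of_tendsto t1 t2 ?_
    filter_upwards [h𝒰 (eventually_ge_atTop (e g))] with n hn
    have h1 := (hS n).2.2 g (hKmem g n hn)
    have h2 : ((S n ∩ (fun x => g • x) ⁻¹' V).ncard : ℝ) ≤
        (S n ∩ V).ncard + {y ∈ S n | g • y ∉ S n}.ncard := by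
      exact_mod_cast ncard_preimage_le (hS n).1 g
    rw [div_add' _ _ _ (hpos n).ne']
    gcongr
    linarith
  have hinv : Inv G (ν : Measure X) := by
    intro g
    have : IsProbabilityMeasure ((ν : Measure X).map fun x => g • x) :=
      Measure.isProbabilityMeasure_map (measurable_smul_left g).aemeasurable
    refine ext_of_isClopen fun V hV => ?_
    rw [Measure.map_apply (measurable_smul_left g) hV.isOpen.measurableSet]
    have h1 := hle V hV g
    have h2 := hle _ (hV.preimage (continuous_const_smul g)) g⁻¹
    rw [← preimage_comp] at h2
    have : (fun x : X => g • x) ∘ (fun x => g⁻¹ • x) = id := by ext x; simp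
    rw [this, preimage_id] at h2
    have h3 := le_antisymm h1 h2
    exact (measureReal_eq_measureReal_iff).1 h3
  have hνμ : (ν : Measure X) = μ := h.uniq _ inferInstance hinv
  have h1 := hlim U hU
  rw [hνμ] at h1
  have h2 : Tendsto (fun n => |((S n ∩ U).ncard : ℝ) / (S n).ncard - μ.real U|) 𝒰 (𝓝 0) := by
    have := (h1.sub_const (μ.real U)).abs
    simpa using this
  have h3 := h2.eventually (gt_mem_nhds hε)
  obtain ⟨n, hn⟩ := h3.exists
  have h4 := hbad n
  have h5 : ((S n ∩ U).ncard : ℝ) - μ.real U * (S n).ncard =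
      (((S n ∩ U).ncard : ℝ) / (S n).ncard - μ.real U) * (S n).ncard := by
    have := (hpos n).ne'
    field_simp
  rw [h5, abs_mul, abs_of_pos (hpos n)] at h4
  exact absurd h4 (not_lt.2 (by gcongr))

theorem UEMin.pos {μ : Measure X} (h : UEMin G μ) {U : Set X} (hU : IsOpen U)
    (hne : U.Nonempty) : 0 < μ.real U := by
  have := h.prob
  by_contra hcon
  have h0 : μ U = 0 := by
    rw [← measureReal_eq_zero_iff]
    exact le_antisymm (not_lt.1 hcon) measureReal_nonneg
  have hcov : (⋃ g : G, (fun x => g • x) ⁻¹' U) = univ := by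
    rw [eq_univ_iff_forall]
    intro x
    obtain ⟨y, hy, g, rfl⟩ := (h.min x).inter_open_nonempty U hU hne
    exact mem_iUnion.2 ⟨g, hy⟩
  have : μ univ = 0 := by
    rw [← hcov]
    exact measure_iUnion_null fun g => by rw [h.inv.preimage g hU.measurableSet, h0]
  simp at this

theorem UEMin.infinite {μ : Measure X} (h : UEMin G μ) : Infinite G := by
  have := h.prob
  obtain ⟨x⟩ : Nonempty X := by
    by_contra hX
    rw [not_nonempty_iff] at hX
    have := measure_univ (μ := μ)
    rw [univ_eq_empty_iff.2 hX] at this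
    simp at this
  rw [← not_finite_iff_infinite]
  intro hfin
  have hf : {y | ∃ g : G, y = g • x}.Finite := by
    refine (Set.finite_range fun g : G => g • x).subset ?_
    rintro _ ⟨g, rfl⟩
    exact ⟨g, rfl⟩
  have hd := h.min x
  have : {y | ∃ g : G, y = g • x} = univ := by
    rw [← hd.closure_eq, hf.isClosed.closure_eq]
  rw [this] at hf
  have : Finite X := finite_univ_iff.1 hf
  exact h.perfect x (isOpen_discrete _)

theorem UEMin.measure_singleton {μ : Measure X} (h : UEMin G μ) (x : X) : μ {x} = 0 := by
  have := h.prob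
  have := h.infinite
  by_contra hne
  have h1 : ∀ g : G, μ {g • x} = μ {x} := fun g => by
    rw [← h.inv.image g (measurableSet_singleton x), image_singleton]
  have h2 := measure_iUnion (μ := μ) (f := fun g : G => {g • x}) (fun g g' hgg' => by
    rw [Function.onFun, Set.disjoint_singleton]
    exact fun e => hgg' (FreeAct.smul_inj e)) (fun g => measurableSet_singleton _)
  simp_rw [h1] at h2
  rw [ENNReal.tsum_const_eq_top_of_ne_zero hne] at h2
  exact measure_ne_top _ _ h2

end Meas

end CantorOrbit

namespace CantorOrbit

open Set Topology Filter ProbabilityTheory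

/-- An exhaustion of an abelian group by symmetric finite sets behaving like balls of polynomial
growth. -/
structure IsBalls {G : Type*} [CommGroup G] (F : ℕ → Finset G) (C : ℕ) : Prop where
  mono : Monotone F
  one_mem : ∀ r, 1 ∈ F r
  inv_mem : ∀ {r g}, g ∈ F r → g⁻¹ ∈ F r
  mul_mem : ∀ {r s g h}, g ∈ F r → h ∈ F s → g * h ∈ F (r + s)
  exhaust : ∀ g, ∃ r, g ∈ F r
  double : ∀ r, ∃ A : Finset G, A.card ≤ C ∧ ∀ g ∈ F (2 * r), ∃ a ∈ A, ∃ h ∈ F r, g = a * h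

theorem exists_isBalls (G : Type*) [CommGroup G] [Group.FG G] :
    ∃ (F : ℕ → Finset G) (C : ℕ), IsBalls F C := by
  classical
  obtain ⟨S, hS⟩ := (Group.fg_def.1 ‹Group.FG G› : (⊤ : Subgroup G).FG)
  let Φ : (S → ℤ) → G := fun a => ∏ i : S, (i.1 : G) ^ a i
  have Φadd : ∀ a b, Φ (a + b) = Φ a * Φ b := fun a b => by
    simp [Φ, zpow_add, Finset.prod_mul_distrib]
  have Φneg : ∀ a, Φ (-a) = (Φ a)⁻¹ := fun a => by simp [Φ, Finset.prod_inv_distrib]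
  let I : ℕ → Finset (S → ℤ) := fun r => Fintype.piFinset fun _ => Finset.Icc (-(r : ℤ)) r
  have hI : ∀ r a, a ∈ I r ↔ ∀ i, -(r : ℤ) ≤ a i ∧ a i ≤ r := fun r a => by simp [I]
  refine ⟨fun r => (I r).image Φ, 3 ^ Fintype.card S, ?_, ?_, ?_, ?_, ?_, ?_⟩
  · intro r s hrs
    refine Finset.image_subset_image fun a ha => ?_
    rw [hI] at ha ⊢
    intro i
    have := ha i
    omega
  · intro r
    exact Finset.mem_image.2 ⟨0, by rw [hI]; simp, by simp [Φ]⟩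
  · intro r g hg
    obtain ⟨a, ha, rfl⟩ := Finset.mem_image.1 hg
    refine Finset.mem_image.2 ⟨-a, ?_, Φneg a⟩
    rw [hI] at ha ⊢
    intro i
    have := ha i
    simp only [Pi.neg_apply]
    omega
  · intro r s g h hg hh
    obtain ⟨a, ha, rfl⟩ := Finset.mem_image.1 hg
    obtain ⟨b, hb, rfl⟩ := Finset.mem_image.1 hh
    refine Finset.mem_image.2 ⟨a + b, ?_, Φadd a b⟩
    rw [hI] at ha hb ⊢
    intro i
    have := ha i
    have := hb i
    simp only [Pi.add_apply]
    push_cast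
    omega
  · intro g
    have hr : ∀ a, ∃ r, a ∈ I r := by
      intro a
      refine ⟨∑ i, (a i).natAbs, ?_⟩
      rw [hI]
      intro i
      have := Finset.single_le_sum (f := fun i => (a i).natAbs) (fun i _ => Nat.zero_le _)
        (Finset.mem_univ i)
      omega
    have hg : g ∈ Subgroup.closure (S : Set G) := by rw [hS]; trivial
    have : ∃ a, Φ a = g := by
      induction hg using Subgroup.closure_induction with
      | mem x hx =>
        refine ⟨Pi.single ⟨x, hx⟩ 1, ?_⟩
        simp only [Φ]
        rw [Finset.prod_eq_single ⟨x, hx⟩]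
        · simp
        · intro b _ hb
          simp [Pi.single_eq_of_ne hb]
        · simp
      | one => exact ⟨0, by simp [Φ]⟩
      | mul x y _ _ hx hy =>
        obtain ⟨a, rfl⟩ := hx
        obtain ⟨b, rfl⟩ := hy
        exact ⟨a + b, Φadd a b⟩
      | inv x _ hx =>
        obtain ⟨a, rfl⟩ := hx
        exact ⟨-a, Φneg a⟩
    obtain ⟨a, rfl⟩ := this
    obtain ⟨r, hr⟩ := hr a
    exact ⟨r, Finset.mem_image_of_mem _ hr⟩
  · intro r
    refine ⟨(Fintype.piFinset fun _ : S => ({-(r : ℤ), 0, (r : ℤ)} : Finset ℤ)).image Φ, ?_, ?_⟩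
    · refine Finset.card_image_le.trans ?_
      rw [Fintype.card_piFinset]
      refine (Finset.prod_le_prod' fun i _ => Finset.card_le_three).trans ?_
      simp
    · intro g hg
      obtain ⟨a, ha, rfl⟩ := Finset.mem_image.1 hg
      rw [hI] at ha
      have : ∀ i, ∃ c b : ℤ, c ∈ ({-(r : ℤ), 0, (r : ℤ)} : Finset ℤ) ∧
          (-(r : ℤ) ≤ b ∧ b ≤ r) ∧ a i = c + b := by
        intro i
        have := ha i
        push_cast at this
        by_cases h1 : a i < -r
        · exact ⟨-r, a i + r, by simp, by omega, by omega⟩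
        by_cases h2 : (r : ℤ) < a i
        · exact ⟨r, a i - r, by simp, by omega, by omega⟩
        · exact ⟨0, a i, by simp, by omega, by omega⟩
      choose c b hc hb hab using this
      refine ⟨Φ c, Finset.mem_image_of_mem _ (Fintype.mem_piFinset.2 hc), Φ b,
        Finset.mem_image_of_mem _ ((hI r b).2 hb), ?_⟩
      rw [← Φadd, show a = c + b from funext hab]

section Balls

variable {G : Type*} [CommGroup G] {F : ℕ → Finset G} {C : ℕ}

theorem IsBalls.card_pos (h : IsBalls F C) (r : ℕ) : 0 < (F r).card :=
  Finset.card_pos.2 ⟨1, h.one_mem r⟩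

theorem IsBalls.card_two_mul (h : IsBalls F C) (r : ℕ) :
    (F (2 * r)).card ≤ C * (F r).card := by
  classical
  obtain ⟨A, hA, hc⟩ := h.double r
  have : F (2 * r) ⊆ (A ×ˢ F r).image fun p => p.1 * p.2 := by
    intro g hg
    obtain ⟨a, ha, b, hb, rfl⟩ := hc g hg
    exact Finset.mem_image.2 ⟨(a, b), by simp [ha, hb], rfl⟩
  refine (Finset.card_le_card this).trans (Finset.card_image_le.trans ?_)
  rw [Finset.card_product]
  gcongr

theorem IsBalls.exists_thin (h : IsBalls F C) (c s₀ : ℕ) {ε : ℝ} (hε : 0 < ε) :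
    ∃ s ρ, s₀ ≤ s ∧ 2 * s + c ≤ ρ ∧
      ((F (ρ + c)).card : ℝ) - (F (ρ - c)).card ≤ ε * (F s).card := by
  by_contra! hcon
  obtain ⟨J, hJ⟩ := exists_nat_gt ((C : ℝ) * C / ε)
  set s := s₀ + c * J with hs
  have key : ∀ j, j ≤ J →
      j * (ε * (F s).card) ≤ ((F (2 * s + 2 * c * j)).card : ℝ) := by
    intro j
    induction j with
    | zero => intro _; simp
    | succ j ih =>
      intro hj
      have h1 := ih (by omega)
      have h2 := hcon s (2 * s + 2 * c * j + c) (by omega) (by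
        have : 0 ≤ 2 * c * j := Nat.zero_le _
        omega)
      rw [show 2 * s + 2 * c * j + c + c = 2 * s + 2 * c * (j + 1) by ring,
        Nat.add_sub_cancel] at h2
      push_cast at h1 h2 ⊢
      linarith
  have h1 := key J le_rfl
  have h2 : (F (2 * s + 2 * c * J)).card ≤ (F (2 * (2 * s))).card :=
    Finset.card_le_card (h.mono (by rw [hs]; nlinarith))
  have h3 := h.card_two_mul (2 * s)
  have h4 := h.card_two_mul s
  have h5 : (F (2 * s + 2 * c * J)).card ≤ C * (C * (F s).card) :=
    h2.trans (h3.trans (Nat.mul_le_mul_left _ h4))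
  have h6 : ((F (2 * s + 2 * c * J)).card : ℝ) ≤ C * (C * (F s).card) := by exact_mod_cast h5
  have h7 : (0 : ℝ) < (F s).card := by exact_mod_cast h.card_pos s
  rw [div_lt_iff₀ hε] at hJ
  nlinarith

theorem IsBalls.exists_superset (h : IsBalls F C) (K : Finset G) : ∃ c, K ⊆ F c := by
  classical
  induction K using Finset.induction_on with
  | empty => exact ⟨0, by simp⟩
  | insert a K _ ih =>
    obtain ⟨c, hc⟩ := ih
    obtain ⟨d, hd⟩ := h.exhaust a
    refine ⟨c + d, Finset.insert_subset (h.mono (by omega) hd) (hc.trans (h.mono (by omega)))⟩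

end Balls

section Meas

variable {G X : Type*} [CommGroup G] [MulAction G X] [TopologicalSpace X]
  [ContinuousConstSMul G X] [FreeAct G X] [CompactSpace X] [PolishSpace X]
  [TotallyDisconnectedSpace X] [MeasurableSpace X] [BorelSpace X] [Countable G]
  {F : ℕ → Finset G} {C : ℕ} {μ : Measure X}

theorem ncard_image_smul (A : Finset G) (x : X) :
    ((fun g : G => g • x) '' (A : Set G)).ncard = A.card := by
  rw [ncard_image_of_injective _ fun g h e => FreeAct.smul_inj e, ncard_coe_finset]

theorem IsBalls.exists_folner (h : IsBalls F C) (K : Finset G) {δ : ℝ} (hδ : 0 < δ) :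
    ∃ ρ, ∀ x : X, Folner K δ ((fun g : G => g • x) '' (F ρ : Set G)) := by
  obtain ⟨c, hc⟩ := h.exists_superset K
  obtain ⟨s, ρ, -, hρ, hthin⟩ := h.exists_thin c 0 hδ
  refine ⟨ρ, fun x => ⟨(F ρ).finite_toSet.image _, ⟨x, 1, h.one_mem ρ, one_smul _ _⟩, ?_⟩⟩
  intro k hk
  classical
  have hsub : (fun y : X => k • y) '' {y ∈ (fun g : G => g • x) '' (F ρ : Set G) |
      k • y ∉ (fun g : G => g • x) '' (F ρ : Set G)} ⊆
      (fun g : G => g • x) '' ((F (ρ + c) \ F (ρ - c) : Finset G) : Set G) := by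
    rintro _ ⟨y, ⟨⟨g, hg, rfl⟩, hy⟩, rfl⟩
    refine ⟨k * g, ?_, mul_smul _ _ _⟩
    rw [Finset.mem_coe, Finset.mem_sdiff]
    refine ⟨by rw [mul_comm]; exact h.mul_mem hg (hc hk), fun hcon => hy ?_⟩
    exact ⟨k * g, h.mono (by omega) hcon, mul_smul _ _ _⟩
  have h1 := ncard_le_ncard hsub ((Finset.finite_toSet _).image _)
  rw [ncard_image_of_injective _ (MulAction.injective k), ncard_image_smul] at h1
  rw [ncard_image_smul]
  have h2 : (F (ρ - c)) ⊆ F (ρ + c) := h.mono (by omega)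
  have h3 := Finset.card_sdiff_add_card_eq_card h2
  have h4 : ((F s).card : ℝ) ≤ (F ρ).card := by
    exact_mod_cast Finset.card_le_card (h.mono (by omega))
  have h5 : ({y ∈ (fun g : G => g • x) '' (F ρ : Set G) |
      k • y ∉ (fun g : G => g • x) '' (F ρ : Set G)}.ncard : ℝ) ≤
      ((F (ρ + c) \ F (ρ - c) : Finset G).card : ℝ) := by exact_mod_cast h1
  have h6 : ((F (ρ + c) \ F (ρ - c) : Finset G).card : ℝ) + (F (ρ - c)).card =
      (F (ρ + c)).card := by exact_mod_cast h3
  nlinarith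

variable (G) in
/-- `U` embeds into `V` by a map locally given by the action. -/
def Emb (U V : Set X) : Prop :=
  ∃ f : X → X, (∀ x ∈ U, LocG G f x) ∧ InjOn f U ∧ MapsTo f U V

theorem weak_comparison (h : UEMin G μ) (hF : IsBalls F C) {U V : Set X} (hU : IsClopen U)
    (hV : IsClopen V) (hlt : C * μ.real U < μ.real V) : Emb G U V := by
  classical
  have hpr := h.prob
  set ε : ℝ := (μ.real V - C * μ.real U) / (2 * (C + 1)) with hε
  have hC : (0 : ℝ) ≤ C := Nat.cast_nonneg C
  have hεpos : 0 < ε := div_pos (by linarith) (by linarith)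
  have hε2 : ε * (2 * (C + 1)) = μ.real V - C * μ.real U := by
    rw [hε]; field_simp
  obtain ⟨K₁, δ₁, hδ₁, H₁⟩ := h.equidist hU hεpos
  obtain ⟨K₂, δ₂, hδ₂, H₂⟩ := h.equidist hV hεpos
  obtain ⟨ρ, hρ⟩ := hF.exists_folner (X := X) (K₁ ∪ K₂) (lt_min hδ₁ hδ₂)
  obtain ⟨A, hAC, hA⟩ := hF.double ρ
  obtain ⟨U', f, hc, hsub, hloc, hinj, hmap, hmove, hmax⟩ :=
    exists_maximal_matching (fun _ => univ) (fun _ => isClopen_univ) (F ρ) hU hV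
  suffices hUU : U' = U by subst hUU; exact ⟨f, hloc, hinj, hmap⟩
  refine Subset.antisymm hsub fun x hx => ?_
  by_contra hx'
  set B : X → Set X := fun y => (fun g : G => g • y) '' (F ρ : Set G) with hB
  have hBf : ∀ y, (B y).Finite := fun y => (F ρ).finite_toSet.image _
  have e1 : B x ∩ V ⊆ f '' (⋃ a ∈ A, B (a • x) ∩ U) := by
    rintro _ ⟨⟨g, hg, rfl⟩, hgV⟩
    obtain ⟨y, hy, e⟩ := hmax x hx hx' g hg trivial hgV
    obtain ⟨k, hk, -, hk'⟩ := hmove y hy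
    refine ⟨y, ?_, e⟩
    have e : f y = g • x := e
    rw [hk'] at e
    have hy2 : y = (k⁻¹ * g) • x := by rw [mul_smul, ← e, inv_smul_smul]
    have hmem : k⁻¹ * g ∈ F (2 * ρ) := by
      rw [two_mul]; exact hF.mul_mem (hF.inv_mem hk) hg
    obtain ⟨a, ha, b, hb, hab⟩ := hA _ hmem
    simp only [mem_iUnion]
    refine ⟨a, ha, ⟨b, hb, ?_⟩, hsub hy⟩
    rw [hy2, hab, mul_comm, mul_smul]
  have hfin : (⋃ a ∈ A, B (a • x) ∩ U).Finite :=
    A.finite_toSet.biUnion fun a _ => (hBf _).inter_of_left U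
  have e2 : (B x ∩ V).ncard ≤ ∑ a ∈ A, (B (a • x) ∩ U).ncard :=
    ((ncard_le_ncard e1 (hfin.image f)).trans (ncard_image_le hfin)).trans
      (Finset.set_ncard_biUnion_le A _)
  have e3 : ((B x ∩ V).ncard : ℝ) ≤ ∑ a ∈ A, ((B (a • x) ∩ U).ncard : ℝ) := by
    exact_mod_cast e2
  have hN : ∀ y, (B y).ncard = (F ρ).card := fun y => ncard_image_smul _ _
  have hNpos : (0 : ℝ) < (F ρ).card := by exact_mod_cast hF.card_pos ρ
  have b1 : ∀ y, ((B y ∩ U).ncard : ℝ) ≤ (μ.real U + ε) * (F ρ).card := by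
    intro y
    have := (abs_le.1 (H₁ _ ((hρ y).mono Finset.subset_union_left (min_le_left _ _)))).2
    rw [show ((fun g : G => g • y) '' (F ρ : Set G)).ncard = _ from hN y] at this
    linarith
  have b2 := (abs_le.1 (H₂ _ ((hρ x).mono Finset.subset_union_right (min_le_right _ _)))).1
  rw [show ((fun g : G => g • x) '' (F ρ : Set G)).ncard = _ from hN x] at b2
  have e4 : ((B x ∩ V).ncard : ℝ) ≤ A.card * ((μ.real U + ε) * (F ρ).card) := by
    refine e3.trans ((Finset.sum_le_sum fun a _ => b1 (a • x)).trans ?_)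
    rw [Finset.sum_const, nsmul_eq_mul]
  have hμ : 0 ≤ μ.real U := measureReal_nonneg
  have e5 : (A.card : ℝ) * ((μ.real U + ε) * (F ρ).card) ≤ C * ((μ.real U + ε) * (F ρ).card) := by
    have : (A.card : ℝ) ≤ C := by exact_mod_cast hAC
    gcongr
  have e6 : (μ.real V - ε) * (F ρ).card ≤ (C * (μ.real U + ε)) * (F ρ).card := by
    simp only [hB] at e4
    linarith
  have e7 := le_of_mul_le_mul_right e6 hNpos
  nlinarith

theorem exists_isClopen_smul_disjoint (E : Finset G) (x : X) :
    ∃ O : Set X, IsClopen O ∧ x ∈ O ∧ ∀ g ∈ E, ∀ y ∈ O, g • y ∈ O → g = 1 := by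
  classical
  induction E using Finset.induction_on with
  | empty => exact ⟨univ, isClopen_univ, trivial, by simp⟩
  | insert a E _ ih =>
    obtain ⟨O, hO, hx, hE⟩ := ih
    by_cases ha : a = 1
    · refine ⟨O, hO, hx, fun g hg y hy hgy => ?_⟩
      rcases Finset.mem_insert.1 hg with rfl | hg
      · exact ha
      · exact hE g hg y hy hgy
    · have hne : a • x ≠ x := fun e => ha (FreeAct.eq_one _ _ e)
      obtain ⟨V, hV, hxV, hVO⟩ := compact_exists_isClopen_in_isOpen
        (isOpen_compl_singleton (x := a • x)) (show x ∈ ({a • x}ᶜ : Set X) from hne.symm)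
      refine ⟨O ∩ (V ∩ (fun y => a • y) ⁻¹' Vᶜ), hO.inter (hV.inter
        (hV.compl.preimage (continuous_const_smul a))), ⟨hx, hxV, fun h => hVO h rfl⟩, ?_⟩
      intro g hg y hy hgy
      rcases Finset.mem_insert.1 hg with rfl | hg
      · exact absurd hgy.2.1 hy.2.2
      · exact hE g hg y hy.1 hgy.1

/-- Clopen markers. -/
theorem exists_marker (E : Finset G) (h1 : (1 : G) ∈ E) (hinv : ∀ g ∈ E, g⁻¹ ∈ E) :
    ∃ M : Set X, IsClopen M ∧ (∀ g ∈ E, ∀ y ∈ M, g • y ∈ M → g = 1) ∧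
      ∀ x, ∃ g ∈ E, g • x ∈ M := by
  classical
  choose O hO hxO hdis using exists_isClopen_smul_disjoint (X := X) E
  obtain ⟨t, ht⟩ := CompactSpace.elim_nhds_subcover O fun x => (hO x).isOpen.mem_nhds (hxO x)
  have key : ∀ t : Finset X, ∃ M : Set X, IsClopen M ∧ (∀ g ∈ E, ∀ y ∈ M, g • y ∈ M → g = 1) ∧
      ∀ i ∈ t, ∀ x ∈ O i, ∃ g ∈ E, g • x ∈ M := by
    intro t
    induction t using Finset.induction_on with
    | empty => exact ⟨∅, isClopen_empty, by simp, by simp⟩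
    | insert a t _ ih =>
      obtain ⟨M, hM, hsep, hcov⟩ := ih
      set N : Set X := O a ∩ ⋂ g ∈ E, (fun y => g • y) ⁻¹' Mᶜ with hN
      have hNc : IsClopen N := (hO a).inter (isClopen_biInter_finset fun g _ =>
        hM.compl.preimage (continuous_const_smul g))
      have hN' : ∀ y ∈ N, ∀ g ∈ E, g • y ∉ M := fun y hy g hg => by
        have := hy.2
        simp only [mem_iInter] at this
        exact this g hg
      refine ⟨M ∪ N, hM.union hNc, ?_, ?_⟩
      · rintro g hg y (hy | hy) (hgy | hgy)
        · exact hsep g hg y hy hgy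
        · exact absurd (by simpa using hy) (hN' _ hgy g⁻¹ (hinv g hg))
        · exact absurd hgy (hN' y hy g hg)
        · exact hdis a g hg y hy.1 hgy.1
      · intro i hi x hx
        rcases Finset.mem_insert.1 hi with rfl | hi
        · by_cases hxN : ∃ g ∈ E, g • x ∈ M
          · obtain ⟨g, hg, hgx⟩ := hxN
            exact ⟨g, hg, Or.inl hgx⟩
          · push Not at hxN
            refine ⟨1, h1, Or.inr ?_⟩
            rw [one_smul]
            refine ⟨hx, ?_⟩
            simp only [mem_iInter]
            exact hxN
        · obtain ⟨g, hg, hgx⟩ := hcov i hi x hx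
          exact ⟨g, hg, Or.inl hgx⟩
  obtain ⟨M, hM, hsep, hcov⟩ := key t
  refine ⟨M, hM, hsep, fun x => ?_⟩
  have : x ∈ ⋃ i ∈ t, O i := ht ▸ mem_univ x
  simp only [mem_iUnion] at this
  obtain ⟨i, hi, hx⟩ := this
  exact hcov i hi x hx

theorem UEMin.real_preimage (h : UEMin G μ) (g : G) {A : Set X} (hA : IsClopen A) :
    μ.real ((fun x => g • x) ⁻¹' A) = μ.real A := by
  rw [Measure.real, h.inv.preimage g hA.isOpen.measurableSet, Measure.real]

theorem UEMin.card_mul_le_one (h : UEMin G μ) (A : Finset G) {M : Set X} (hM : IsClopen M)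
    (hd : ∀ g ∈ A, ∀ g' ∈ A, ∀ x, g • x ∈ M → g' • x ∈ M → g = g') :
    A.card * μ.real M ≤ 1 := by
  have := h.prob
  calc (A.card : ℝ) * μ.real M = ∑ g ∈ A, μ.real ((fun x => g • x) ⁻¹' M) := by
        simp_rw [h.real_preimage _ hM]; simp
    _ = μ.real (⋃ g ∈ A, (fun x => g • x) ⁻¹' M) := by
        rw [measureReal_biUnion_finset]
        · intro g hg g' hg' hne
          rw [Function.onFun, Set.disjoint_left]
          intro x hx hx'
          exact hne (hd g hg g' hg' x hx hx')
        · intro g _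
          exact (hM.preimage (continuous_const_smul g)).isOpen.measurableSet
    _ ≤ 1 := measureReal_le_one

theorem UEMin.real_le_card_mul (h : UEMin G μ) (A : Finset G) {M V : Set X} (hM : IsClopen M)
    (hd : ∀ x ∈ V, ∃ g ∈ A, g • x ∈ M) : μ.real V ≤ A.card * μ.real M := by
  have := h.prob
  calc μ.real V ≤ μ.real (⋃ g ∈ A, (fun x => g • x) ⁻¹' M) := by
        refine measureReal_mono (fun x hx => ?_) (measure_ne_top _ _)
        obtain ⟨g, hg, hgx⟩ := hd x hx
        exact mem_biUnion hg hgx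
    _ ≤ ∑ g ∈ A, μ.real ((fun x => g • x) ⁻¹' M) := measureReal_biUnion_finset_le _ _
    _ = A.card * μ.real M := by simp_rw [h.real_preimage _ hM]; simp

end Meas

end CantorOrbit

namespace CantorOrbit

open Set Topology Filter ProbabilityTheory

theorem eventually_mem_iff_of_isClopen {X : Type*} [TopologicalSpace X] {A : Set X}
    (hA : IsClopen A) (x : X) : ∀ᶠ y in 𝓝 x, (y ∈ A ↔ x ∈ A) := by
  by_cases hx : x ∈ A
  · filter_upwards [hA.isOpen.mem_nhds hx] with y hy
    simp [hx, hy]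
  · filter_upwards [hA.compl.isOpen.mem_nhds hx] with y hy
    simp only [hx, iff_false]
    exact hy

section Meas

variable {G X : Type*} [CommGroup G] [MulAction G X] [TopologicalSpace X]
  [ContinuousConstSMul G X] [FreeAct G X] [CompactSpace X] [PolishSpace X]
  [TotallyDisconnectedSpace X] [MeasurableSpace X] [BorelSpace X] [Countable G]
  {F : ℕ → Finset G} {C : ℕ} {μ : Measure X} {T : X → X → Prop}

open Classical in
theorem ncard_rel_eq {B : Finset G} (hB : ∀ x y, T x y → ∃ g ∈ B, y = g • x)
    (P : X → X → Prop) (x : X) :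
    {y | T x y ∧ P x y}.ncard = (B.filter fun g => T x (g • x) ∧ P x (g • x)).card := by
  rw [← ncard_image_smul (X := X) _ x]
  congr 1
  ext y
  constructor
  · rintro ⟨h1, h2⟩
    obtain ⟨g, hg, rfl⟩ := hB x y h1
    exact ⟨g, by simp [hg, h1, h2], rfl⟩
  · rintro ⟨g, hg, rfl⟩
    have := (Finset.mem_filter.1 (Finset.mem_coe.1 hg)).2
    exact this

theorem ClopenRel.isLocallyConstant_ncard (hT : ClopenRel G T) {P : X → X → Prop}
    (hP : ∀ g : G, IsClopen {x | P x (g • x)}) :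
    IsLocallyConstant fun x => {y | T x y ∧ P x y}.ncard := by
  classical
  obtain ⟨B, hB⟩ := hT.bdd
  rw [IsLocallyConstant.iff_eventually_eq]
  intro x
  have h : ∀ᶠ y in 𝓝 x, ∀ g ∈ B, ((T y (g • y) ∧ P y (g • y)) ↔ (T x (g • x) ∧ P x (g • x))) := by
    rw [Filter.eventually_all_finset]
    intro g _
    exact eventually_mem_iff_of_isClopen ((hT.clopen g).inter (hP g)) x
  filter_upwards [h] with y hy
  rw [ncard_rel_eq hB, ncard_rel_eq hB, Finset.filter_congr hy]

theorem ClopenRel.isLocallyConstant_ncard_mem (hT : ClopenRel G T) {V : Set X}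
    (hV : IsClopen V) : IsLocallyConstant fun x => {y | T x y ∧ y ∈ V}.ncard :=
  hT.isLocallyConstant_ncard (P := fun _ y => y ∈ V)
    fun g => hV.preimage (continuous_const_smul g)

theorem ClopenRel.isLocallyConstant_ncard_cls (hT : ClopenRel G T) :
    IsLocallyConstant fun x => {y | T x y}.ncard := by
  simpa using hT.isLocallyConstant_ncard_mem isClopen_univ

theorem ClopenRel.sep_eq (hT : ClopenRel G T) {x y : X} (hxy : T x y) (P : X → Prop) :
    {z | T x z ∧ P z} = {z | T y z ∧ P z} := by
  have := hT.cls_eq hxy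
  ext z
  have : T x z ↔ T y z := Set.ext_iff.1 this z
  simp [this]

/-- Mass transport: the set of classes with a high proportion of `V` is small if `V` is. -/
theorem ClopenRel.real_bad_le (hT : ClopenRel G T) (h : UEMin G μ) {V : Set X} (hV : IsClopen V)
    {η : ℝ} (hη : 0 < η) :
    η * μ.real {x | η * {y | T x y}.ncard < {y | T x y ∧ y ∈ V}.ncard} ≤ μ.real V := by
  classical
  have := h.prob
  obtain ⟨B, hB⟩ := hT.bdd
  set N : X → ℝ≥0∞ := fun x => ({y | T x y}.ncard : ℝ≥0∞) with hN
  have hNc : IsLocallyConstant N := hT.isLocallyConstant_ncard_cls.comp fun n : ℕ => (n : ℝ≥0∞)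
  have hNm : Measurable N := hNc.continuous.measurable
  have hN0 : ∀ x, N x ≠ 0 := fun x => by
    simp only [hN, ne_eq, Nat.cast_eq_zero]; exact (hT.ncard_pos x).ne'
  have hNt : ∀ x, N x ≠ ∞ := fun x => ENNReal.natCast_ne_top _
  set χ : G → X → ℝ≥0∞ := fun g => Set.indicator {y | T (g⁻¹ • y) y ∧ y ∈ V} fun y => (N y)⁻¹
    with hχ
  have hinv : ∀ g : G, IsClopen {y | T (g⁻¹ • y) y} := fun g => by
    have := hT.clopen g⁻¹
    convert this using 2
    exact funext fun y => propext ⟨hT.equiv.symm, hT.equiv.symm⟩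
  have hAm : ∀ g : G, MeasurableSet {y | T (g⁻¹ • y) y ∧ y ∈ V} := fun g =>
    ((hinv g).inter hV).isOpen.measurableSet
  have hχm : ∀ g, Measurable (χ g) := fun g => hNm.inv.indicator (hAm g)
  have e1 : ∀ g, ∫⁻ x, χ g (g • x) ∂μ = ∫⁻ y, χ g y ∂μ := by
    intro g
    conv_rhs => rw [← h.inv g]
    rw [lintegral_map (hχm g) (measurable_smul_left g)]
  have e2 : ∀ x, ∑ g ∈ B, χ g (g • x) = ({y | T x y ∧ y ∈ V}.ncard : ℝ≥0∞) * (N x)⁻¹ := by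
    intro x
    rw [ncard_rel_eq hB (fun _ y => y ∈ V), Finset.card_filter]
    push_cast
    rw [Finset.sum_mul]
    refine Finset.sum_congr rfl fun g _ => ?_
    simp only [hχ, Set.indicator_apply, mem_ofPred_eq, inv_smul_smul]
    split_ifs with hc
    · rw [one_mul]
      simp only [hN]
      rw [hT.cls_eq hc.1]
    · simp
  have e3 : ∀ y, ∑ g ∈ B, χ g y = V.indicator (fun _ => 1) y := by
    intro y
    by_cases hy : y ∈ V
    · have : ∀ g ∈ B, χ g y = (if T (g⁻¹ • y) y then 1 else 0) * (N y)⁻¹ := by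
        intro g _
        simp [hχ, Set.indicator_apply, hy]
      rw [Finset.sum_congr rfl this, ← Finset.sum_mul, Finset.sum_boole]
      have hcard : (B.filter fun g => T (g⁻¹ • y) y).card = {z | T y z}.ncard := by
        rw [← ncard_coe_finset, ← ncard_image_of_injective (f := fun g : G => g⁻¹ • y) _
          fun g g' e => inv_injective (FreeAct.smul_inj e)]
        congr 1
        ext z
        constructor
        · rintro ⟨g, hg, rfl⟩
          exact hT.equiv.symm (Finset.mem_filter.1 (Finset.mem_coe.1 hg)).2
        · intro hz
          obtain ⟨g, hg, e⟩ := hB z y (hT.equiv.symm hz)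
          have e' : g⁻¹ • y = z := by rw [e, inv_smul_smul]
          refine ⟨g, ?_, e'⟩
          rw [Finset.mem_coe, Finset.mem_filter, e']
          exact ⟨hg, hT.equiv.symm hz⟩
      rw [hcard, Set.indicator_of_mem hy]
      exact ENNReal.mul_inv_cancel (hN0 y) (hNt y)
    · rw [Set.indicator_of_notMem hy]
      refine Finset.sum_eq_zero fun g _ => ?_
      simp [hχ, hy]
  have e4 : ∫⁻ x, ({y | T x y ∧ y ∈ V}.ncard : ℝ≥0∞) * (N x)⁻¹ ∂μ = μ V := by
    simp_rw [← e2]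
    rw [lintegral_finsetSum (f := fun g x => χ g (g • x)) _
      fun g _ => (hχm g).comp (measurable_smul_left g)]
    simp_rw [e1]
    rw [← lintegral_finsetSum _ fun g _ => hχm g]
    simp_rw [e3]
    rw [lintegral_indicator hV.isOpen.measurableSet]
    simp
  have hfm : Measurable fun x => ({y | T x y ∧ y ∈ V}.ncard : ℝ≥0∞) * (N x)⁻¹ := by
    refine Measurable.mul ?_ hNm.inv
    exact ((hT.isLocallyConstant_ncard_mem hV).comp fun n : ℕ => (n : ℝ≥0∞)).continuous.measurable
  have e5 := mul_meas_ge_le_lintegral (μ := μ) hfm (ENNReal.ofReal η)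
  rw [e4] at e5
  have e6 : {x | η * {y | T x y}.ncard < {y | T x y ∧ y ∈ V}.ncard} ⊆
      {x | ENNReal.ofReal η ≤ ({y | T x y ∧ y ∈ V}.ncard : ℝ≥0∞) * (N x)⁻¹} := by
    intro x hx
    have hx : η * {y | T x y}.ncard < {y | T x y ∧ y ∈ V}.ncard := hx
    change ENNReal.ofReal η ≤ ({y | T x y ∧ y ∈ V}.ncard : ℝ≥0∞) * (N x)⁻¹
    rw [← div_eq_mul_inv, ENNReal.le_div_iff_mul_le (Or.inl (hN0 x)) (Or.inl (hNt x))]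
    simp only [hN]
    rw [← ENNReal.ofReal_natCast, ← ENNReal.ofReal_natCast, ← ENNReal.ofReal_mul hη.le]
    exact ENNReal.ofReal_le_ofReal hx.le
  have e7 : ENNReal.ofReal η * μ {x | η * {y | T x y}.ncard < {y | T x y ∧ y ∈ V}.ncard} ≤ μ V :=
    (mul_le_mul_right (measure_mono e6) _).trans e5
  have e8 := ENNReal.toReal_mono (measure_ne_top _ _) e7
  rwa [ENNReal.toReal_mul, ENNReal.toReal_ofReal hη.le] at e8

/-- A clopen relation whose classes mostly have small boundary. -/
theorem exists_clopenRel_carve (h : UEMin G μ) (hF : IsBalls F C) (K : Finset G) {ε : ℝ}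
    (hε : 0 < ε) : ∃ T : X → X → Prop, ClopenRel G T ∧
      IsClopen {x | ∃ k ∈ K, ¬ T x (k • x)} ∧ μ.real {x | ∃ k ∈ K, ¬ T x (k • x)} ≤ ε := by
  classical
  have := h.prob
  obtain ⟨c, hc⟩ := hF.exists_superset K
  obtain ⟨s, ρ, -, hρ, hthin⟩ := hF.exists_thin c 0 hε
  obtain ⟨M, hM, hsep, hcov⟩ := exists_marker (X := X) (F (2 * s)) (hF.one_mem _)
    (fun g hg => hF.inv_mem hg)
  set T : X → X → Prop := fun x y => ∀ z ∈ M, (∃ g ∈ F ρ, z = g • x) ↔ ∃ g ∈ F ρ, z = g • y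
    with hT
  have hTiff : ∀ (g : G) x, T x (g • x) ↔
      ∀ k ∈ F ρ ∪ (F ρ).image (· * g), k • x ∈ M → (k ∈ F ρ ∧ k * g⁻¹ ∈ F ρ) := by
    intro g x
    constructor
    · intro ht k hk hkM
      have := ht _ hkM
      have e1 : (∃ a ∈ F ρ, k • x = a • x) ↔ k ∈ F ρ :=
        ⟨fun ⟨a, ha, e⟩ => FreeAct.smul_inj e ▸ ha, fun hk => ⟨k, hk, rfl⟩⟩
      have e2 : (∃ a ∈ F ρ, k • x = a • g • x) ↔ k * g⁻¹ ∈ F ρ := by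
        constructor
        · rintro ⟨a, ha, e⟩
          rw [← mul_smul] at e
          rw [FreeAct.smul_inj e]; simpa
        · exact fun hk => ⟨k * g⁻¹, hk, by rw [← mul_smul]; simp⟩
      rw [e1, e2] at this
      rcases Finset.mem_union.1 hk with hk | hk
      · exact ⟨hk, this.1 hk⟩
      · obtain ⟨a, ha, rfl⟩ := Finset.mem_image.1 hk
        have h2 : a * g * g⁻¹ ∈ F ρ := by simpa
        exact ⟨this.2 h2, h2⟩
    · intro H z hz
      constructor
      · rintro ⟨k, hk, rfl⟩
        exact ⟨k * g⁻¹, (H k (Finset.mem_union_left _ hk) hz).2, by rw [← mul_smul]; simp⟩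
      · rintro ⟨k, hk, rfl⟩
        rw [← mul_smul] at hz ⊢
        exact ⟨k * g, (H _ (Finset.mem_union_right _ (Finset.mem_image_of_mem _ hk)) hz).1, rfl⟩
  have hrel : ClopenRel G T := by
    refine ⟨⟨fun x z _ => Iff.rfl, fun ht z hz => (ht z hz).symm,
      fun h1 h2 z hz => (h1 z hz).trans (h2 z hz)⟩, ?_, ?_⟩
    · refine ⟨F (ρ + ρ), fun x y hxy => ?_⟩
      obtain ⟨a, ha, haM⟩ := hcov x
      have ha' : a ∈ F ρ := hF.mono (by omega) ha
      obtain ⟨b, hb, e⟩ := (hxy _ haM).1 ⟨a, ha', rfl⟩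
      refine ⟨b⁻¹ * a, hF.mul_mem (hF.inv_mem hb) ha', ?_⟩
      rw [mul_smul, e, inv_smul_smul]
    · intro g
      have : {x | T x (g • x)} = ⋂ k ∈ F ρ ∪ (F ρ).image (· * g),
          {x | k • x ∈ M → (k ∈ F ρ ∧ k * g⁻¹ ∈ F ρ)} := by
        ext x
        simp only [mem_iInter, mem_ofPred_eq]
        exact hTiff g x
      rw [this]
      refine isClopen_biInter_finset fun k _ => ?_
      by_cases hk : k ∈ F ρ ∧ k * g⁻¹ ∈ F ρ
      · simp only [hk, and_self, implies_true]; exact isClopen_univ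
      · simp only [hk, imp_false]
        exact (hM.preimage (continuous_const_smul k)).compl
  have hcl : IsClopen {x | ∃ k ∈ K, ¬ T x (k • x)} := by
    have : {x | ∃ k ∈ K, ¬ T x (k • x)} = ⋃ k ∈ K, {x | T x (k • x)}ᶜ := by
      ext x; simp
    rw [this]
    exact K.finite_toSet.isClopen_biUnion fun k _ => (hrel.clopen k).compl
  refine ⟨T, hrel, hcl, ?_⟩
  have h1 := h.real_le_card_mul (F (ρ + c) \ F (ρ - c)) hM
    (V := {x | ∃ k ∈ K, ¬ T x (k • x)}) (by
      rintro x ⟨k, hk, hTk⟩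
      rw [hTiff] at hTk
      push Not at hTk
      obtain ⟨a, ha, haM, hak⟩ := hTk
      refine ⟨a, ?_, haM⟩
      rw [Finset.mem_sdiff]
      constructor
      · rcases Finset.mem_union.1 ha with ha | ha
        · exact hF.mono (by omega) ha
        · obtain ⟨b, hb, rfl⟩ := Finset.mem_image.1 ha
          exact hF.mul_mem hb (hc hk)
      · intro hcon
        refine hak (hF.mono (by omega) hcon) ?_
        have := hF.mul_mem hcon (hF.inv_mem (hc hk))
        exact hF.mono (by omega) this)
  have h2 := h.card_mul_le_one (F s) hM (by
    intro g hg g' hg' x hgx hgx'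
    have := hsep (g' * g⁻¹) (by rw [two_mul]; exact hF.mul_mem hg' (hF.inv_mem hg)) (g • x) hgx
      (by rwa [← mul_smul, inv_mul_cancel_right])
    rw [mul_inv_eq_one] at this
    exact this.symm)
  have h3 := Finset.card_sdiff_add_card_eq_card (hF.mono (show ρ - c ≤ ρ + c by omega))
  have h4 : ((F (ρ + c) \ F (ρ - c)).card : ℝ) + (F (ρ - c)).card = (F (ρ + c)).card := by
    exact_mod_cast h3
  have h5 : ((F (ρ + c) \ F (ρ - c)).card : ℝ) ≤ ε * (F s).card := by linarith
  calc _ ≤ _ := h1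
    _ ≤ ε * (F s).card * μ.real M := by gcongr
    _ = ε * ((F s).card * μ.real M) := by ring
    _ ≤ ε := by nlinarith

/-- Clopen tilings of the orbits by almost invariant sets. -/
theorem exists_tiling (h : UEMin G μ) (hF : IsBalls F C) (K : Finset G) {ε : ℝ}
    (hε : 0 < ε) : ∃ T : X → X → Prop, ClopenRel G T ∧
      ∀ x, ({y | T x y ∧ ∃ k ∈ K, ¬ T y (k • y)}.ncard : ℝ) ≤ ε * {y | T x y}.ncard := by
  classical
  have := h.prob
  have hinf := h.infinite
  -- a large ball
  obtain ⟨r, hr⟩ : ∃ r, 4 / ε ≤ (F r).card := by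
    obtain ⟨n, hn⟩ := exists_nat_ge (4 / ε)
    obtain ⟨A, hA⟩ := Infinite.exists_subset_card_eq G n
    obtain ⟨r, hr⟩ := hF.exists_superset A
    exact ⟨r, hn.trans (by exact_mod_cast hA ▸ Finset.card_le_card hr)⟩
  obtain ⟨W₀, hW₀, hsep, hcov⟩ := exists_marker (X := X) (F (2 * r)) (hF.one_mem _)
    (fun g hg => hF.inv_mem hg)
  have hN : (0 : ℝ) < (F (2 * r)).card := by exact_mod_cast hF.card_pos _
  have hW₀μ := h.real_le_card_mul (F (2 * r)) hW₀ (V := univ) (fun x _ => hcov x)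
  rw [probReal_univ] at hW₀μ
  set N : ℝ := ((F (2 * r)).card : ℝ) with hNdef
  have hC : (0 : ℝ) ≤ C := Nat.cast_nonneg C
  have hε₁ : 0 < ε / 4 / (2 * (C + 1) * N) := by positivity
  obtain ⟨T, hT, hVc, hVμ⟩ := exists_clopenRel_carve h hF (K ∪ F r) hε₁
  set V : Set X := {x | ∃ k ∈ K ∪ F r, ¬ T x (k • x)} with hV
  have hbad := hT.real_bad_le h hVc (show 0 < ε / 4 by positivity)
  set S : Set X := {x | ε / 4 * {y | T x y}.ncard < {y | T x y ∧ y ∈ V}.ncard} with hS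
  have hSc : IsClopen S := by
    have h1 : IsLocallyConstant fun x => ({y | T x y}.ncard, {y | T x y ∧ y ∈ V}.ncard) :=
      hT.isLocallyConstant_ncard_cls.prodMk (hT.isLocallyConstant_ncard_mem hVc)
    exact ⟨⟨h1 {p : ℕ × ℕ | ε / 4 * (p.1 : ℝ) < p.2}ᶜ⟩,
      h1 {p : ℕ × ℕ | ε / 4 * (p.1 : ℝ) < p.2}⟩
  have hSμ : μ.real S * (2 * (C + 1) * N) ≤ 1 := by
    have h1 : ε / 4 * μ.real S ≤ ε / 4 / (2 * (C + 1) * N) := hbad.trans hVμ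
    rw [le_div_iff₀ (by positivity)] at h1
    have h2 : (0 : ℝ) < ε / 4 := by positivity
    nlinarith
  have hSinv : ∀ x y, T x y → (x ∈ S ↔ y ∈ S) := by
    intro x y hxy
    change (ε / 4 * {z | T x z}.ncard < {z | T x z ∧ z ∈ V}.ncard) ↔
      (ε / 4 * {z | T y z}.ncard < {z | T y z ∧ z ∈ V}.ncard)
    rw [hT.cls_eq hxy, hT.sep_eq hxy (· ∈ V)]
  set W : Set X := W₀ \ S with hW
  have hWc : IsClopen W := hW₀.diff hSc
  have hWμ : μ.real W₀ - μ.real S ≤ μ.real W := by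
    have : μ.real W₀ ≤ μ.real W + μ.real S := by
      refine (measureReal_mono (fun x hx => ?_) (measure_ne_top _ _)).trans
        (measureReal_union_le _ _)
      by_cases hxS : x ∈ S
      · exact Or.inr hxS
      · exact Or.inl ⟨hx, hxS⟩
    linarith
  have hS0 : 0 ≤ μ.real S := measureReal_nonneg
  obtain ⟨f, hloc, hinj, hmap⟩ := weak_comparison h hF hSc hWc (by
    by_contra hcon
    push Not at hcon
    have h1 : μ.real W₀ ≤ (C + 1) * μ.real S := by linarith
    nlinarith)
  set π : X → X := S.piecewise f id with hπ
  have hπS : ∀ x ∈ S, π x = f x := fun x hx => piecewise_eq_of_mem _ _ _ hx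
  have hπS' : ∀ x ∉ S, π x = x := fun x hx => piecewise_eq_of_notMem _ _ _ hx
  have hπloc : ∀ x, LocG G π x := by
    intro x
    by_cases hx : x ∈ S
    · refine (hloc x hx).congr ?_
      filter_upwards [hSc.isOpen.mem_nhds hx] with y hy using hπS y hy
    · refine ⟨1, ?_⟩
      filter_upwards [hSc.compl.isOpen.mem_nhds hx] with y hy
      rw [hπS' y hy, one_smul]
  have hπnot : ∀ x, π x ∉ S := by
    intro x
    by_cases hx : x ∈ S
    · rw [hπS x hx]; exact (hmap hx).2
    · rwa [hπS' x hx]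
  refine ⟨_, hT.comap hπloc, fun x => ?_⟩
  have hrel := hT.comap hπloc
  set c : Set X := {y | T (π x) y} with hcdef
  have hcfin : c.Finite := hT.finite _
  have hcS : ∀ y ∈ c, y ∉ S := fun y hy hyS => hπnot x ((hSinv _ _ hy).2 hyS)
  have hVfin : {y | T (π x) y ∧ y ∈ V}.Finite := hcfin.subset fun y hy => hy.1
  have hgood : ({y | T (π x) y ∧ y ∈ V}.ncard : ℝ) ≤ ε / 4 * c.ncard := by
    have := hπnot x
    exact not_lt.1 this
  -- the markers inside a good class are sparse
  have hWcount : ((c ∩ W).ncard : ℝ) ≤ ε / 2 * c.ncard := by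
    set c₁ : Set X := {y ∈ c ∩ W | y ∉ V} with hc₁
    have hc₁fin : c₁.Finite := hcfin.subset fun y hy => hy.1.1
    have h1 : c ∩ W ⊆ c₁ ∪ {y | T (π x) y ∧ y ∈ V} := by
      intro y hy
      by_cases hyV : y ∈ V
      · exact Or.inr ⟨hy.1, hyV⟩
      · exact Or.inl ⟨hy, hyV⟩
    have h2 : c₁.ncard * (F r).card ≤ c.ncard := by
      rw [← ncard_coe_finset (F r), ← ncard_prod]
      refine ncard_le_ncard_of_injOn (fun p : X × G => p.2 • p.1) ?_ ?_ hcfin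
      · rintro ⟨y, g⟩ ⟨hy, hg⟩
        have hg : g ∈ F r := hg
        have hyV : y ∉ V := hy.2
        have : T y (g • y) := by
          by_contra hcon
          exact hyV ⟨g, Finset.mem_union_right _ hg, hcon⟩
        exact hT.equiv.trans hy.1.1 this
      · rintro ⟨y, g⟩ ⟨hy, hg⟩ ⟨y', g'⟩ ⟨hy', hg'⟩ e
        have hg : g ∈ F r := hg
        have hg' : g' ∈ F r := hg'
        have e : g • y = g' • y' := e
        have e1 : (g'⁻¹ * g) • y = y' := by rw [mul_smul, e, inv_smul_smul]
        have e2 : g'⁻¹ * g = 1 := hsep _ (by rw [two_mul]; exact hF.mul_mem (hF.inv_mem hg') hg)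
          y hy.1.2.1 (by rw [e1]; exact hy'.1.2.1)
        rw [e2, one_smul] at e1
        rw [inv_mul_eq_one] at e2
        rw [e1, e2]
    have h3 : (c₁.ncard : ℝ) * (F r).card ≤ c.ncard := by exact_mod_cast h2
    have h4 : ((c ∩ W).ncard : ℝ) ≤ c₁.ncard + {y | T (π x) y ∧ y ∈ V}.ncard := by
      exact_mod_cast (ncard_le_ncard h1 (hc₁fin.union hVfin)).trans (ncard_union_le _ _)
    have h5 : (c₁.ncard : ℝ) ≤ ε / 4 * c.ncard := by
      have h6 : (c₁.ncard : ℝ) * (4 / ε) ≤ c.ncard :=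
        (mul_le_mul_of_nonneg_left hr (Nat.cast_nonneg _)).trans h3
      rw [mul_div_assoc', div_le_iff₀ hε] at h6
      linarith
    linarith
  have hsub : {y | T (π x) (π y) ∧ ∃ k ∈ K, ¬ T (π y) (π (k • y))} ⊆
      {y | T (π x) y ∧ y ∈ V} ∪ (S ∩ f ⁻¹' (c ∩ W)) := by
    rintro y ⟨hy, k, hk, hTk⟩
    by_cases hyS : y ∈ S
    · refine Or.inr ⟨hyS, ?_, hmap hyS⟩
      rw [hπS y hyS] at hy
      exact hy
    · refine Or.inl ?_
      rw [hπS' y hyS] at hy hTk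
      refine ⟨hy, k, Finset.mem_union_left _ hk, fun hcon => ?_⟩
      have : k • y ∉ S := hcS _ (hT.equiv.trans hy hcon)
      rw [hπS' _ this] at hTk
      exact hTk hcon
  have hpre : (S ∩ f ⁻¹' (c ∩ W)).ncard ≤ (c ∩ W).ncard :=
    ncard_le_ncard_of_injOn f (fun y hy => hy.2) (hinj.mono inter_subset_left)
      (hcfin.inter_of_left W)
  have hprefin : (S ∩ f ⁻¹' (c ∩ W)).Finite := by
    refine Set.Finite.of_finite_image ((hcfin.inter_of_left W).subset ?_)
      (hinj.mono inter_subset_left)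
    rintro _ ⟨y, hy, rfl⟩
    exact hy.2
  have hfinal : {y | T (π x) (π y) ∧ ∃ k ∈ K, ¬ T (π y) (π (k • y))}.ncard ≤
      {y | T (π x) y ∧ y ∈ V}.ncard + (c ∩ W).ncard :=
    (ncard_le_ncard hsub (hVfin.union hprefin)).trans
      ((ncard_union_le _ _).trans (Nat.add_le_add_left hpre _))
  have hfinal' : ({y | T (π x) (π y) ∧ ∃ k ∈ K, ¬ T (π y) (π (k • y))}.ncard : ℝ) ≤
      {y | T (π x) y ∧ y ∈ V}.ncard + (c ∩ W).ncard := by exact_mod_cast hfinal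
  have hcle : (c.ncard : ℝ) ≤ {y | T (π x) (π y)}.ncard := by
    have : c ⊆ {y | T (π x) (π y)} := fun y hy => by
      change T (π x) (π y)
      rw [hπS' y (hcS y hy)]; exact hy
    exact_mod_cast ncard_le_ncard this (hrel.finite x)
  have hc0 : (0 : ℝ) ≤ c.ncard := Nat.cast_nonneg _
  nlinarith

end Meas

end CantorOrbit

namespace CantorOrbit

open Set Topology Filter ProbabilityTheory

section Meas

variable {G X : Type*} [CommGroup G] [MulAction G X] [TopologicalSpace X]
  [ContinuousConstSMul G X] [FreeAct G X] [CompactSpace X] [PolishSpace X]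
  [TotallyDisconnectedSpace X] [MeasurableSpace X] [BorelSpace X] [Countable G]
  {F : ℕ → Finset G} {C : ℕ} {μ : Measure X} {T : X → X → Prop}

/-- Tilings whose tiles have small boundary and see prescribed clopen sets with the right
frequency. -/
theorem exists_tiling_equidist (h : UEMin G μ) (hF : IsBalls F C) (K : Finset G) {ι : Type*}
    (s : Finset ι) (U : ι → Set X) (hU : ∀ i ∈ s, IsClopen (U i)) {ε : ℝ} (hε : 0 < ε) :
    ∃ T : X → X → Prop, ClopenRel G T ∧
      (∀ x, ({y | T x y ∧ ∃ k ∈ K, ¬ T y (k • y)}.ncard : ℝ) ≤ ε * {y | T x y}.ncard) ∧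
      ∀ i ∈ s, ∀ x, |({y | T x y ∧ y ∈ U i}.ncard : ℝ) - μ.real (U i) * {y | T x y}.ncard| ≤
        ε * {y | T x y}.ncard := by
  classical
  have key : ∃ (K' : Finset G) (δ : ℝ), 0 < δ ∧ ∀ S : Set X, Folner K' δ S → ∀ i ∈ s,
      |((S ∩ U i).ncard : ℝ) - μ.real (U i) * S.ncard| ≤ ε * S.ncard := by
    induction s using Finset.induction_on with
    | empty => exact ⟨∅, 1, one_pos, by simp⟩
    | insert a s _ ih =>
      obtain ⟨K₁, δ₁, hδ₁, H₁⟩ := ih fun i hi => hU i (Finset.mem_insert_of_mem hi)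
      obtain ⟨K₂, δ₂, hδ₂, H₂⟩ := h.equidist (hU a (Finset.mem_insert_self _ _)) hε
      refine ⟨K₁ ∪ K₂, min δ₁ δ₂, lt_min hδ₁ hδ₂, fun S hS i hi => ?_⟩
      rcases Finset.mem_insert.1 hi with rfl | hi
      · exact H₂ S (hS.mono Finset.subset_union_right (min_le_right _ _))
      · exact H₁ S (hS.mono Finset.subset_union_left (min_le_left _ _)) i hi
  obtain ⟨K', δ, hδ, H⟩ := key
  obtain ⟨T, hT, hb⟩ := exists_tiling h hF (K ∪ K') (lt_min hε hδ)
  have hmono : ∀ (K₁ : Finset G) (x : X) (P : X → Prop),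
      (∀ y, T x y → P y → ∃ k ∈ K ∪ K', ¬ T y (k • y)) →
      ({y | T x y ∧ P y}.ncard : ℝ) ≤ min ε δ * {y | T x y}.ncard := by
    intro K₁ x P hP
    refine le_trans ?_ (hb x)
    have := ncard_le_ncard (s := {y | T x y ∧ P y})
      (t := {y | T x y ∧ ∃ k ∈ K ∪ K', ¬ T y (k • y)}) (fun y hy => ⟨hy.1, hP y hy.1 hy.2⟩)
      ((hT.finite x).subset fun y hy => hy.1)
    exact_mod_cast this
  refine ⟨T, hT, fun x => ?_, fun i hi x => ?_⟩
  · refine (hmono K x _ fun y _ hy => ?_).trans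
      (mul_le_mul_of_nonneg_right (min_le_left _ _) (Nat.cast_nonneg _))
    obtain ⟨k, hk, h'⟩ := hy
    exact ⟨k, Finset.mem_union_left _ hk, h'⟩
  · refine H {y | T x y} ⟨hT.finite x, ⟨x, hT.equiv.refl x⟩, fun k hk => ?_⟩ i hi
    refine (hmono K x _ fun y hy hky => ?_).trans
      (mul_le_mul_of_nonneg_right (min_le_right _ _) (Nat.cast_nonneg _))
    exact ⟨k, Finset.mem_union_right _ hk, fun hcon => hky (hT.equiv.trans hy hcon)⟩

theorem comparison (h : UEMin G μ) (hF : IsBalls F C) {U V : Set X} (hU : IsClopen U)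
    (hV : IsClopen V) (hlt : μ.real U < μ.real V) : Emb G U V := by
  classical
  obtain ⟨T, hT, -, H⟩ := exists_tiling_equidist h hF ∅ Finset.univ
    (fun b : Bool => if b then U else V) (by intro i _; cases i <;> simp [hU, hV])
    (show 0 < (μ.real V - μ.real U) / 3 by linarith)
  have hcard : ∀ x, {y | T x y ∧ y ∈ U}.ncard < {y | T x y ∧ y ∈ V}.ncard := by
    intro x
    have h1 := (abs_le.1 (H true (Finset.mem_univ _) x)).2
    have h2 := (abs_le.1 (H false (Finset.mem_univ _) x)).1
    simp only [if_true, Bool.false_eq_true, if_false] at h1 h2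
    have h3 : (0 : ℝ) < {y | T x y}.ncard := by exact_mod_cast hT.ncard_pos x
    have h4 : ({y | T x y ∧ y ∈ U}.ncard : ℝ) < {y | T x y ∧ y ∈ V}.ncard := by nlinarith
    exact_mod_cast h4
  obtain ⟨B, hB⟩ := hT.bdd
  obtain ⟨U', f, hc, hsub, hloc, hinj, hmap, hmove, hmax⟩ :=
    exists_maximal_matching (fun g => {x | T x (g • x)}) hT.clopen B hU hV
  suffices hUU : U' = U by subst hUU; exact ⟨f, hloc, hinj, hmap⟩
  refine Subset.antisymm hsub fun x hx => ?_
  by_contra hx'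
  refine absurd (hcard x) (not_lt.2 ?_)
  have hfin : {y | T x y ∧ y ∈ U}.Finite := (hT.finite x).subset fun y hy => hy.1
  refine (ncard_le_ncard (t := f '' {y | T x y ∧ y ∈ U}) ?_ (hfin.image f)).trans
    (ncard_image_le hfin)
  rintro y ⟨hxy, hyV⟩
  obtain ⟨g, hg, rfl⟩ := hB x y hxy
  obtain ⟨z, hz, e⟩ := hmax x hx hx' g hg hxy hyV
  refine ⟨z, ⟨?_, hsub hz⟩, e⟩
  obtain ⟨k, hk, hTk, hk'⟩ := hmove z hz
  have e : f z = g • x := e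
  have hTk : T z (k • z) := hTk
  rw [← hk', e] at hTk
  exact hT.equiv.trans hxy (hT.equiv.symm hTk)

theorem UEMin.exists_small (h : UEMin G μ) {x : X} {U : Set X} (hU : IsOpen U) (hx : x ∈ U)
    {ε : ℝ} (hε : 0 < ε) : ∃ W : Set X, IsClopen W ∧ x ∈ W ∧ W ⊆ U ∧ μ.real W < ε := by
  have := h.prob
  obtain ⟨O, hxO, hO, hlt⟩ := Set.exists_isOpen_lt_of_lt ({x} : Set X) (ENNReal.ofReal ε)
    (μ := μ) (by rw [h.measure_singleton x]; exact ENNReal.ofReal_pos.2 hε)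
  obtain ⟨W, hW, hxW, hWO⟩ := compact_exists_isClopen_in_isOpen (hO.inter hU)
    (show x ∈ O ∩ U from ⟨hxO rfl, hx⟩)
  refine ⟨W, hW, hxW, fun y hy => (hWO hy).2, ?_⟩
  rw [Measure.real]
  have h1 : μ W < ENNReal.ofReal ε := (measure_mono fun y hy => (hWO hy).1).trans_lt hlt
  exact (ENNReal.lt_ofReal_iff_toReal_lt h1.ne_top).1 h1

theorem UEMin.real_diff (h : UEMin G μ) {A B : Set X} (hB : IsClopen B) (hBA : B ⊆ A) :
    μ.real (A \ B) = μ.real A - μ.real B := by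
  have := h.prob
  exact measureReal_sdiff hBA hB.isOpen.measurableSet

theorem real_image_of_locG (h : UEMin G μ) {U : Set X} {f : X → X}
    (hU : IsClopen U) (hl : ∀ x ∈ U, LocG G f x) (hi : InjOn f U) :
    μ.real (f '' U) = μ.real U := by
  rw [Measure.real, measure_image_of_locG h.inv hU hl hi, Measure.real]

/-- One back-and-forth step: match all but small neighbourhoods of two points. -/
theorem exists_pmap_step (h : UEMin G μ) (hF : IsBalls F C) {a b : X} {A B P Q : Set X}
    (hA : IsClopen A) (hB : IsClopen B) (ha : a ∈ A) (hb : b ∈ B) (hAB : μ.real A = μ.real B)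
    (hP : IsClopen P) (haP : a ∈ P) (hQ : IsOpen Q) (hbQ : b ∈ Q) :
    ∃ A' B' : Set X, IsClopen A' ∧ IsClopen B' ∧ a ∈ A' ∧ b ∈ B' ∧ μ.real A' = μ.real B' ∧
      A' ⊆ A ∧ B' ⊆ B ∧ A' ⊆ P ∧ B' ⊆ Q ∧ ∃ f f', PMap G (A \ A') (B \ B') ∅ f f' := by
  classical
  have := h.prob
  have : Nonempty X := ⟨a⟩
  have hW : IsClopen (A ∩ P) := hA.inter hP
  set W := A ∩ P with hWdef
  have hWA : W ⊆ A := inter_subset_left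
  obtain ⟨W', hW', hbW', hW'B, hW'W⟩ := h.exists_small (hB.isOpen.inter hQ) ⟨hb, hbQ⟩
    (h.pos hW.isOpen ⟨a, ha, haP⟩)
  have hW'B' : W' ⊆ B := hW'B.trans inter_subset_left
  obtain ⟨Y, hY, haY, hYW, hYW'⟩ := h.exists_small hW.isOpen ⟨ha, haP⟩
    (h.pos hW'.isOpen ⟨b, hbW'⟩)
  obtain ⟨f, hfl, hfi, hfm⟩ := comparison h hF (hA.diff hW) (hB.diff hW') (by
    rw [h.real_diff hW hWA, h.real_diff hW' hW'B']; linarith)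
  have hI := isClopen_image_of_locG (hA.diff hW) hfl
  have hIμ := real_image_of_locG h (hA.diff hW) hfl hfi
  set I := f '' (A \ W) with hIdef
  have hIsub : I ⊆ B \ W' := hfm.image_subset
  have hB₁ : IsClopen ((B \ W') \ I) := (hB.diff hW').diff hI
  set B₁ := (B \ W') \ I with hB₁def
  have hB₁μ : μ.real B₁ = μ.real W - μ.real W' := by
    rw [h.real_diff hI hIsub, hIμ, h.real_diff hW hWA, h.real_diff hW' hW'B']; linarith
  obtain ⟨f₂, hl₂, hi₂, hm₂⟩ := comparison h hF hB₁ (hW.diff hY) (by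
    rw [hB₁μ, h.real_diff hY hYW]; linarith)
  have hJ := isClopen_image_of_locG hB₁ hl₂
  have hJμ := real_image_of_locG h hB₁ hl₂ hi₂
  set J := f₂ '' B₁ with hJdef
  have hJsub : J ⊆ W \ Y := hm₂.image_subset
  obtain ⟨f', hf'⟩ := PMap.of_injOn (hA.diff hW) hfl hfi
  obtain ⟨f₂', hf₂'⟩ := PMap.of_injOn hB₁ hl₂ hi₂
  obtain ⟨u, u', hu⟩ : ∃ u u', PMap G ((A \ W) ∪ J) (I ∪ B₁) ∅ u u' := ⟨_, _,
    hf'.union (hf₂'.symm' hJ.isOpen) (hA.diff hW) hJ hI hB₁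
    (Set.disjoint_left.2 fun x hx hxJ => hx.2 (hJsub hxJ).1)
    (Set.disjoint_left.2 fun x hx hxB => hxB.2 hx)⟩
  refine ⟨W \ J, W', hW.diff hJ, hW', ⟨⟨ha, haP⟩, fun haJ => (hJsub haJ).2 haY⟩, hbW', ?_,
    sdiff_subset.trans hWA, hW'B', fun x hx => hx.1.2, fun x hx => (hW'B hx).2, u, u', ?_⟩
  · rw [h.real_diff hJ (fun x hx => (hJsub hx).1), hJμ, hB₁μ]; ring
  · convert hu using 1
    · ext x
      simp only [Set.mem_sdiff, mem_union]
      constructor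
      · rintro ⟨h1, h2⟩
        by_cases hxW : x ∈ W
        · by_contra hcon
          push Not at hcon
          exact h2 ⟨hxW, hcon.2⟩
        · exact Or.inl ⟨h1, hxW⟩
      · rintro (⟨h1, h2⟩ | h1)
        · exact ⟨h1, fun h3 => h2 h3.1⟩
        · exact ⟨hWA (hJsub h1).1, fun h3 => h3.2 h1⟩
    · ext x
      simp only [Set.mem_sdiff, mem_union, hB₁def]
      constructor
      · rintro ⟨h1, h2⟩
        by_cases hxI : x ∈ I
        · exact Or.inl hxI
        · exact Or.inr ⟨⟨h1, h2⟩, hxI⟩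
      · rintro (h1 | h1)
        · exact hIsub h1
        · exact h1.1

/-- Gluing maps along annuli shrinking to a point. -/
theorem exists_glue {A B : ℕ → Set X} {a b : X} {f : ℕ → X → X} (hA : ∀ n, IsClopen (A n))
    (hAm : ∀ n, A (n + 1) ⊆ A n) (hBm : ∀ n, B (n + 1) ⊆ B n) (ha : ∀ n, a ∈ A n)
    (hb : ∀ n, b ∈ B n) (hA' : ∀ x, x ≠ a → ∃ n, x ∉ A n)
    (hB' : ∀ O ∈ 𝓝 b, ∃ n, B n ⊆ O)
    (hf : ∀ n, MapsTo (f n) (A n \ A (n + 1)) (B n \ B (n + 1)))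
    (hl : ∀ n, ∀ x ∈ A n \ A (n + 1), LocG G (f n) x) :
    ∃ g : X → X, g a = b ∧ (∀ n, ∀ x ∈ A n \ A (n + 1), g x = f n x) ∧ ContinuousOn g (A 0) ∧
      (∀ x ∈ A 0, x ≠ a → ∃ n, x ∈ A n \ A (n + 1)) ∧ (∀ x ∈ A 0, x ≠ a → LocG G g x) := by
  classical
  have hanti : Antitone A := antitone_nat_of_succ_le hAm
  have hantiB : Antitone B := antitone_nat_of_succ_le hBm
  set g : X → X := fun x => if hx : ∃ n, x ∉ A (n + 1) then f (Nat.find hx) x else b with hg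
  have hga : g a = b := by
    simp only [hg]
    rw [dif_neg]
    push Not
    exact fun n => ha _
  have hgn : ∀ n, ∀ x ∈ A n \ A (n + 1), g x = f n x := by
    intro n x hx
    have hex : ∃ n, x ∉ A (n + 1) := ⟨n, hx.2⟩
    have : Nat.find hex = n := by
      rw [Nat.find_eq_iff]
      exact ⟨hx.2, fun m hm hcon => hcon (hanti (by omega : m + 1 ≤ n) hx.1)⟩
    simp only [hg]
    rw [dif_pos hex, this]
  have hex : ∀ m, ∀ x ∈ A m, x ≠ a → ∃ n, m ≤ n ∧ x ∈ A n \ A (n + 1) := by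
    intro m x hx hxa
    obtain ⟨n, hn⟩ := hA' x hxa
    have hex : ∃ n, x ∉ A n := ⟨n, hn⟩
    have h1 := Nat.find_spec hex
    have h2 : m < Nat.find hex := by
      by_contra hcon
      exact h1 (hanti (not_lt.1 hcon) hx)
    obtain ⟨k, hk⟩ : ∃ k, Nat.find hex = k + 1 := ⟨Nat.find hex - 1, by omega⟩
    refine ⟨k, by omega, ?_, hk ▸ h1⟩
    by_contra hcon
    exact Nat.find_min hex (by omega : k < Nat.find hex) hcon
  have hloc : ∀ x ∈ A 0, x ≠ a → LocG G g x := by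
    intro x hx hxa
    obtain ⟨n, -, hn⟩ := hex 0 x hx hxa
    refine (hl n x hn).congr ?_
    filter_upwards [((hA n).diff (hA (n + 1))).isOpen.mem_nhds hn] with y hy using hgn n y hy
  refine ⟨g, hga, hgn, fun x hx => ?_, fun x hx hxa => ?_, hloc⟩
  · by_cases hxa : x = a
    · subst hxa
      refine ContinuousAt.continuousWithinAt ?_
      intro O hO
      rw [hga] at hO
      obtain ⟨n, hn⟩ := hB' O hO
      rw [Filter.mem_map]
      refine Filter.mem_of_superset ((hA n).isOpen.mem_nhds (ha n)) fun y hy => hn ?_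
      by_cases hya : y = x
      · rw [hya, hga]; exact hb n
      · obtain ⟨m, hm, hym⟩ := hex n y hy hya
        rw [hgn m y hym]
        exact hantiB hm (hf m hym).1
    · exact (hloc x hx hxa).continuousAt.continuousWithinAt
  · obtain ⟨n, -, hn⟩ := hex 0 x hx hxa
    exact ⟨n, hn⟩

theorem exists_clopen_basis (a : X) : ∃ P : ℕ → Set X, (∀ n, IsClopen (P n)) ∧ (∀ n, a ∈ P n) ∧
    ∀ O ∈ 𝓝 a, ∃ n, P n ⊆ O := by
  obtain ⟨B, hB⟩ := (𝓝 a).exists_antitone_basis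
  have : ∀ n, ∃ W : Set X, IsClopen W ∧ a ∈ W ∧ W ⊆ B n := by
    intro n
    obtain ⟨W, hW, haW, hWB⟩ := compact_exists_isClopen_in_isOpen (isOpen_interior (s := B n))
      (mem_interior_iff_mem_nhds.2 (hB.1.mem_of_mem (i := n) trivial))
    exact ⟨W, hW, haW, hWB.trans interior_subset⟩
  choose P hP haP hPB using this
  refine ⟨P, hP, haP, fun O hO => ?_⟩
  obtain ⟨n, -, hn⟩ := hB.1.mem_iff.1 hO
  exact ⟨n, (hPB n).trans hn⟩

/-- Clopen sets of equal measure are equivalent through a homeomorphism inside the orbits. -/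
theorem exists_pmap (h : UEMin G μ) (hF : IsBalls F C) {A B : Set X}
    (hA : IsClopen A) (hB : IsClopen B) (hne : A.Nonempty) (hAB : μ.real A = μ.real B) :
    ∃ a ∈ A, ∃ f f', PMap G A B {a} f f' := by
  classical
  have := h.prob
  obtain ⟨a, ha⟩ := hne
  have hBne : B.Nonempty := by
    rw [nonempty_iff_ne_empty]
    rintro rfl
    have := h.pos hA.isOpen ⟨a, ha⟩
    rw [hAB] at this
    simp at this
  obtain ⟨b, hb, g₀, hg₀⟩ := (h.min a).inter_open_nonempty B hB.isOpen hBne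
  obtain ⟨P, hP, haP, hPb⟩ := exists_clopen_basis a
  obtain ⟨Q, hQ, hbQ, hQb⟩ := exists_clopen_basis b
  let St : Type _ := {p : Set X × Set X // IsClopen p.1 ∧ IsClopen p.2 ∧ a ∈ p.1 ∧ b ∈ p.2 ∧
    μ.real p.1 = μ.real p.2}
  have step : ∀ (n : ℕ) (p : St), ∃ q : St, q.1.1 ⊆ p.1.1 ∧ q.1.2 ⊆ p.1.2 ∧ q.1.1 ⊆ P n ∧
      q.1.2 ⊆ Q n ∧ ∃ f f', PMap G (p.1.1 \ q.1.1) (p.1.2 \ q.1.2) ∅ f f' := by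
    rintro n ⟨⟨A, B⟩, h1, h2, h3, h4, h5⟩
    obtain ⟨A', B', k1, k2, k3, k4, k5, k6, k7, k8, k9, k10⟩ :=
      exists_pmap_step h hF h1 h2 h3 h4 h5 (hP n) (haP n) (hQ n).isOpen (hbQ n)
    exact ⟨⟨(A', B'), k1, k2, k3, k4, k5⟩, k6, k7, k8, k9, k10⟩
  choose nxt hn1 hn2 hn3 hn4 fn fn' hfn using step
  let s : ℕ → St := fun n => Nat.rec ⟨(A, B), hA, hB, ha, hb, hAB⟩ (fun n p => nxt n p) n
  have hs : ∀ n, s (n + 1) = nxt n (s n) := fun n => rfl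
  set An : ℕ → Set X := fun n => (s n).1.1 with hAn
  set Bn : ℕ → Set X := fun n => (s n).1.2 with hBn
  set f : ℕ → X → X := fun n => fn n (s n) with hfdef
  set f' : ℕ → X → X := fun n => fn' n (s n) with hfdef'
  have hpm : ∀ n, PMap G (An n \ An (n + 1)) (Bn n \ Bn (n + 1)) ∅ (f n) (f' n) :=
    fun n => hfn n (s n)
  have cA : ∀ n, IsClopen (An n) := fun n => (s n).2.1
  have cB : ∀ n, IsClopen (Bn n) := fun n => (s n).2.2.1
  have aA : ∀ n, a ∈ An n := fun n => (s n).2.2.2.1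
  have bB : ∀ n, b ∈ Bn n := fun n => (s n).2.2.2.2.1
  have mA : ∀ n, An (n + 1) ⊆ An n := fun n => hn1 n (s n)
  have mB : ∀ n, Bn (n + 1) ⊆ Bn n := fun n => hn2 n (s n)
  have nA : ∀ O ∈ 𝓝 a, ∃ n, An n ⊆ O := fun O hO => by
    obtain ⟨n, hn⟩ := hPb O hO
    exact ⟨n + 1, (hn3 n (s n)).trans hn⟩
  have nB : ∀ O ∈ 𝓝 b, ∃ n, Bn n ⊆ O := fun O hO => by
    obtain ⟨n, hn⟩ := hQb O hO
    exact ⟨n + 1, (hn4 n (s n)).trans hn⟩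
  have sA : ∀ x, x ≠ a → ∃ n, x ∉ An n := fun x hx => by
    obtain ⟨n, hn⟩ := nA _ (isOpen_compl_singleton.mem_nhds (show a ∈ ({x}ᶜ : Set X) from hx.symm))
    exact ⟨n, fun h' => hn h' rfl⟩
  have sB : ∀ x, x ≠ b → ∃ n, x ∉ Bn n := fun x hx => by
    obtain ⟨n, hn⟩ := nB _ (isOpen_compl_singleton.mem_nhds (show b ∈ ({x}ᶜ : Set X) from hx.symm))
    exact ⟨n, fun h' => hn h' rfl⟩
  obtain ⟨g, ga, gn, gc, ge, gl⟩ := exists_glue (G := G) (f := f) cA mA mB aA bB sA nB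
    (fun n => (hpm n).mapsTo) (fun n x hx => (hpm n).loc x hx (notMem_empty _))
  obtain ⟨g', ga', gn', gc', ge', gl'⟩ := exists_glue (G := G) (f := f') cB mB mA bB aA sB nA
    (fun n => (hpm n).mapsTo') (fun n x hx => ((hpm n).symm'
      ((cB n).diff (cB (n + 1))).isOpen).loc x hx (notMem_empty _))
  have antiA : Antitone An := antitone_nat_of_succ_le mA
  have antiB : Antitone Bn := antitone_nat_of_succ_le mB
  refine ⟨a, ha, g, g', ⟨?_, ?_, ?_, ?_, gc, gc', ?_, fun x hx hxa => gl x hx hxa⟩⟩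
  · intro x hx
    by_cases hxa : x = a
    · rw [hxa, ga]; exact hb
    · obtain ⟨n, hn⟩ := ge x hx hxa
      rw [gn n x hn]
      exact antiB (Nat.zero_le n) ((hpm n).mapsTo hn).1
  · intro y hy
    by_cases hyb : y = b
    · rw [hyb, ga']; exact ha
    · obtain ⟨n, hn⟩ := ge' y hy hyb
      rw [gn' n y hn]
      exact antiA (Nat.zero_le n) ((hpm n).mapsTo' hn).1
  · intro x hx
    by_cases hxa : x = a
    · rw [hxa, ga, ga']
    · obtain ⟨n, hn⟩ := ge x hx hxa
      rw [gn n x hn, gn' n _ ((hpm n).mapsTo hn), (hpm n).left x hn]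
  · intro y hy
    by_cases hyb : y = b
    · rw [hyb, ga', ga]
    · obtain ⟨n, hn⟩ := ge' y hy hyb
      rw [gn' n y hn, gn n _ ((hpm n).mapsTo' hn), (hpm n).right y hn]
  · intro x hx
    by_cases hxa : x = a
    · exact ⟨g₀, by rw [hxa, ga, hg₀]⟩
    · exact (gl x hx hxa).exists_eq

end Meas

end CantorOrbit

namespace CantorOrbit

open Set Topology Filter ProbabilityTheory

section LocConst

variable {X : Type*} [TopologicalSpace X]

theorem isLocallyConstant_iff_eventually {α : Type*} {f : X → α} :
    IsLocallyConstant f ↔ ∀ x, ∀ᶠ y in 𝓝 x, f y = f x :=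
  IsLocallyConstant.iff_eventually_eq f

theorem isClopen_eq_of_isLocallyConstant {α : Type*} {f : X → α} (h : IsLocallyConstant f) (a : α) :
    IsClopen {x | f x = a} :=
  ⟨⟨h {a}ᶜ⟩, h {a}⟩

theorem exists_nat_of_isLocallyConstant [CompactSpace X] {α : Type*} {f : X → α}
    (h : IsLocallyConstant f) :
    ∃ φ : X → ℕ, IsLocallyConstant φ ∧ ∀ x y, φ x = φ y ↔ f x = f y := by
  have : Countable (range f) := h.range_finite.countable
  obtain ⟨e, he⟩ := exists_injective_nat (range f)
  refine ⟨fun x => e ⟨f x, mem_range_self x⟩, ?_, fun x y => ?_⟩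
  · rw [isLocallyConstant_iff_eventually] at h ⊢
    intro x
    filter_upwards [h x] with y hy
    simp [hy]
  · rw [he.eq_iff, Subtype.mk.injEq]

theorem isLocallyConstant_setOf_mem {ι : Type*} {A : ι → Set X} (hA : ∀ i, IsClopen (A i))
    {t : Set ι} (ht : t.Finite) (hAt : ∀ i ∉ t, A i = ∅) :
    IsLocallyConstant fun x => {i | x ∈ A i} := by
  rw [isLocallyConstant_iff_eventually]
  intro x
  filter_upwards [(ht.eventually_all (l := 𝓝 x)).2
    fun i _ => eventually_mem_iff_of_isClopen (hA i) x] with y hy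
  ext i
  by_cases hi : i ∈ t
  · exact hy i hi
  · simp [hAt i hi]

theorem exists_clopen_partition [CompactSpace X] {Q : Set X → Prop}
    (hQ : ∀ U V, U ⊆ V → Q V → Q U) (hQ0 : Q ∅) (hloc : ∀ x, ∃ W, IsClopen W ∧ x ∈ W ∧ Q W) :
    ∃ p : X → ℕ, IsLocallyConstant p ∧ ∀ k, Q {x | p x = k} := by
  classical
  choose W hW hxW hQW using hloc
  obtain ⟨t, ht⟩ := isCompact_univ.elim_finite_subcover W (fun x => (hW x).isOpen)
    (fun x _ => mem_iUnion.2 ⟨x, hxW x⟩)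
  obtain ⟨p, hp, hpe⟩ := exists_nat_of_isLocallyConstant (isLocallyConstant_setOf_mem
    (A := fun c : X => if c ∈ t then W c else ∅) (t := (t : Set X))
    (fun c => by split_ifs <;> simp [hW, isClopen_empty]) t.finite_toSet (fun c hc => by simp_all))
  refine ⟨p, hp, fun k => ?_⟩
  by_cases hk : ∃ x, p x = k
  · obtain ⟨x, rfl⟩ := hk
    obtain ⟨c, hc, hxc⟩ := mem_iUnion₂.1 (ht (mem_univ x))
    refine hQ _ _ (fun y hy => ?_) (hQW c)
    have h1 := (hpe y x).1 hy
    have h2 : c ∈ {c | x ∈ if c ∈ t then W c else ∅} := by simp [hc, hxc]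
    rw [← h1] at h2
    simpa [hc] using h2
  · convert hQ0
    ext x
    simp only [mem_ofPred_eq, mem_empty_iff_false, iff_false]
    exact fun h => hk ⟨x, h⟩

end LocConst

section Fold

variable {G X : Type*} [CommGroup G] [MulAction G X] [TopologicalSpace X] [ContinuousConstSMul G X]
  [FreeAct G X] [CompactSpace X] [PolishSpace X] [TotallyDisconnectedSpace X] [MeasurableSpace X]
  [BorelSpace X] [Countable G] {F : ℕ → Finset G} {C : ℕ} {μ : Measure X}

/-- `w` folds `D` onto `V`, with `n` sheets indexed by `j`. -/
structure Fold (G : Type*) {X : Type*} [Group G] [MulAction G X] [TopologicalSpace X] (n : ℕ)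
    (D V : Set X) (w : X → X) (j : X → ℕ) : Prop where
  mapsTo : MapsTo w D V
  cont : ∀ x ∈ D, ContinuousAt w x
  nhds : ∀ x ∈ D, ∀ U ∈ 𝓝 x, w '' U ∈ 𝓝 (w x)
  locConst : ∀ x ∈ D, ∀ᶠ y in 𝓝 x, j y = j x
  lt : ∀ x ∈ D, j x < n
  rel : ∀ x ∈ D, ∃ g : G, w x = g • x
  inj : ∀ x ∈ D, ∀ y ∈ D, w x = w y → j x = j y → x = y
  surj : ∀ v ∈ V, ∀ c < n, ∃ x ∈ D, w x = v ∧ j x = c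
  loc : ∃ P : Set X, P.Finite ∧ ∀ x ∈ D, x ∉ P → LocG G w x

theorem PMap.continuousAt {U V P : Set X} {f f' : X → X} (h : PMap G U V P f f') (hU : IsOpen U)
    {x : X} (hx : x ∈ U) : ContinuousAt f x :=
  h.cont.continuousAt (hU.mem_nhds hx)

theorem PMap.image_mem_nhds {U V P : Set X} {f f' : X → X} (h : PMap G U V P f f') (hV : IsOpen V)
    {x : X} (hx : x ∈ U) {N : Set X} (hN : N ∈ 𝓝 x) : f '' N ∈ 𝓝 (f x) := by
  have h1 : ContinuousAt f' (f x) := h.cont'.continuousAt (hV.mem_nhds (h.mapsTo hx))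
  have h2 : f' ⁻¹' N ∈ 𝓝 (f x) := h1.preimage_mem_nhds (by rwa [h.left x hx])
  filter_upwards [h2, hV.mem_nhds (h.mapsTo hx)] with y hy hyV
  exact ⟨f' y, hy, h.right y hyV⟩

theorem exists_fold (h : UEMin G μ) (hF : IsBalls F C) {V : Set X} (hV : IsClopen V)
    (hVne : V.Nonempty) (n : ℕ) {D : Set X} (hD : IsClopen D)
    (hDV : ((n : ℝ) + 1) * μ.real V = μ.real D) : ∃ w j, Fold G (n + 1) D V w j := by
  classical
  have hpos := h.pos hV.isOpen hVne
  have := h.prob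
  induction n generalizing D with
  | zero =>
    have hne : D.Nonempty := by
      rw [nonempty_iff_ne_empty]
      rintro rfl
      simp at hDV
      linarith
    obtain ⟨a, -, f, f', hf⟩ := exists_pmap h hF hD hV hne (by rw [← hDV]; simp)
    exact ⟨f, fun _ => 0, hf.mapsTo, fun x hx => hf.continuousAt hD.isOpen hx,
      fun x hx U hU => hf.image_mem_nhds hV.isOpen hx hU, fun x hx => by simp, by simp,
      hf.rel, fun x hx y hy e _ => hf.injOn hx hy e,
      fun v hv c hc => ⟨f' v, hf.mapsTo' hv, hf.right v hv, by omega⟩,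
      {a}, finite_singleton a, hf.loc⟩
  | succ n ih =>
    have : Nonempty X := ⟨hVne.some⟩
    push_cast at hDV
    obtain ⟨f, hl, hi, hm⟩ := comparison h hF hV hD (by nlinarith)
    obtain ⟨f', hf⟩ := PMap.of_injOn hV hl hi
    have hI := isClopen_image_of_locG hV hl
    have hIμ := real_image_of_locG h hV hl hi
    have hID : f '' V ⊆ D := hm.image_subset
    set I := f '' V with hIdef
    obtain ⟨w, j, hw⟩ := ih (hD.diff hI) (by rw [h.real_diff hI hID, hIμ]; linarith)
    have hg := hf.symm' hI.isOpen
    have e1 : ∀ x ∈ I, I.piecewise f' w =ᶠ[𝓝 x] f' := fun x hx => by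
      filter_upwards [hI.isOpen.mem_nhds hx] with y hy using by simp [hy]
    have e2 : ∀ x ∉ I, I.piecewise f' w =ᶠ[𝓝 x] w := fun x hx => by
      filter_upwards [hI.compl.isOpen.mem_nhds hx] with y hy using piecewise_eq_of_notMem _ _ _ hy
    have e3 : ∀ x ∈ I, I.piecewise (fun _ => n + 1) j =ᶠ[𝓝 x] fun _ => n + 1 := fun x hx => by
      filter_upwards [hI.isOpen.mem_nhds hx] with y hy using by simp [hy]
    have e4 : ∀ x ∉ I, I.piecewise (fun _ => n + 1) j =ᶠ[𝓝 x] j := fun x hx => by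
      filter_upwards [hI.compl.isOpen.mem_nhds hx] with y hy using piecewise_eq_of_notMem _ _ _ hy
    obtain ⟨P, hP, hPl⟩ := hw.loc
    refine ⟨I.piecewise f' w, I.piecewise (fun _ => n + 1) j, ?_, ?_, ?_, ?_, ?_, ?_, ?_, ?_, P,
      hP, ?_⟩
    · intro x hx
      by_cases hxI : x ∈ I
      · rw [(e1 x hxI).eq_of_nhds]; exact hg.mapsTo hxI
      · rw [(e2 x hxI).eq_of_nhds]; exact hw.mapsTo ⟨hx, hxI⟩
    · intro x hx
      by_cases hxI : x ∈ I
      · exact (hg.continuousAt hI.isOpen hxI).congr (e1 x hxI).symm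
      · exact (hw.cont x ⟨hx, hxI⟩).congr (e2 x hxI).symm
    · intro x hx U hU
      by_cases hxI : x ∈ I
      · rw [(e1 x hxI).eq_of_nhds]
        refine mem_of_superset (hg.image_mem_nhds hV.isOpen hxI (inter_mem hU (e1 x hxI))) ?_
        rintro _ ⟨y, ⟨h1, h2⟩, rfl⟩
        exact ⟨y, h1, h2⟩
      · rw [(e2 x hxI).eq_of_nhds]
        refine mem_of_superset (hw.nhds x ⟨hx, hxI⟩ _ (inter_mem hU (e2 x hxI))) ?_
        rintro _ ⟨y, ⟨h1, h2⟩, rfl⟩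
        exact ⟨y, h1, h2⟩
    · intro x hx
      by_cases hxI : x ∈ I
      · filter_upwards [e3 x hxI] with y hy
        rw [hy, (e3 x hxI).eq_of_nhds]
      · filter_upwards [e4 x hxI, hw.locConst x ⟨hx, hxI⟩] with y hy hy'
        rw [hy, (e4 x hxI).eq_of_nhds, hy']
    · intro x hx
      by_cases hxI : x ∈ I
      · rw [(e3 x hxI).eq_of_nhds]; omega
      · rw [(e4 x hxI).eq_of_nhds]
        have := hw.lt x ⟨hx, hxI⟩
        omega
    · intro x hx
      by_cases hxI : x ∈ I
      · rw [(e1 x hxI).eq_of_nhds]; exact hg.rel x hxI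
      · rw [(e2 x hxI).eq_of_nhds]; exact hw.rel x ⟨hx, hxI⟩
    · intro x hx y hy e e'
      by_cases hxI : x ∈ I <;> by_cases hyI : y ∈ I
      · rw [(e1 x hxI).eq_of_nhds, (e1 y hyI).eq_of_nhds] at e
        exact hg.injOn hxI hyI e
      · rw [(e3 x hxI).eq_of_nhds, (e4 y hyI).eq_of_nhds] at e'
        have := hw.lt y ⟨hy, hyI⟩
        omega
      · rw [(e4 x hxI).eq_of_nhds, (e3 y hyI).eq_of_nhds] at e'
        have := hw.lt x ⟨hx, hxI⟩
        omega
      · rw [(e2 x hxI).eq_of_nhds, (e2 y hyI).eq_of_nhds] at e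
        rw [(e4 x hxI).eq_of_nhds, (e4 y hyI).eq_of_nhds] at e'
        exact hw.inj x ⟨hx, hxI⟩ y ⟨hy, hyI⟩ e e'
    · intro v hv c hc
      rcases Nat.lt_succ_iff_lt_or_eq.1 hc with hc' | rfl
      · obtain ⟨x, hx, hxv, hxc⟩ := hw.surj v hv c hc'
        exact ⟨x, hx.1, by rw [(e2 x hx.2).eq_of_nhds, hxv], by rw [(e4 x hx.2).eq_of_nhds, hxc]⟩
      · have hx := hf.mapsTo hv
        exact ⟨f v, hID hx, by rw [(e1 _ hx).eq_of_nhds, hf.left v hv],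
          by rw [(e3 _ hx).eq_of_nhds]⟩
    · intro x hx hxP
      by_cases hxI : x ∈ I
      · exact (hg.loc x hxI (notMem_empty _)).congr (e1 x hxI)
      · exact (hPl x ⟨hx, hxI⟩ hxP).congr (e2 x hxI)

end Fold

end CantorOrbit

namespace CantorOrbit

open Set Topology Filter ProbabilityTheory

section Rank

variable {X : Type*} {S : Set X} {κ : X → ℕ}

theorem ncard_rank_lt (hS : S.Finite) {y : X} (hy : y ∈ S) :
    {z | z ∈ S ∧ κ z < κ y}.ncard < S.ncard :=
  ncard_lt_ncard ⟨fun _ hz => hz.1, fun hcon => (lt_irrefl _ (hcon hy).2)⟩ hS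

theorem ncard_rank_lt_rank (hS : S.Finite) {y z : X} (hy : y ∈ S) (hyz : κ y < κ z) :
    {x | x ∈ S ∧ κ x < κ y}.ncard < {x | x ∈ S ∧ κ x < κ z}.ncard :=
  ncard_lt_ncard ⟨fun _ hx => ⟨hx.1, hx.2.trans hyz⟩,
    fun hcon => (lt_irrefl _ (hcon ⟨hy, hyz⟩).2)⟩ (hS.subset fun _ hx => hx.1)

theorem injOn_ncard_rank (hS : S.Finite) (hκ : InjOn κ S) :
    InjOn (fun y => {z | z ∈ S ∧ κ z < κ y}.ncard) S := by
  intro y hy z hz e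
  rcases lt_trichotomy (κ y) (κ z) with hlt | heq | hgt
  · exact absurd e (ncard_rank_lt_rank hS hy hlt).ne
  · exact hκ hy hz heq
  · exact absurd e (ncard_rank_lt_rank hS hz hgt).ne'

theorem exists_ncard_rank_eq (hS : S.Finite) (hκ : InjOn κ S) {c : ℕ} (hc : c < S.ncard) :
    ∃ y ∈ S, {z | z ∈ S ∧ κ z < κ y}.ncard = c := by
  have h1 : (fun y => {z | z ∈ S ∧ κ z < κ y}.ncard) '' S = Iio S.ncard := by
    refine eq_of_subset_of_ncard_le ?_ ?_ (finite_Iio _)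
    · rintro _ ⟨y, hy, rfl⟩
      exact ncard_rank_lt hS hy
    · rw [(injOn_ncard_rank hS hκ).ncard_image, ← Finset.coe_Iio, ncard_coe_finset, Nat.card_Iio]
  exact (h1.symm ▸ hc : c ∈ (fun y => {z | z ∈ S ∧ κ z < κ y}.ncard) '' S)

end Rank

variable {G X : Type*} [CommGroup G] [MulAction G X] [TopologicalSpace X] [ContinuousConstSMul G X]
  [FreeAct G X] [CompactSpace X] [PolishSpace X] [TotallyDisconnectedSpace X] [MeasurableSpace X]
  [BorelSpace X] [Countable G] {F : ℕ → Finset G} {C : ℕ} {μ : Measure X} {T : X → X → Prop}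

theorem Fold.congr {n : ℕ} {D V : Set X} {w w' : X → X} {j j' : X → ℕ} (h : Fold G n D V w j)
    (hD : IsOpen D) (hw : ∀ x ∈ D, w' x = w x) (hj : ∀ x ∈ D, j' x = j x) :
    Fold G n D V w' j' := by
  have e1 : ∀ x ∈ D, w' =ᶠ[𝓝 x] w := fun x hx => by
    filter_upwards [hD.mem_nhds hx] with y hy using hw y hy
  obtain ⟨P, hP, hPl⟩ := h.loc
  refine ⟨fun x hx => hw x hx ▸ h.mapsTo hx, fun x hx => (h.cont x hx).congr (e1 x hx).symm,
    fun x hx U hU => ?_, fun x hx => ?_, fun x hx => hj x hx ▸ h.lt x hx,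
    fun x hx => hw x hx ▸ h.rel x hx, fun x hx y hy e e' => ?_, fun v hv c hc => ?_,
    P, hP, fun x hx hxP => (hPl x hx hxP).congr (e1 x hx)⟩
  · rw [hw x hx]
    refine mem_of_superset (h.nhds x hx _ (inter_mem hU (e1 x hx))) ?_
    rintro _ ⟨y, ⟨h1, h2⟩, rfl⟩
    exact ⟨y, h1, h2⟩
  · filter_upwards [hD.mem_nhds hx, h.locConst x hx] with y hy hy'
    rw [hj y hy, hj x hx, hy']
  · rw [hw x hx, hw y hy] at e
    rw [hj x hx, hj y hy] at e'
    exact h.inj x hx y hy e e'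
  · obtain ⟨x, hx, h1, h2⟩ := h.surj v hv c hc
    exact ⟨x, hx, by rw [hw x hx, h1], by rw [hj x hx, h2]⟩

/-- Simultaneous folding of the pieces of a clopen partition. -/
theorem exists_fold_partition (h : UEMin G μ) (hF : IsBalls F C) {D : Set X} (hD : IsClopen D)
    {i : X → ℕ} (hi : IsLocallyConstant i) (hdiv : ∀ k, (D ∩ {x | i x = k}).Nonempty →
      ∃ V : Set X, IsClopen V ∧ 9 * μ.real V = μ.real (D ∩ {x | i x = k})) :
    ∃ (V : ℕ → Set X) (w : X → X) (j : X → ℕ), (∀ k, IsClopen (V k)) ∧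
      ∀ k, Fold G 9 (D ∩ {x | i x = k}) (V k) w j := by
  have hDk : ∀ k, IsClopen (D ∩ {x | i x = k}) := fun k =>
    hD.inter (isClopen_eq_of_isLocallyConstant hi k)
  have key : ∀ k, ∃ (V : Set X) (w : X → X) (j : X → ℕ), IsClopen V ∧
      Fold G 9 (D ∩ {x | i x = k}) V w j := by
    intro k
    rcases (D ∩ {x | i x = k}).eq_empty_or_nonempty with he | hne
    · refine ⟨∅, id, fun _ => 0, isClopen_empty, ?_⟩
      rw [he]
      exact ⟨mapsTo_empty _ _, by simp, by simp, by simp, by simp, by simp, by simp, by simp,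
        ∅, finite_empty, by simp⟩
    · obtain ⟨V, hV, hVD⟩ := hdiv k hne
      have hVne : V.Nonempty := by
        rw [nonempty_iff_ne_empty]
        rintro rfl
        have := h.pos (hDk k).isOpen hne
        rw [← hVD] at this
        simp at this
      obtain ⟨w, j, hw⟩ := exists_fold h hF hV hVne 8 (hDk k) (by rw [← hVD]; norm_num)
      exact ⟨V, w, j, hV, hw⟩
  choose V w j hV hw using key
  exact ⟨V, fun x => w (i x) x, fun x => j (i x) x, hV, fun k => (hw k).congr (hDk k).isOpen
    (fun x hx => by rw [show i x = k from hx.2]) (fun x hx => by rw [show i x = k from hx.2])⟩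

theorem exists_finite_translates {q : X → X} {Z L : Set X} (hloc : ∀ x ∉ Z, LocG G q x)
    (K : Finset G) (hL : IsCompact L) (hLZ : ∀ x ∈ L, x ∉ Z)
    (hLK : ∀ x ∈ L, ∀ g ∈ K, g • x ∉ Z) :
    ∃ K' : Finset G, ∀ x ∈ L, ∀ g ∈ K, ∃ k ∈ K', q (g • x) = k • q x := by
  classical
  refine hL.induction_on (p := fun s => ∃ K' : Finset G, ∀ x ∈ s, ∀ g ∈ K, ∃ k ∈ K',
    q (g • x) = k • q x) ⟨∅, by simp⟩ ?_ ?_ ?_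
  · rintro s t hst ⟨K', hK'⟩
    exact ⟨K', fun x hx => hK' x (hst hx)⟩
  · rintro s t ⟨K₁, h₁⟩ ⟨K₂, h₂⟩
    refine ⟨K₁ ∪ K₂, fun x hx g hg => ?_⟩
    rcases hx with hx | hx
    · obtain ⟨k, hk, e⟩ := h₁ x hx g hg
      exact ⟨k, Finset.mem_union_left _ hk, e⟩
    · obtain ⟨k, hk, e⟩ := h₂ x hx g hg
      exact ⟨k, Finset.mem_union_right _ hk, e⟩
  · intro x hx
    obtain ⟨a, ha⟩ := hloc x (hLZ x hx)
    have : ∀ g : G, ∃ b : G, g ∈ K → ∀ᶠ y in 𝓝 x, q (g • y) = b • g • y := by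
      intro g
      by_cases hg : g ∈ K
      · obtain ⟨b, hb⟩ := hloc _ (hLK x hx g hg)
        exact ⟨b, fun _ => ((continuous_const_smul g).continuousAt (x := x)).eventually hb⟩
      · exact ⟨1, fun h => absurd h hg⟩
    choose b hb using this
    have hall := (Finset.eventually_all K (l := 𝓝 x)
      (p := fun g y => q (g • y) = b g • g • y)).2 fun g hg => hb g hg
    refine ⟨_, mem_nhdsWithin_of_mem_nhds (inter_mem ha hall), K.image fun g => b g * g * a⁻¹, ?_⟩
    rintro y ⟨h1, h2⟩ g hg
    refine ⟨_, Finset.mem_image_of_mem _ hg, ?_⟩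
    rw [h2 g hg, show q y = a • y from h1, mul_smul, mul_smul, inv_smul_smul]

theorem exists_small_nhds (h : UEMin G μ) {S : Set X} (hS : S.Finite) {ε : ℝ} (hε : 0 < ε) :
    ∃ N : Set X, IsClopen N ∧ S ⊆ N ∧ μ.real N < ε := by
  have := h.prob
  induction S, hS using Set.Finite.induction_on generalizing ε with
  | empty => exact ⟨∅, isClopen_empty, subset_rfl, by simpa⟩
  | @insert a S _ _ ih =>
    obtain ⟨N, hN, hSN, hNε⟩ := ih (half_pos hε)
    obtain ⟨W, hW, haW, -, hWε⟩ := h.exists_small isOpen_univ (mem_univ a) (half_pos hε)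
    refine ⟨W ∪ N, hW.union hN, insert_subset (Or.inl haW) (hSN.trans subset_union_right), ?_⟩
    have := measureReal_union_le (μ := μ) W N
    linarith

/-- Labels separating the points of each class. -/
theorem ClopenRel.exists_label (hT : ClopenRel G T) :
    ∃ p : X → ℕ, IsLocallyConstant p ∧ ∀ x y, T x y → p x = p y → x = y := by
  obtain ⟨B, hB⟩ := hT.bdd
  obtain ⟨p, hp, hpQ⟩ := exists_clopen_partition (X := X)
    (Q := fun U => ∀ x ∈ U, ∀ y ∈ U, T x y → x = y)
    (fun U V hUV hV x hx y hy => hV x (hUV hx) y (hUV hy)) (by simp) (fun x => by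
      obtain ⟨O, hO, hxO, hOB⟩ := exists_isClopen_smul_disjoint B x
      refine ⟨O, hO, hxO, fun y hy z hz hyz => ?_⟩
      obtain ⟨g, hg, rfl⟩ := hB y z hyz
      rw [hOB g hg y hy hz, one_smul])
  exact ⟨p, hp, fun x y hxy e => hpQ (p x) x rfl y e.symm hxy⟩

/-- A continuous choice of representatives of the classes. -/
theorem ClopenRel.exists_repr (hT : ClopenRel G T) :
    ∃ τ : X → X, (∀ x, LocG G τ x) ∧ (∀ x, T x (τ x)) ∧ ∀ x y, T x y → τ x = τ y := by
  obtain ⟨p, hp, hpT⟩ := hT.exists_label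
  have hex : ∀ x, ∃ y, T x y ∧ ∀ z, T x z → p y ≤ p z := fun x => by
    obtain ⟨y, hy, hm⟩ := exists_min_image {y | T x y} p (hT.finite x) ⟨x, hT.equiv.refl x⟩
    exact ⟨y, hy, hm⟩
  choose τ hτ hτm using hex
  have huniq : ∀ x y, T x y → (∀ z, T x z → p y ≤ p z) → τ x = y := fun x y hy hm =>
    hpT _ _ (hT.equiv.trans (hT.equiv.symm (hτ x)) hy) (le_antisymm (hτm x y hy) (hm _ (hτ x)))
  refine ⟨τ, fun x => ?_, hτ, fun x y hxy => ?_⟩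
  · obtain ⟨B, hB⟩ := hT.bdd
    obtain ⟨g, -, hg⟩ := hB _ _ (hτ x)
    refine ⟨g, ?_⟩
    have hp' := isLocallyConstant_iff_eventually.1 hp
    have h1 : ∀ b : G, ∀ᶠ y in 𝓝 x, p (b • y) = p (b • x) := fun b =>
      ((continuous_const_smul b).continuousAt (x := x)).eventually (hp' (b • x))
    have h2 : ∀ b : G, ∀ᶠ y in 𝓝 x, (T y (b • y) ↔ T x (b • x)) := fun b =>
      eventually_mem_iff_of_isClopen (hT.clopen b) x
    have h3 := (Finset.eventually_all B (l := 𝓝 x)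
      (p := fun b y => p (b • y) = p (b • x) ∧ (T y (b • y) ↔ T x (b • x)))).2
        fun b _ => (h1 b).and (h2 b)
    filter_upwards [h3, h1 g, h2 g] with y hy3 hy1 hy2
    refine huniq _ _ (hy2.2 (hg ▸ hτ x)) fun z hz => ?_
    obtain ⟨b, hb, rfl⟩ := hB y z hz
    rw [hy1, (hy3 b hb).1, ← hg]
    exact hτm x _ ((hy3 b hb).2.1 hz)
  · refine huniq _ _ (hT.equiv.trans hxy (hτ y)) fun z hz => hτm y z ?_
    exact hT.equiv.trans (hT.equiv.symm hxy) hz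

end CantorOrbit

namespace CantorOrbit

open Set Topology Filter ProbabilityTheory

variable {G X : Type*} [CommGroup G] [MulAction G X] [TopologicalSpace X] [ContinuousConstSMul G X]
  [FreeAct G X] [CompactSpace X] [PolishSpace X] [TotallyDisconnectedSpace X] [MeasurableSpace X]
  [BorelSpace X] [Countable G] {F : ℕ → Finset G} {C : ℕ} {μ : Measure X} {T : X → X → Prop}

/-- A tiling, with ranks of the points of each `V k` inside the tiles, such that the generators move
a point `q x` to another tile only when its rank is in the first third. -/
theorem exists_towers (h : UEMin G μ) (hF : IsBalls F C) {q : X → X} (hq : Continuous q) {Z : Set X}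
    (hZ : Z.Finite) (hloc : ∀ x ∉ Z, LocG G q x) {K : Finset G} (hK : ∀ g ∈ K, g⁻¹ ∈ K)
    {V : ℕ → Set X} (hV : ∀ k, IsClopen (V k)) {s : Finset ℕ} (hs : ∀ k ∈ s, (V k).Nonempty) :
    ∃ (τ : X → X) (r n : ℕ → X → ℕ), (∀ x, LocG G τ x) ∧ (∀ k, IsLocallyConstant (r k)) ∧
      (∀ k, IsLocallyConstant (n k)) ∧ (∀ k y y', τ y = τ y' → n k y = n k y') ∧
      (∀ k, ∀ y ∈ V k, r k y < n k y) ∧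
      (∀ k, ∀ y ∈ V k, ∀ y' ∈ V k, τ y = τ y' → r k y = r k y' → y = y') ∧
      (∀ k y, ∀ c < n k y, ∃ v ∈ V k, τ v = τ y ∧ r k v = c) ∧
      ∀ x, ∀ g ∈ K, τ (q x) ≠ τ (q (g • x)) → ∀ k ∈ s, q x ∈ V k →
        3 * (r k (q x) + 1) ≤ n k (q x) := by
  classical
  have := h.prob
  obtain ⟨θ, hθ, hθs⟩ : ∃ θ : ℝ, 0 < θ ∧ ∀ k ∈ s, θ ≤ μ.real (V k) := by
    rcases s.eq_empty_or_nonempty with rfl | hne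
    · exact ⟨1, one_pos, by simp⟩
    · obtain ⟨k, hk, hm⟩ := s.exists_min_image (fun k => μ.real (V k)) hne
      exact ⟨μ.real (V k), h.pos (hV k).isOpen (hs k hk), hm⟩
  have hZ' : (⋃ g ∈ K, (fun x : X => g • x) '' Z).Finite :=
    K.finite_toSet.biUnion fun g _ => hZ.image _
  obtain ⟨N, hN, hZN, hNθ⟩ := exists_small_nhds h ((hZ.union hZ').image q)
    (by positivity : 0 < θ / 12)
  obtain ⟨K', hK'⟩ := exists_finite_translates hloc K (L := q ⁻¹' Nᶜ)
    ((hN.compl.preimage hq).isClosed.isCompact)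
    (fun x hx hxZ => hx (hZN (mem_image_of_mem q (Or.inl hxZ))))
    (fun x hx g hg hgZ => hx (hZN (mem_image_of_mem q (Or.inr
      (mem_iUnion₂.2 ⟨g⁻¹, hK g hg, _, hgZ, by simp⟩)))))
  obtain ⟨T, hT, hTK, hTs⟩ := exists_tiling_equidist h hF K' (Finset.insertNone s)
    (fun o : Option ℕ => o.elim N V) (by rintro (_ | k) _ <;> simp [hN, hV])
    (by positivity : 0 < θ / 12)
  obtain ⟨p, hp, hpT⟩ := hT.exists_label
  obtain ⟨τ, hτl, hτ, hττ⟩ := hT.exists_repr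
  have hτT : ∀ {x y}, τ x = τ y → T x y := fun {x y} e =>
    hT.equiv.trans (hτ x) (e ▸ hT.equiv.symm (hτ y))
  obtain ⟨M, hM⟩ := hp.range_finite.bddAbove
  have hM : ∀ x, p x ≤ M := fun x => hM (mem_range_self x)
  set bad : Set X := N ∪ ⋃ k ∈ K', {y | T y (k • y)}ᶜ with hbad
  have hbadc : IsClopen bad := hN.union (K'.finite_toSet.isClopen_biUnion
    fun k _ => (hT.clopen k).compl)
  have hbadn : ∀ x, ∀ k ∈ s, 3 * {y | T x y ∧ y ∈ bad}.ncard ≤ {y | T x y ∧ y ∈ V k}.ncard := by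
    intro x k hk
    have h1 := hTs (some k) (by simpa using hk) x
    have h2 := hTs none (by simp) x
    have h3 := hTK x
    simp only [Option.elim] at h1 h2
    have h4 : {y | T x y ∧ y ∈ bad} ⊆ {y | T x y ∧ y ∈ N} ∪
        {y | T x y ∧ ∃ k ∈ K', ¬ T y (k • y)} := by
      rintro y ⟨hy, hyN | hyK⟩
      · exact Or.inl ⟨hy, hyN⟩
      · obtain ⟨k, hk, hyk⟩ := mem_iUnion₂.1 hyK
        exact Or.inr ⟨hy, k, hk, hyk⟩
    have h5 := (ncard_le_ncard h4 (((hT.finite x).subset fun y hy => hy.1).union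
      ((hT.finite x).subset fun y hy => hy.1))).trans (ncard_union_le _ _)
    have h6 : ({y | T x y ∧ y ∈ bad}.ncard : ℝ) ≤ ({y | T x y ∧ y ∈ N}.ncard : ℝ) +
        ({y | T x y ∧ ∃ k ∈ K', ¬ T y (k • y)}.ncard : ℝ) := by exact_mod_cast h5
    have h7 := (abs_le.1 h1).1
    have h8 := (abs_le.1 h2).2
    have h9 := hθs k hk
    have h10 : (0 : ℝ) ≤ {y | T x y}.ncard := Nat.cast_nonneg _
    have h11 := mul_le_mul_of_nonneg_right h9 h10
    have h12 := mul_le_mul_of_nonneg_right hNθ.le h10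
    have : (3 : ℝ) * {y | T x y ∧ y ∈ bad}.ncard ≤ {y | T x y ∧ y ∈ V k}.ncard := by
      nlinarith
    exact_mod_cast this
  set κ : X → ℕ := fun y => p y + if y ∈ bad then 0 else M + 1 with hκdef
  have hκ : IsLocallyConstant κ := by
    rw [isLocallyConstant_iff_eventually] at hp ⊢
    intro x
    filter_upwards [hp x, eventually_mem_iff_of_isClopen hbadc x] with y h1 h2
    simp only [hκdef, h1, h2]
  have hκlt : ∀ {x y}, y ∈ bad → κ x < κ y → x ∈ bad := by
    intro x y hy hxy
    by_contra hx
    simp only [hκdef, if_pos hy, if_neg hx] at hxy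
    have := hM y
    omega
  have hκT : ∀ {x y}, T x y → κ x = κ y → x = y := by
    intro x y hxy e
    refine hpT x y hxy ?_
    have h1 := hM x
    have h2 := hM y
    simp only [hκdef] at e
    split_ifs at e <;> omega
  have hκinj : ∀ x k, InjOn κ {y | T x y ∧ y ∈ V k} := fun x k y hy z hz e =>
    hκT (hT.equiv.trans (hT.equiv.symm hy.1) hz.1) e
  have hfin : ∀ x k, {y | T x y ∧ y ∈ V k}.Finite := fun x k =>
    (hT.finite x).subset fun y hy => hy.1
  set r : ℕ → X → ℕ := fun k x => {y | T x y ∧ (y ∈ V k ∧ κ y < κ x)}.ncard with hr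
  set n : ℕ → X → ℕ := fun k x => {y | T x y ∧ y ∈ V k}.ncard with hn
  have hrS : ∀ k x y, T x y → r k y =
      {z | z ∈ {z | T x z ∧ z ∈ V k} ∧ κ z < κ y}.ncard := by
    intro k x y hxy
    refine congrArg Set.ncard ?_
    ext z
    have : T x z ↔ T y z := Set.ext_iff.1 (hT.cls_eq hxy) z
    simp [this, and_assoc]
  refine ⟨τ, r, n, hτl, fun k => hT.isLocallyConstant_ncard fun g => ?_,
    fun k => hT.isLocallyConstant_ncard_mem (hV k), fun k y y' e => ?_, fun k y hy => ?_,
    fun k y hy y' hy' e e' => ?_, fun k y c hc => ?_, fun x g hg hne k hk hxk => ?_⟩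
  · refine ((hV k).preimage (continuous_const_smul g)).inter ?_
    have h1 : IsLocallyConstant fun x => (κ (g • x), κ x) :=
      (hκ.comp_continuous (continuous_const_smul g)).prodMk hκ
    exact ⟨⟨h1 {q : ℕ × ℕ | q.1 < q.2}ᶜ⟩, h1 {q : ℕ × ℕ | q.1 < q.2}⟩
  · rw [hn]
    exact congrArg Set.ncard (hT.sep_eq (hτT e) _)
  · rw [hrS k y y (hT.equiv.refl y)]
    exact ncard_rank_lt (hfin y k) ⟨hT.equiv.refl y, hy⟩
  · rw [hrS k y y (hT.equiv.refl y), hrS k y y' (hτT e)] at e'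
    exact injOn_ncard_rank (hfin y k) (hκinj y k) ⟨hT.equiv.refl y, hy⟩ ⟨hτT e, hy'⟩ e'
  · obtain ⟨v, hv, hvc⟩ := exists_ncard_rank_eq (hfin y k) (hκinj y k) hc
    exact ⟨v, hv.2, (hττ _ _ hv.1).symm, by rw [hrS k y v hv.1, hvc]⟩
  · have hb : q x ∈ bad := by
      by_cases hxN : q x ∈ N
      · exact Or.inl hxN
      · obtain ⟨k, hk, e⟩ := hK' x hxN g hg
        refine Or.inr (mem_iUnion₂.2 ⟨k, hk, fun hcon => hne (hττ _ _ ?_)⟩)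
        rw [e]
        exact hcon
    refine le_trans ?_ (hbadn (q x) k hk)
    have : r k (q x) < {y | T (q x) y ∧ y ∈ bad}.ncard := by
      refine ncard_lt_ncard ⟨fun z hz => ⟨hz.1, hκlt hb hz.2.2⟩, fun hcon => ?_⟩
        ((hT.finite (q x)).subset fun y hy => hy.1)
      exact lt_irrefl _ (hcon (⟨hT.equiv.refl _, hb⟩ : q x ∈ {y | T (q x) y ∧ y ∈ bad})).2.2
    omega

end CantorOrbit

namespace CantorOrbit

open Set Topology Filter ProbabilityTheory

variable {G X : Type*} [CommGroup G] [MulAction G X] [TopologicalSpace X] [ContinuousConstSMul G X]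
  [FreeAct G X] [CompactSpace X] [PolishSpace X] [TotallyDisconnectedSpace X] [MeasurableSpace X]
  [BorelSpace X] [Countable G] {F : ℕ → Finset G} {C : ℕ} {μ : Measure X} {T : X → X → Prop}

/-- A finite-to-one map `z` inside the orbits whose fibres are separated by the label `l`. -/
structure Collapse (G : Type*) {X : Type*} [Group G] [MulAction G X] [TopologicalSpace X]
    (z : X → X) (l : X → ℕ) : Prop where
  cont : Continuous z
  isOpenMap : IsOpenMap z
  rel : ∀ x, ∃ g : G, z x = g • x
  locConst : IsLocallyConstant l
  inj : ∀ x y, z x = z y → l x = l y → x = y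
  loc : ∃ Z : Set X, Z.Finite ∧ ∀ x ∉ Z, LocG G z x

theorem Collapse.finite_preimage {z : X → X} {l : X → ℕ} (h : Collapse G z l) {P : Set X}
    (hP : P.Finite) : (z ⁻¹' P).Finite := by
  have h1 : InjOn (fun x => (z x, l x)) univ := fun x _ y _ e =>
    h.inj x y (Prod.ext_iff.1 e).1 (Prod.ext_iff.1 e).2
  exact ((hP.prod h.locConst.range_finite).preimage (h1.mono (subset_univ _))).subset
    fun x hx => ⟨hx, mem_range_self x⟩

theorem isOpenMap_of_locG {τ : X → X} (h : ∀ x, LocG G τ x) : IsOpenMap τ := fun _ hU =>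
  isOpen_image_of_locG hU fun x _ => h x

theorem continuous_of_locG {τ : X → X} (h : ∀ x, LocG G τ x) : Continuous τ :=
  continuous_iff_continuousAt.2 fun x => (h x).continuousAt

theorem Collapse.step (h : UEMin G μ) (hF : IsBalls F C) {δ : ℝ} (hδ : 0 < δ)
    (hdiv : ∀ D : Set X, IsClopen D → D.Nonempty → μ.real D < δ →
      ∃ V : Set X, IsClopen V ∧ 9 * μ.real V = μ.real D)
    {K : Finset G} (hK : ∀ g ∈ K, g⁻¹ ∈ K) {z : X → X} {l : X → ℕ} (hz : Collapse G z l)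
    {W : Set X} (hW : IsClopen W) :
    ∃ (e : X → ℕ) (t : X → Fin 3) (z' : X → X), IsLocallyConstant e ∧ IsLocallyConstant t ∧
      Collapse G z' (fun x => Nat.pair (Nat.pair (l x) (e x)) (t x)) ∧
      (∀ x y, z x = z y → z' x = z' y ∧ e x = e y ∧ t x = t y) ∧
      (∀ x y, l x = l y → e x = e y → (x ∈ W ↔ y ∈ W)) ∧
      (∀ x y, e x = e y → ∃ y', z y' = z y ∧ l y' = l x) ∧
      (∀ x c, ∃ y, l y = l x ∧ e y = e x ∧ z' y = z' x ∧ t y = c) ∧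
      ∀ g ∈ K, ∀ x, z' x ≠ z' (g • x) → t x = 0 ∧ t (g • x) = 0 := by
  classical
  have := h.prob
  have hzimg : ∀ U : Set X, IsClopen U → IsClopen (z '' U) := fun U hU =>
    ⟨(hU.isClosed.isCompact.image hz.cont).isClosed, hz.isOpenMap U hU.isOpen⟩
  have hD : IsClopen (range z) := by
    rw [← image_univ]
    exact hzimg _ isClopen_univ
  have hl : ∀ k, IsClopen {x | l x = k} := isClopen_eq_of_isLocallyConstant hz.locConst
  have hS₁ : IsLocallyConstant fun d => {k | d ∈ z '' ({x | l x = k} ∩ W)} :=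
    isLocallyConstant_setOf_mem (fun k => hzimg _ ((hl k).inter hW)) hz.locConst.range_finite
      (fun k hk => image_eq_empty.2 (eq_empty_of_forall_notMem fun x hx => hk ⟨x, hx.1⟩))
  have hS₂ : IsLocallyConstant fun d => {k | d ∈ z '' ({x | l x = k} ∩ Wᶜ)} :=
    isLocallyConstant_setOf_mem (fun k => hzimg _ ((hl k).inter hW.compl))
      hz.locConst.range_finite
      (fun k hk => image_eq_empty.2 (eq_empty_of_forall_notMem fun x hx => hk ⟨x, hx.1⟩))
  obtain ⟨p, hp, hpδ⟩ := exists_clopen_partition (X := X) (Q := fun U => μ.real U < δ)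
    (fun U V hUV hV => (measureReal_mono hUV (measure_ne_top _ _)).trans_lt hV) (by simpa)
    (fun x => by
      obtain ⟨V, hV, hxV, -, hVδ⟩ := h.exists_small isOpen_univ (mem_univ x) hδ
      exact ⟨V, hV, hxV, hVδ⟩)
  obtain ⟨i, hi, hie⟩ := exists_nat_of_isLocallyConstant (hS₁.prodMk (hS₂.prodMk hp))
  have htype : ∀ x d, i d = i (z x) → ∃ y, z y = d ∧ l y = l x ∧ (y ∈ W ↔ x ∈ W) := by
    intro x d e
    have e := (hie d (z x)).1 e
    simp only [Prod.mk.injEq] at e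
    by_cases hx : x ∈ W
    · have h1 : l x ∈ {k | z x ∈ z '' ({x | l x = k} ∩ W)} := ⟨x, ⟨rfl, hx⟩, rfl⟩
      rw [← e.1] at h1
      obtain ⟨y, ⟨h2, h3⟩, h4⟩ := h1
      exact ⟨y, h4, h2, iff_of_true h3 hx⟩
    · have h1 : l x ∈ {k | z x ∈ z '' ({x | l x = k} ∩ Wᶜ)} := ⟨x, ⟨rfl, hx⟩, rfl⟩
      rw [← e.2.1] at h1
      obtain ⟨y, ⟨h2, h3⟩, h4⟩ := h1
      exact ⟨y, h4, h2, iff_of_false h3 hx⟩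
  obtain ⟨V, w, j, hV, hfold⟩ := exists_fold_partition h hF hD hi (fun k hne => by
    refine hdiv _ (hD.inter (isClopen_eq_of_isLocallyConstant hi k)) hne ?_
    obtain ⟨d, -, hd⟩ := hne
    refine (measureReal_mono (fun d' hd' => ?_) (measure_ne_top _ _)).trans_lt (hpδ (p d))
    have := (hie d' d).1 (hd'.2.trans hd.symm)
    simp only [Prod.mk.injEq] at this
    exact this.2.2)
  have hmem : ∀ x, z x ∈ range z ∩ {d | i d = i (z x)} := fun x => ⟨mem_range_self x, rfl⟩
  set q : X → X := fun x => w (z x) with hq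
  have hqc : Continuous q := continuous_iff_continuousAt.2 fun x =>
    ((hfold _).cont _ (hmem x)).comp hz.cont.continuousAt
  have hqo : IsOpenMap q := by
    rw [isOpenMap_iff_nhds_le]
    intro x U hU
    have h1 : z '' (q ⁻¹' U) ∈ 𝓝 (z x) := hz.isOpenMap.image_mem_nhds hU
    refine mem_of_superset ((hfold _).nhds _ (hmem x) _ h1) ?_
    rintro _ ⟨_, ⟨y, hy, rfl⟩, rfl⟩
    exact hy
  choose P hP hPl using fun k => (hfold k).loc
  have hP' : (⋃ k ∈ range i, P k).Finite := hi.range_finite.biUnion fun k _ => hP k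
  obtain ⟨Z, hZ, hZl⟩ := hz.loc
  have hqZ : (Z ∪ z ⁻¹' (⋃ k ∈ range i, P k)).Finite := hZ.union (hz.finite_preimage hP')
  have hql : ∀ x ∉ Z ∪ z ⁻¹' (⋃ k ∈ range i, P k), LocG G q x := by
    intro x hx
    refine LocG.comp (f' := w) (hPl (i (z x)) _ (hmem x) fun hcon => hx (Or.inr ?_))
      (hZl x fun hcon => hx (Or.inl hcon))
    exact mem_iUnion₂.2 ⟨i (z x), mem_range_self _, hcon⟩
  have hfs : (i '' range z).Finite := hi.range_finite.subset (image_subset_range _ _)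
  obtain ⟨τ, r, n, hτ, hr, hn, hnτ, hrn, hri, hrs, hrK⟩ := exists_towers h hF hqc hqZ hql hK hV
    (s := hfs.toFinset) (fun k hk => by
      obtain ⟨d, hd, rfl⟩ := hfs.mem_toFinset.1 hk
      exact ⟨w d, (hfold _).mapsTo ⟨hd, rfl⟩⟩)
  set k : X → ℕ := fun x => i (z x) with hk
  set N : X → ℕ := fun x => n (k x) (q x) with hN
  set m : X → ℕ := fun x => 9 * r (k x) (q x) + j (z x) with hm
  have hqV : ∀ x, q x ∈ V (k x) := fun x => (hfold _).mapsTo (hmem x)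
  have hj9 : ∀ x, j (z x) < 9 := fun x => (hfold _).lt _ (hmem x)
  have hmN : ∀ x, m x < 3 * N x * 3 := fun x => by
    have := hrn _ _ (hqV x)
    have := hj9 x
    simp only [hm, hN]
    omega
  have hNpos : ∀ x, 0 < 3 * N x := fun x => by have := hmN x; omega
  have hkl : ∀ x, ∀ᶠ y in 𝓝 x, k y = k x := fun x =>
    hz.cont.continuousAt.eventually (isLocallyConstant_iff_eventually.1 hi (z x))
  have hNl : ∀ x, ∀ᶠ y in 𝓝 x, N y = N x := fun x => by
    filter_upwards [hkl x, hqc.continuousAt.eventually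
      (isLocallyConstant_iff_eventually.1 (hn (k x)) (q x))] with y h1 h2
    simp only [hN, h1, h2]
  have hml : ∀ x, ∀ᶠ y in 𝓝 x, m y = m x := fun x => by
    filter_upwards [hkl x, hqc.continuousAt.eventually
      (isLocallyConstant_iff_eventually.1 (hr (k x)) (q x)),
      hz.cont.continuousAt.eventually ((hfold _).locConst _ (hmem x))] with y h1 h2 h3
    simp only [hm, h1, h2, h3]
  set e : X → ℕ := fun x => Nat.pair (k x) (m x % (3 * N x)) with he
  set t : X → Fin 3 := fun x => ⟨m x / (3 * N x), Nat.div_lt_of_lt_mul (hmN x)⟩ with ht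
  have hek : ∀ {x y}, e x = e y → k x = k y ∧ m x % (3 * N x) = m y % (3 * N y) :=
    fun {x y} e => Nat.pair_eq_pair.1 e
  have hel : IsLocallyConstant e := isLocallyConstant_iff_eventually.2 fun x => by
    filter_upwards [hkl x, hNl x, hml x] with y h1 h2 h3
    simp only [he, h1, h2, h3]
  have htl : IsLocallyConstant t := isLocallyConstant_iff_eventually.2 fun x => by
    filter_upwards [hNl x, hml x] with y h2 h3
    simp only [ht, h2, h3]
  have hfib : ∀ x y, e x = e y → ∃ y', z y' = z y ∧ l y' = l x ∧ (y' ∈ W ↔ x ∈ W) :=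
    fun x y exy => htype x (z y) (hek exy).1.symm
  have ht0 : ∀ g ∈ K, ∀ x, τ (q x) ≠ τ (q (g • x)) → t x = 0 := by
    intro g hg x hne
    have h1 := hrK x g hg hne (k x) (hfs.mem_toFinset.2 ⟨z x, mem_range_self x, rfl⟩) (hqV x)
    have h2 := hj9 x
    refine Fin.ext ?_
    simp only [ht, Fin.val_zero]
    refine Nat.div_eq_of_lt ?_
    simp only [hm, hN]
    omega
  refine ⟨e, t, fun x => τ (q x), hel, htl, ⟨?_, ?_, ?_, ?_, ?_, _, hqZ, ?_⟩, ?_, ?_, ?_, ?_, ?_⟩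
  · exact (continuous_of_locG hτ).comp hqc
  · exact (isOpenMap_of_locG hτ).comp hqo
  · intro x
    obtain ⟨a, ha⟩ := hz.rel x
    obtain ⟨b, hb⟩ := (hfold _).rel _ (hmem x)
    obtain ⟨c, hc⟩ := (hτ (q x)).exists_eq
    exact ⟨c * b * a, by rw [hc, hq, mul_smul, mul_smul, ← ha, ← hb]⟩
  · refine isLocallyConstant_iff_eventually.2 fun x => ?_
    filter_upwards [isLocallyConstant_iff_eventually.1 hz.locConst x,
      isLocallyConstant_iff_eventually.1 hel x,
      isLocallyConstant_iff_eventually.1 htl x] with y h1 h2 h3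
    simp only [h1, h2, h3]
  · intro x y hxy hlab
    obtain ⟨h1, h2⟩ := Nat.pair_eq_pair.1 hlab
    obtain ⟨h3, h4⟩ := Nat.pair_eq_pair.1 h1
    obtain ⟨h5, h6⟩ := hek h4
    have h7 : m x / (3 * N x) = m y / (3 * N y) := h2
    have h8 : N x = N y := by
      simp only [hN]
      rw [h5]
      exact hnτ _ _ _ hxy
    have h9 : m x = m y := by
      rw [← Nat.div_add_mod (m x) (3 * N x), h6, h7, h8, Nat.div_add_mod]
    have h10 := hj9 x
    have h11 := hj9 y
    have h12 : r (k x) (q x) = r (k x) (q y) ∧ j (z x) = j (z y) := by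
      simp only [hm, ← h5] at h9
      omega
    have h13 : q x = q y := hri (k x) _ (hqV x) _ (h5 ▸ hqV y) hxy h12.1
    refine hz.inj x y ((hfold (k x)).inj _ (hmem x) _ ?_ h13 h12.2) h3
    exact ⟨mem_range_self y, h5.symm⟩
  · intro x hx
    exact LocG.comp (hτ (q x)) (hql x hx)
  · intro x y hxy
    simp only [he, ht, hm, hN, hk, hq, hxy, and_self]
  · intro x y h1 h2
    obtain ⟨y', h3, h4, h5⟩ := hfib x y h2
    rw [hz.inj y' y h3 (h4.trans h1)] at h5
    exact h5.symm
  · intro x y hxy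
    obtain ⟨y', h3, h4, -⟩ := hfib x y hxy
    exact ⟨y', h3, h4⟩
  · intro x c
    set M := 3 * N x * c + m x % (3 * N x) with hM
    have h1 : m x % (3 * N x) < 3 * N x := Nat.mod_lt _ (hNpos x)
    have h2 : M < 9 * N x := by
      have : 3 * N x * c ≤ 3 * N x * 2 := Nat.mul_le_mul_left _ (by omega)
      omega
    obtain ⟨v, hv, hvτ, hvr⟩ := hrs (k x) (q x) (M / 9) (Nat.div_lt_of_lt_mul h2)
    obtain ⟨d, hd, hdv, hdj⟩ := (hfold (k x)).surj v hv (M % 9) (Nat.mod_lt _ (by norm_num))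
    obtain ⟨y, hyd, hyl, -⟩ := htype x d hd.2
    have hky : k y = k x := by simp only [hk, hyd]; exact hd.2
    have hqy : q y = v := by simp only [hq, hyd, hdv]
    have hNy : N y = N x := by
      simp only [hN]
      rw [hky, hqy]
      exact hnτ _ _ _ hvτ
    have hmy : m y = M := by
      simp only [hm, hky, hqy, hvr, hyd, hdj]
      exact Nat.div_add_mod M 9
    have h3 : M % (3 * N x) = m x % (3 * N x) := by
      rw [hM, Nat.mul_add_mod, Nat.mod_mod]
    have h4 : M / (3 * N x) = c := by
      rw [hM, Nat.mul_add_div (hNpos x), Nat.div_eq_of_lt h1, add_zero]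
    refine ⟨y, hyl, ?_, ?_, ?_⟩
    · simp only [he, hky, hmy, hNy, h3]
    · simp only [hqy, hvτ]
    · refine Fin.ext ?_
      simp only [ht, hmy, hNy, h4]
  · intro g hg x hne
    refine ⟨ht0 g hg x hne, ht0 g⁻¹ (hK g hg) (g • x) ?_⟩
    rw [inv_smul_smul]
    exact hne.symm

end CantorOrbit

namespace CantorOrbit

open Set Topology Filter ProbabilityTheory

variable {G X : Type*} [CommGroup G] [MulAction G X] [TopologicalSpace X] [ContinuousConstSMul G X]
  [FreeAct G X] [CompactSpace X] [PolishSpace X] [TotallyDisconnectedSpace X] [MeasurableSpace X]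
  [BorelSpace X] [Countable G] {F : ℕ → Finset G} {C : ℕ} {μ : Measure X} {T : X → X → Prop}

/-- A coding of `X` by sequences `e n x`, `t n x` adapted to the orbit relation: the `t`-part is
free, tail-equivalent codes give orbit-equivalent points, and elements of `K` either preserve the
tail or move points with `t = 0`. -/
structure Coding (K : Set G) (e : ℕ → X → ℕ) (t : ℕ → X → Fin 3) : Prop where
  locConst_e : ∀ n, IsLocallyConstant (e n)
  locConst_t : ∀ n, IsLocallyConstant (t n)
  inj : ∀ x y, (∀ n, e n x = e n y) → (∀ n, t n x = t n y) → x = y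
  surj : ∀ x, ∀ s : ℕ → Fin 3, ∃ y, (∀ n, e n y = e n x) ∧ ∀ n, t n y = s n
  rel : ∀ x y k, (∀ n, k ≤ n → e n x = e n y ∧ t n x = t n y) → ∃ g : G, y = g • x
  gen : ∀ g ∈ K, ∀ x, (∃ k, ∀ n, k ≤ n → e n x = e n (g • x) ∧ t n x = t n (g • x)) ∨
    ∀ n, t n x = 0 ∧ t n (g • x) = 0

theorem exists_coding (h : UEMin G μ) (hF : IsBalls F C) {δ : ℝ} (hδ : 0 < δ)
    (hdiv : ∀ D : Set X, IsClopen D → D.Nonempty → μ.real D < δ →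
      ∃ V : Set X, IsClopen V ∧ 9 * μ.real V = μ.real D)
    {K : Finset G} (hK : ∀ g ∈ K, g⁻¹ ∈ K) :
    ∃ (e : ℕ → X → ℕ) (t : ℕ → X → Fin 3), Coding (K : Set G) e t := by
  classical
  have : Countable (TopologicalSpace.Clopens X) :=
    TopologicalSpace.Clopens.countable_iff_secondCountable.2 inferInstance
  have : TotallySeparatedSpace X := inferInstance
  obtain ⟨W, hW⟩ := exists_surjective_nat (TopologicalSpace.Clopens X)
  let St : Type _ := {p : (X → X) × (X → ℕ) // Collapse G p.1 p.2}
  have step : ∀ (n : ℕ) (p : St), ∃ (q : St) (e : X → ℕ) (t : X → Fin 3),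
      q.1.2 = (fun x => Nat.pair (Nat.pair (p.1.2 x) (e x)) (t x)) ∧
      IsLocallyConstant e ∧ IsLocallyConstant t ∧
      (∀ x y, p.1.1 x = p.1.1 y → q.1.1 x = q.1.1 y ∧ e x = e y ∧ t x = t y) ∧
      (∀ x y, p.1.2 x = p.1.2 y → e x = e y → (x ∈ W n ↔ y ∈ W n)) ∧
      (∀ x y, e x = e y → ∃ y', p.1.1 y' = p.1.1 y ∧ p.1.2 y' = p.1.2 x) ∧
      (∀ x c, ∃ y, p.1.2 y = p.1.2 x ∧ e y = e x ∧ q.1.1 y = q.1.1 x ∧ t y = c) ∧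
      ∀ g ∈ K, ∀ x, q.1.1 x ≠ q.1.1 (g • x) → t x = 0 ∧ t (g • x) = 0 := by
    rintro n ⟨⟨z, l⟩, hz⟩
    obtain ⟨e, t, z', h1, h2, h3, h4⟩ := Collapse.step h hF hδ hdiv hK hz (W n).isClopen
    exact ⟨⟨(z', _), h3⟩, e, t, rfl, h1, h2, h4⟩
  choose nxt e' t' hl hel htl hz hWn hfib hfree hgen using step
  have hst : Collapse G (id : X → X) (fun _ : X => 0) :=
    ⟨continuous_id, IsOpenMap.id, fun x => ⟨1, by simp⟩, IsLocallyConstant.const _,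
      fun x y e _ => e, ∅, finite_empty, fun x _ => ⟨1, by simp⟩⟩
  let s : ℕ → St := fun n => Nat.rec ⟨(id, fun _ => 0), hst⟩ (fun n p => nxt n p) n
  set z : ℕ → X → X := fun n => (s n).1.1 with hzdef
  set l : ℕ → X → ℕ := fun n => (s n).1.2 with hldef
  set e : ℕ → X → ℕ := fun n => e' n (s n) with hedef
  set t : ℕ → X → Fin 3 := fun n => t' n (s n) with htdef
  have hc : ∀ n, Collapse G (z n) (l n) := fun n => (s n).2
  have hl' : ∀ n x, l (n + 1) x = Nat.pair (Nat.pair (l n x) (e n x)) (t n x) := fun n x =>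
    congrFun (hl n (s n)) x
  have hz' : ∀ n x y, z n x = z n y → z (n + 1) x = z (n + 1) y ∧ e n x = e n y ∧ t n x = t n y :=
    fun n => hz n (s n)
  have hW' : ∀ n x y, l n x = l n y → e n x = e n y → (x ∈ W n ↔ y ∈ W n) := fun n => hWn n (s n)
  have hfib' : ∀ n x y, e n x = e n y → ∃ y', z n y' = z n y ∧ l n y' = l n x :=
    fun n => hfib n (s n)
  have hfree' : ∀ n x c, ∃ y, l n y = l n x ∧ e n y = e n x ∧ z (n + 1) y = z (n + 1) x ∧
    t n y = c := fun n => hfree n (s n)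
  have hgen' : ∀ n, ∀ g ∈ K, ∀ x, z (n + 1) x ≠ z (n + 1) (g • x) →
    t n x = 0 ∧ t n (g • x) = 0 := fun n => hgen n (s n)
  have hlab : ∀ n x y, l n x = l n y ↔ ∀ k, k < n → e k x = e k y ∧ t k x = t k y := by
    intro n x y
    induction n with
    | zero => exact iff_of_true rfl (by simp)
    | succ n ih =>
      rw [hl', hl', Nat.pair_eq_pair, Nat.pair_eq_pair, ih]
      constructor
      · rintro ⟨⟨h1, h2⟩, h3⟩ k hk
        rcases Nat.lt_succ_iff_lt_or_eq.1 hk with hk | rfl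
        · exact h1 k hk
        · exact ⟨h2, Fin.ext h3⟩
      · intro h1
        exact ⟨⟨fun k hk => h1 k (by omega), (h1 n (by omega)).1⟩, by rw [(h1 n (by omega)).2]⟩
  have htail : ∀ n x y, z n x = z n y → ∀ k, n ≤ k → z k x = z k y := by
    intro n x y hxy k hk
    induction k, hk using Nat.le_induction with
    | base => exact hxy
    | succ k _ ih => exact (hz' k x y ih).1
  have htail' : ∀ n x y, z n x = z n y → ∀ k, n ≤ k → e k x = e k y ∧ t k x = t k y :=
    fun n x y hxy k hk => (hz' k x y (htail n x y hxy k hk)).2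
  have hinj : ∀ x y, (∀ n, e n x = e n y) → (∀ n, t n x = t n y) → x = y := by
    intro x y h1 h2
    by_contra hne
    obtain ⟨U, hU, hxU, hyU⟩ := exists_isClopen_of_totally_separated hne
    obtain ⟨n, hn⟩ := hW ⟨U, hU⟩
    have h3 := hW' n x y ((hlab n x y).2 fun k _ => ⟨h1 k, h2 k⟩) (h1 n)
    rw [hn] at h3
    exact hyU (h3.1 hxU)
  have hec : ∀ n, IsLocallyConstant (e n) := fun n => hel n (s n)
  have htc : ∀ n, IsLocallyConstant (t n) := fun n => htl n (s n)
  refine ⟨e, t, hec, htc, hinj, ?_, ?_, ?_⟩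
  · intro x s
    have hfin : ∀ n, ∃ y, (∀ m, e m y = e m x) ∧ (∀ m, m < n → t m y = s m) := by
      intro n
      induction n with
      | zero => exact ⟨x, fun _ => rfl, by simp⟩
      | succ n ih =>
        obtain ⟨y, h1, h2⟩ := ih
        obtain ⟨y', h3, h4, h5, h6⟩ := hfree' n y (s n)
        have h7 := (hlab n y' y).1 h3
        refine ⟨y', fun m => ?_, fun m hm => ?_⟩
        · rcases lt_trichotomy m n with hm | rfl | hm
          · rw [(h7 m hm).1, h1]
          · rw [h4, h1]
          · rw [(htail' _ _ _ h5 m hm).1, h1]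
        · rcases Nat.lt_succ_iff_lt_or_eq.1 hm with hm | rfl
          · rw [(h7 m hm).2, h2 m hm]
          · exact h6
    have hcl : ∀ n, IsClosed {y | (∀ m, e m y = e m x) ∧ (∀ m, m < n → t m y = s m)} := by
      intro n
      have h1 : IsClosed ((⋂ m, {y | e m y = e m x}) ∩ ⋂ m, ⋂ _ : m < n, {y | t m y = s m}) :=
        (isClosed_iInter fun m => (isClopen_eq_of_isLocallyConstant (hec m) _).isClosed).inter
          (isClosed_iInter fun m => isClosed_iInter fun _ =>
            (isClopen_eq_of_isLocallyConstant (htc m) _).isClosed)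
      convert h1 using 1
      ext y
      simp
    obtain ⟨y, hy⟩ := IsCompact.nonempty_iInter_of_sequence_nonempty_isCompact_isClosed
      (fun n => {y | (∀ m, e m y = e m x) ∧ (∀ m, m < n → t m y = s m)})
      (fun n y hy => ⟨hy.1, fun m hm => hy.2 m (by omega)⟩) hfin (hcl 0).isCompact hcl
    rw [mem_iInter] at hy
    exact ⟨y, (hy 0).1, fun n => (hy (n + 1)).2 n (by omega)⟩
  · intro x y k hxy
    obtain ⟨y', h1, h2⟩ := hfib' k x y (hxy k le_rfl).1
    have h3 := (hlab k y' x).1 h2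
    have h4 := htail' k y' y h1
    have h5 : y' = x := by
      refine hinj y' x (fun n => ?_) (fun n => ?_)
      · rcases lt_or_ge n k with hn | hn
        · exact (h3 n hn).1
        · rw [(h4 n hn).1, (hxy n hn).1]
      · rcases lt_or_ge n k with hn | hn
        · exact (h3 n hn).2
        · rw [(h4 n hn).2, (hxy n hn).2]
    rw [h5] at h1
    obtain ⟨a, ha⟩ := (hc k).rel x
    obtain ⟨b, hb⟩ := (hc k).rel y
    exact ⟨b⁻¹ * a, by rw [mul_smul, ← ha, h1, hb, inv_smul_smul]⟩
  · intro g hg x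
    by_cases hex : ∃ n, z n x = z n (g • x)
    · obtain ⟨n, hn⟩ := hex
      exact Or.inl ⟨n, htail' n _ _ hn⟩
    · push Not at hex
      exact Or.inr fun n => hgen' n g hg x (hex (n + 1))

/-- A coded action is orbit equivalent to its threefold amplification. -/
theorem Coding.exists_homeomorph {K : Set G} {e : ℕ → X → ℕ} {t : ℕ → X → Fin 3}
    (h : Coding K e t) (hK : Subgroup.closure K = ⊤) :
    ∃ Φ : X ≃ₜ X × Fin 3, ∀ x y, (∃ g : G, y = g • x) ↔ ∃ g : G, (Φ y).1 = g • (Φ x).1 := by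
  classical
  have hrefl : ∀ x : X, ∃ g : G, x = g • x := fun x => ⟨1, by simp⟩
  have hsymm : ∀ {x y : X}, (∃ g : G, y = g • x) → ∃ g : G, x = g • y := by
    rintro x _ ⟨g, rfl⟩
    exact ⟨g⁻¹, by simp⟩
  have htrans : ∀ {x y w : X}, (∃ g : G, y = g • x) → (∃ g : G, w = g • y) →
      ∃ g : G, w = g • x := by
    rintro x _ _ ⟨g, rfl⟩ ⟨g', rfl⟩
    exact ⟨g' * g, by rw [mul_smul]⟩
  have hgenerate : ∀ f : X → X, (∀ g ∈ K, ∀ x, ∃ a : G, f (g • x) = a • f x) →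
      ∀ (g : G) x, ∃ a : G, f (g • x) = a • f x := by
    intro f hf g
    have hg : g ∈ Subgroup.closure K := hK ▸ Subgroup.mem_top g
    induction hg using Subgroup.closure_induction with
    | mem g hg => exact hf g hg
    | one => intro x; rw [one_smul]; exact hrefl _
    | mul a b _ _ ha hb =>
      intro x
      rw [mul_smul]
      exact htrans (hb x) (ha (b • x))
    | inv a _ ha =>
      intro x
      have := ha (a⁻¹ • x)
      rw [smul_inv_smul] at this
      exact hsymm this
  choose σ hσe hσt using fun x => h.surj x fun n => t (n + 1) x
  choose a hae hat using fun (j : Fin 3) x => h.surj x fun n => Nat.casesOn n j fun n => t n x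
  have hat0 : ∀ j x, t 0 (a j x) = j := fun j x => hat j x 0
  have hats : ∀ j x n, t (n + 1) (a j x) = t n x := fun j x n => hat j x (n + 1)
  have hσ0 : ∀ x, (∀ n, t n x = 0) → σ x = x := fun x hx =>
    h.inj _ _ (hσe x) fun n => by rw [hσt, hx, hx]
  have ha0 : ∀ x, (∀ n, t n x = 0) → a 0 x = x := fun x hx =>
    h.inj _ _ (hae 0 x) fun n => by
      cases n with
      | zero => rw [hat0, hx]
      | succ n => rw [hats, hx, hx]
  have haσ : ∀ x, a (t 0 x) (σ x) = x := fun x => h.inj _ _ (fun n => by rw [hae, hσe]) fun n => by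
    cases n with
    | zero => rw [hat0]
    | succ n => rw [hats, hσt]
  have hσa : ∀ j x, σ (a j x) = x := fun j x =>
    h.inj _ _ (fun n => by rw [hσe, hae]) fun n => by rw [hσt, hats]
  have hσrel := hgenerate σ fun g hg x => by
    rcases h.gen g hg x with ⟨k, hk⟩ | h0
    · refine h.rel _ _ k fun n hn => ?_
      rw [hσe, hσe, hσt, hσt]
      exact ⟨(hk n hn).1, (hk (n + 1) (by omega)).2⟩
    · rw [hσ0 _ fun n => (h0 n).1, hσ0 _ fun n => (h0 n).2]
      exact ⟨g, rfl⟩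
  have harel := hgenerate (a 0) fun g hg x => by
    rcases h.gen g hg x with ⟨k, hk⟩ | h0
    · refine h.rel _ _ (k + 1) fun n hn => ?_
      obtain ⟨n, rfl⟩ : ∃ m, n = m + 1 := ⟨n - 1, by omega⟩
      rw [hae, hae, hats, hats]
      exact ⟨(hk (n + 1) (by omega)).1, (hk n (by omega)).2⟩
    · rw [ha0 _ fun n => (h0 n).1, ha0 _ fun n => (h0 n).2]
      exact ⟨g, rfl⟩
  have hajrel : ∀ j x, ∃ g : G, a j x = g • a 0 x := fun j x => h.rel _ _ 1 fun n hn => by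
    obtain ⟨n, rfl⟩ : ∃ m, n = m + 1 := ⟨n - 1, by omega⟩
    rw [hae, hae, hats, hats]
    exact ⟨rfl, rfl⟩
  set P : X → (ℕ → ℕ) × (ℕ → Fin 3) := fun x => (fun n => e n x, fun n => t n x) with hP
  have hPc : Continuous P := by
    refine Continuous.prodMk (continuous_pi fun n => ?_) (continuous_pi fun n => ?_)
    · exact (h.locConst_e n).continuous
    · exact (h.locConst_t n).continuous
  have hPi : Function.Injective P := fun x y exy =>
    h.inj x y (fun n => congrFun (Prod.ext_iff.1 exy).1 n)
      fun n => congrFun (Prod.ext_iff.1 exy).2 n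
  have hPe := hPc.isClosedEmbedding hPi
  have hσc : Continuous σ := by
    rw [hPe.isInducing.continuous_iff]
    refine Continuous.prodMk (continuous_pi fun n => ?_) (continuous_pi fun n => ?_)
    · simp only [hσe]
      exact (h.locConst_e n).continuous
    · simp only [hσt]
      exact (h.locConst_t (n + 1)).continuous
  let E : X ≃ X × Fin 3 :=
    { toFun := fun x => (σ x, t 0 x)
      invFun := fun p => a p.2 p.1
      left_inv := haσ
      right_inv := fun p => Prod.ext (hσa _ _) (hat0 _ _) }
  have hE : Continuous E := hσc.prodMk (h.locConst_t 0).continuous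
  refine ⟨hE.homeoOfEquivCompactToT2, fun x y => ⟨?_, ?_⟩⟩
  · rintro ⟨g, rfl⟩
    exact hσrel g x
  · rintro ⟨g, hg⟩
    have hg : σ y = g • σ x := hg
    have h1 := hajrel (t 0 x) (σ x)
    have h2 := hajrel (t 0 y) (σ y)
    rw [haσ] at h1 h2
    have h3 := harel g (σ x)
    rw [← hg] at h3
    exact htrans (hsymm h1) (htrans h3 h2)

end CantorOrbit

namespace CantorOrbit

open Set Topology Filter ProbabilityTheory

variable {G X : Type*} [CommGroup G] [MulAction G X] [TopologicalSpace X] [ContinuousConstSMul G X]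
  [FreeAct G X] [CompactSpace X] [PolishSpace X] [TotallyDisconnectedSpace X] [MeasurableSpace X]
  [BorelSpace X] [Countable G] {F : ℕ → Finset G} {C : ℕ} {μ : Measure X} {T : X → X → Prop}

theorem prod_count_image_of_slice [SFinite μ] {n : ℕ} {a : X → X × Fin n} {i : Fin n} {A : Set X}
    (hA : ∀ x ∈ A, (a x).2 = i) :
    (μ.prod Measure.count) (a '' A) = μ ((fun x => (a x).1) '' A) := by
  have : a '' A = ((fun x => (a x).1) '' A) ×ˢ {i} := by
    ext ⟨y, k⟩
    simp only [mem_image, mem_prod, mem_singleton_iff]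
    constructor
    · rintro ⟨x, hx, e⟩
      rw [← hA x hx, e]
      exact ⟨⟨x, hx, by rw [e]⟩, rfl⟩
    · rintro ⟨⟨x, hx, e⟩, rfl⟩
      exact ⟨x, hx, Prod.ext e (hA x hx)⟩
  rw [this, Measure.prod_prod, Measure.count_singleton, mul_one]

/-- An orbit-preserving embedding into an amplification whose image has measure `9` multiplies the
invariant measure by `9`. -/
theorem prod_count_image_eq (h : UEMin G μ) {n : ℕ} {a : X → X × Fin n} (ha : IsClosedEmbedding a)
    (hrel : ∀ (x : X) (g : G), ∃ g' : G, (a (g • x)).1 = g' • (a x).1)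
    (hm : (μ.prod Measure.count) (range a) = 9) (A : Set X) :
    (μ.prod Measure.count) (a '' A) = 9 * μ A := by
  have := h.prob
  have hae : MeasurableEmbedding a := ha.measurableEmbedding
  set m : Measure X := (μ.prod Measure.count).comap a with hmdef
  have hmA : ∀ A, m A = (μ.prod Measure.count) (a '' A) := fun A => hae.comap_apply _ A
  have hmi : ∀ (i : Fin n) (A : Set X), (∀ x ∈ A, (a x).2 = i) →
      m A = μ ((fun x => (a x).1) '' A) := fun i A hA => by
    rw [hmA, prod_count_image_of_slice hA]
  have hp : Measurable fun x => (a x).1 := (continuous_fst.comp ha.continuous).measurable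
  have hinj : ∀ (i : Fin n) (A : Set X), (∀ x ∈ A, (a x).2 = i) →
      InjOn (fun x => (a x).1) A := fun i A hA x hx y hy e =>
    ha.injective (Prod.ext e (by rw [hA x hx, hA y hy]))
  have hinv : Inv G m := by
    intro g
    rw [Measure.ext_iff_of_iUnion_eq_univ (ι := Fin n × Fin n)
      (s := fun p => {x | (a x).2 = p.1 ∧ (a (g⁻¹ • x)).2 = p.2})
      (eq_univ_of_forall fun x => mem_iUnion.2 ⟨((a x).2, (a (g⁻¹ • x)).2), rfl, rfl⟩)]
    rintro ⟨i, k⟩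
    have hs : MeasurableSet {x | (a x).2 = i ∧ (a (g⁻¹ • x)).2 = k} :=
      ((continuous_snd.comp ha.continuous).measurable (measurableSet_singleton i)).inter
        (((continuous_snd.comp ha.continuous).comp
          (continuous_const_smul g⁻¹)).measurable (measurableSet_singleton k))
    ext B hB
    have hBs := hB.inter hs
    rw [Measure.restrict_apply hB, Measure.restrict_apply hB,
      Measure.map_apply (measurable_smul_left g) hBs]
    set B' := B ∩ {x | (a x).2 = i ∧ (a (g⁻¹ • x)).2 = k} with hB'
    have hpre : ∀ x ∈ (fun x => g • x) ⁻¹' B', (a x).2 = k := fun x hx => by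
      have := hx.2.2
      rwa [inv_smul_smul] at this
    rw [hmi i B' fun x hx => hx.2.1, hmi k _ hpre]
    have himg : (fun x => (a x).1) '' B' =
        (fun x => (a (g • x)).1) '' ((fun x => g • x) ⁻¹' B') := by
      rw [← image_preimage_eq B' (MulAction.surjective g), image_image, preimage_image_eq _
        (MulAction.injective g)]
    rw [himg]
    refine h.inv.measure_image_eq (measurable_smul_left g hBs) hp
      (hp.comp (measurable_smul_left g)) (hinj k _ hpre) ?_ fun x _ => hrel x g
    intro x hx y hy e
    exact MulAction.injective g (hinj i B' (fun x hx => hx.2.1) hx hy e)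
  have h9 : (9 : ℝ≥0∞)⁻¹ * 9 = 1 := ENNReal.inv_mul_cancel (by norm_num) (by norm_num)
  have hν := h.uniq ((9 : ℝ≥0∞)⁻¹ • m) ⟨by
    rw [Measure.smul_apply, hmA, image_univ, hm, smul_eq_mul, h9]⟩ (fun g => by
      rw [Measure.map_smul, hinv g])
  rw [← hmA, ← hν, Measure.smul_apply, smul_eq_mul, ← mul_assoc, mul_comm 9, h9, one_mul]

theorem exists_division (h : UEMin G μ) (hF : IsBalls F C) [Nonempty X] {n : ℕ}
    {a : X → X × Fin n} (ha : IsClosedEmbedding a) (hU : IsOpen (range a))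
    (hrel : ∀ (x : X) (g : G), ∃ g' : G, (a (g • x)).1 = g' • (a x).1)
    (hm : (μ.prod Measure.count) (range a) = 9) :
    ∃ δ : ℝ, 0 < δ ∧ ∀ D : Set X, IsClopen D → D.Nonempty → μ.real D < δ →
      ∃ V : Set X, IsClopen V ∧ 9 * μ.real V = μ.real D := by
  have := h.prob
  obtain ⟨x₀⟩ := ‹Nonempty X›
  set i := (a x₀).2 with hi
  set S : Set X := {x | (a x).2 = i} with hS
  have hSc : IsClopen S := (isClopen_discrete {i}).preimage (continuous_snd.comp ha.continuous)
  have hpS : (fun x => (a x).1) '' S = (fun y => (y, i)) ⁻¹' range a := by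
    ext y
    constructor
    · rintro ⟨x, hx, rfl⟩
      exact ⟨x, Prod.ext rfl hx⟩
    · rintro ⟨x, hx⟩
      exact ⟨x, by rw [hS, mem_ofPred_eq, hx], by simp only [hx]⟩
  have hpSc : IsClopen ((fun x => (a x).1) '' S) := by
    rw [hpS]
    exact (IsClopen.preimage ⟨ha.isClosed_range, hU⟩ (by fun_prop))
  refine ⟨μ.real ((fun x => (a x).1) '' S), h.pos hpSc.isOpen ⟨_, x₀, rfl, rfl⟩,
    fun D hD hDne hlt => ?_⟩
  obtain ⟨f, hl, hinj, hmaps⟩ := comparison h hF hD hpSc hlt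
  have hI := isClopen_image_of_locG hD hl
  refine ⟨S ∩ (fun x => (a x).1) ⁻¹' (f '' D), hSc.inter
    (hI.preimage (continuous_fst.comp ha.continuous)), ?_⟩
  have h1 := prod_count_image_eq h ha hrel hm (S ∩ (fun x => (a x).1) ⁻¹' (f '' D))
  rw [prod_count_image_of_slice (i := i) (fun x hx => hx.1), image_inter_preimage,
    inter_eq_right.2 hmaps.image_subset] at h1
  rw [← real_image_of_locG h hD hl hinj, Measure.real, Measure.real, h1, ENNReal.toReal_mul]
  rfl

end CantorOrbit

namespace CantorOrbit

open Set Topology Filter ProbabilityTheory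

variable {G X : Type*} [CommGroup G] [MulAction G X] [TopologicalSpace X] [ContinuousConstSMul G X]
  [FreeAct G X] [CompactSpace X] [PolishSpace X] [TotallyDisconnectedSpace X] [MeasurableSpace X]
  [BorelSpace X] [Countable G] {μ : Measure X}

/-- A uniquely ergodic minimal free action of a finitely generated abelian group whose relation is
orbit equivalent to a clopen piece of measure `9` is orbit equivalent to its threefold
amplification. -/
theorem exists_homeomorph_prod_three [Group.FG G] [Nonempty X] (h : UEMin G μ) {n : ℕ}
    {a : X → X × Fin n} (ha : IsClosedEmbedding a) (hU : IsOpen (range a))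
    (hrel : ∀ (x : X) (g : G), ∃ g' : G, (a (g • x)).1 = g' • (a x).1)
    (hm : (μ.prod Measure.count) (range a) = 9) :
    ∃ Φ : X ≃ₜ X × Fin 3, ∀ x y, (∃ g : G, y = g • x) ↔ ∃ g : G, (Φ y).1 = g • (Φ x).1 := by
  classical
  obtain ⟨F, C, hF⟩ := exists_isBalls G
  obtain ⟨δ, hδ, hdiv⟩ := exists_division h hF ha hU hrel hm
  obtain ⟨S, hS⟩ := Group.fg_def.1 ‹Group.FG G›
  obtain ⟨e, t, hc⟩ := exists_coding h hF hδ hdiv (K := S ∪ S.image fun g => g⁻¹) (by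
    intro g hg
    simp only [Finset.mem_union, Finset.mem_image] at hg ⊢
    rcases hg with hg | ⟨k, hk, rfl⟩
    · exact Or.inr ⟨g, hg, rfl⟩
    · exact Or.inl (by simpa using hk))
  refine hc.exists_homeomorph (top_le_iff.1 (hS ▸ Subgroup.closure_mono ?_))
  simp

theorem uEMin_of_isInvariantMeasure {φ : G →* (X ≃ₜ X)} (hφ : ∀ (g : G) (x : X), φ g x = g • x)
    (hp : Perfect (univ : Set X)) (hmin : IsMinimalRel (orbitRelOf φ)) (hμ : IsProbabilityMeasure μ)
    (hinv : IsInvariantMeasure (orbitRelOf φ) μ)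
    (huniq : ∀ ν : Measure X, IsProbabilityMeasure ν → IsInvariantMeasure (orbitRelOf φ) ν →
      ν = μ) : UEMin G μ where
  prob := hμ
  inv g := by
    have : (fun x : X => g • x) = φ g := funext fun x => (hφ g x).symm
    rw [this]
    exact hinv (φ g) fun x => ⟨g, rfl⟩
  uniq ν hν hi := huniq ν hν fun p hp' => by
    refine Measure.ext fun A hA => ?_
    rw [Measure.map_apply p.continuous.measurable hA]
    have := hi.measure_image_eq (S := p ⁻¹' A) (p := id) (q := p)
      (p.continuous.measurable hA) measurable_id p.continuous.measurable Function.injective_id.injOn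
      p.injective.injOn fun x _ => by
        obtain ⟨g, hg⟩ := hp' x
        exact ⟨g, hg.symm.trans (hφ g x)⟩
    rwa [image_id, image_preimage_eq _ p.surjective] at this
  min x := by
    convert hmin x using 2
    ext y
    exact ⟨fun ⟨g, hg⟩ => ⟨g, by rw [hg, ← hφ]⟩, fun ⟨g, hg⟩ => ⟨g, hg.symm.trans (hφ g x)⟩⟩
  perfect x hx := by
    obtain ⟨y, hy, hne⟩ := accPt_iff_nhds.1 (hp.acc x (mem_univ x)) {x} (hx.mem_nhds rfl)
    exact hne hy.1

end CantorOrbit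

/-- `{9^n : n ∈ ℤ}` is not the fundamental group of any uniquely ergodic
Cantor minimal system arising from a free action of a finitely generated abelian group. -/
theorem statement12 :
    ¬ ∃ (G : Type) (_ : CommGroup G) (_ : Group.FG G)
      (X : Type) (_ : TopologicalSpace X) (_ : MeasurableSpace X),
      BorelSpace X ∧ CompactSpace X ∧ TopologicalSpace.MetrizableSpace X ∧
        TotallyDisconnectedSpace X ∧ Nonempty X ∧ Perfect (Set.univ : Set X) ∧
      ∃ φ : G →* (X ≃ₜ X), IsFreeAction φ ∧ IsMinimalRel (orbitRelOf φ) ∧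
        ∃ μ : Measure X, IsProbabilityMeasure μ ∧ IsInvariantMeasure (orbitRelOf φ) μ ∧
          (∀ ν : Measure X, IsProbabilityMeasure ν → IsInvariantMeasure (orbitRelOf φ) ν →
            ν = μ) ∧
          fundGroup (orbitRelOf φ) μ = {x : ℝ | ∃ n : ℤ, x = (9 : ℝ) ^ n} := by
  rintro ⟨G, _, _, X, _, _, _, _, _, _, _, hp, φ, hfree, hmin, μ, hμ, hinv, huniq, hfund⟩
  let : MulAction G X :=
    { smul g x := φ g x
      one_smul x := by
        change φ 1 x = x
        rw [map_one]
        rfl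
      mul_smul g k x := by
        change φ (g * k) x = φ g (φ k x)
        rw [map_mul]
        rfl }
  have hφ : ∀ (g : G) (x : X), φ g x = g • x := fun _ _ => rfl
  have : ContinuousConstSMul G X := ⟨fun g => (φ g).continuous⟩
  have : CantorOrbit.FreeAct G X := ⟨fun g x hx => by_contra fun hg => hfree g hg x hx⟩
  have : PolishSpace X := by
    let := TopologicalSpace.metrizableSpaceMetric X
    infer_instance
  have : Countable G := by
    obtain ⟨F, C, hF⟩ := CantorOrbit.exists_isBalls G
    refine Set.countable_univ_iff.1 ((Set.countable_iUnion fun r => (F r).countable_toSet).mono ?_)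
    intro g _
    obtain ⟨r, hr⟩ := hF.exhaust g
    exact Set.mem_iUnion.2 ⟨r, hr⟩
  have h : CantorOrbit.UEMin G μ :=
    CantorOrbit.uEMin_of_isInvariantMeasure hφ hp hmin hμ hinv huniq
  have h9 : (9 : ℝ) ∈ fundGroup (orbitRelOf φ) μ := by
    rw [hfund]
    exact ⟨1, by simp⟩
  obtain ⟨n, U, hU, ⟨a, ha⟩, hm⟩ := h9
  have hr : Set.range (fun x => (a x : X × Fin n)) = U := by
    rw [← Function.comp_def, a.surjective.range_comp, Subtype.range_coe]
  obtain ⟨Φ, hΦ⟩ := CantorOrbit.exists_homeomorph_prod_three h (a := fun x => (a x : X × Fin n))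
    (hU.isClosed.isClosedEmbedding_subtypeVal.comp a.isClosedEmbedding) (by rw [hr]; exact hU.isOpen)
    (fun x g => by
      obtain ⟨g', hg'⟩ := (ha x (g • x)).1 ⟨g, rfl⟩
      exact ⟨g', hg'.symm⟩)
    (by
      rw [hr, ← ENNReal.ofReal_toReal (a := (μ.prod Measure.count) U), ← hm]
      · simp
      · intro htop
        rw [htop] at hm
        norm_num at hm)
  have h3 : (3 : ℝ) ∈ fundGroup (orbitRelOf φ) μ := by
    refine ⟨3, Set.univ, isClopen_univ, ⟨Φ.trans (Homeomorph.Set.univ _).symm, fun x y => ?_⟩, ?_⟩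
    · have := hΦ x y
      exact ⟨fun ⟨g, hg⟩ => (this.1 ⟨g, hg.symm⟩).imp fun _ => Eq.symm,
        fun ⟨g, hg⟩ => (this.2 ⟨g, hg.symm⟩).imp fun _ => Eq.symm⟩
    · rw [← Set.univ_prod_univ, Measure.prod_prod]
      simp
  rw [hfund] at h3
  obtain ⟨k, hk⟩ := h3
  have h2k : (3 : ℝ) ^ (1 : ℤ) = 3 ^ (2 * k) := by
    rw [zpow_mul, zpow_one]
    refine hk.trans ?_
    norm_num
  have := zpow_right_injective₀ (by norm_num : (0 : ℝ) < 3) (by norm_num) h2k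
  omega
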